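/- Let A and B be real numbers with 0 < A < B, and for each pair of odd coprime positive integers m, n let a(m, n) be an integer with a(m, n) ≡ −2 (mod m²) and a(m, n) ≡ 2 (mod n²). Then for every D > 0, the sum Σ |θ(x; m²n², a(m, n)) − x/φ(m²n²)|, taken over all pairs of odd coprime positive integers m, n with (log x)^A < m < (log x)^B and (log x)^A < n < (log x)^B, is O(x/(log x)^D) as x → ∞. -/

import Mathlib

open scoped Classical

/-- The Chebyshev function `θ(x; q, a) = ∑_{p < x, p ≡ a [q]} log p`. -/
noncomputable def theta (x : ℝ) (q : ℕ) (a : ℤ) : ℝ :=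
  ∑ p ∈ (Finset.range ⌈x⌉₊).filter
      (fun p : ℕ => p.Prime ∧ (p : ZMod q) = (a : ZMod q)), Real.log p

/-- The mean value of a Dirichlet character over a period. -/
noncomputable def charMean {q : ℕ} [NeZero q] (χ : DirichletCharacter ℂ q) : ℂ :=
  (∑ b : ZMod q, χ b) / q

lemma charMean_eq_zero {q : ℕ} [NeZero q] {χ : DirichletCharacter ℂ q} (hχ : χ ≠ 1) :
    charMean χ = 0 := by
  simp [charMean, MulChar.sum_eq_zero_of_ne_one hχ]

lemma norm_charMean_le {q : ℕ} [NeZero q] (χ : DirichletCharacter ℂ q) : ‖charMean χ‖ ≤ 1 := by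
  have hq : (0 : ℝ) < q := by exact_mod_cast Nat.pos_of_neZero q
  rw [charMean, norm_div, Complex.norm_natCast, div_le_one hq]
  calc ‖∑ b : ZMod q, χ b‖ ≤ ∑ b : ZMod q, ‖χ b‖ := norm_sum_le _ _
    _ ≤ ∑ b : ZMod q, 1 := Finset.sum_le_sum fun b _ => χ.norm_le_one b
    _ = q := by simp

lemma sum_range_period {q : ℕ} [NeZero q] (f : ZMod q → ℂ) (m : ℕ) :
    ∑ i ∈ Finset.range q, f ((m + i : ℕ) : ZMod q) = ∑ b : ZMod q, f b := by
  rw [← Equiv.sum_comp (Equiv.addLeft (m : ZMod q)) f]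
  refine Finset.sum_nbij' (fun i => (i : ZMod q)) (fun b => b.val) ?_ ?_ ?_ ?_ ?_
  · simp
  · intro b _; simpa using ZMod.val_lt b
  · intro i hi; exact ZMod.val_cast_of_lt (by simpa using hi)
  · intro b _; simp
  · intro i _; simp

lemma norm_sum_range_sub_le {q : ℕ} [NeZero q] (χ : DirichletCharacter ℂ q) (m n : ℕ) :
    ‖∑ i ∈ Finset.range n, χ ((m + i : ℕ) : ZMod q) - charMean χ * n‖ ≤ 2 * q := by
  have hq0 : (q : ℂ) ≠ 0 := by exact_mod_cast NeZero.ne q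
  induction n using Nat.strong_induction_on generalizing m with
  | _ n ih =>
    by_cases h : n < q
    · calc _ ≤ ‖∑ i ∈ Finset.range n, χ ((m + i : ℕ) : ZMod q)‖ + ‖charMean χ * n‖ := norm_sub_le _ _
        _ ≤ n + n := by
          gcongr
          · calc _ ≤ ∑ i ∈ Finset.range n, ‖χ ((m + i : ℕ) : ZMod q)‖ := norm_sum_le _ _
              _ ≤ ∑ i ∈ Finset.range n, 1 := Finset.sum_le_sum fun b _ => χ.norm_le_one _
              _ = n := by simp
          · rw [norm_mul, Complex.norm_natCast]
            exact mul_le_of_le_one_left (by positivity) (norm_charMean_le χ)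
        _ ≤ 2 * q := by
          have : (n : ℝ) ≤ q := by exact_mod_cast h.le
          linarith
    · obtain ⟨k, rfl⟩ := Nat.exists_eq_add_of_le (not_lt.mp h)
      have h1 := ih k (by have := Nat.pos_of_neZero q; omega) (m + q)
      have h2 := sum_range_period (q := q) χ m
      rw [Finset.sum_range_add, h2]
      convert h1 using 2
      have : (∑ b : ZMod q, χ b) = charMean χ * q := by
        rw [charMean]; field_simp
      rw [this]
      push_cast
      simp only [add_assoc]
      ring

/-- The remainder in the sum of `χ` over `(M, t]`. -/
noncomputable def charRem {q : ℕ} [NeZero q] (χ : DirichletCharacter ℂ q) (M : ℕ) (t : ℝ) : ℂ :=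
  ∑ k ∈ Finset.Ioc M ⌊t⌋₊, χ (k : ZMod q) - charMean χ * (t - M)

lemma norm_charRem_le {q : ℕ} [NeZero q] (χ : DirichletCharacter ℂ q) (M : ℕ) {t : ℝ}
    (ht : M ≤ t) : ‖charRem χ M t‖ ≤ 3 * q := by
  have ht0 : 0 ≤ t := le_trans (by positivity) ht
  have hM : M ≤ ⌊t⌋₊ := Nat.le_floor ht
  have hq : (1 : ℝ) ≤ q := by exact_mod_cast Nat.pos_of_neZero q
  have h1 := norm_sum_range_sub_le χ (M + 1) (⌊t⌋₊ - M)
  have h2 : ∑ k ∈ Finset.Ioc M ⌊t⌋₊, χ (k : ZMod q) =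
      ∑ i ∈ Finset.range (⌊t⌋₊ - M), χ ((M + 1 + i : ℕ) : ZMod q) := by
    rw [← Finset.Ico_add_one_add_one_eq_Ioc, Finset.sum_Ico_eq_sum_range]
    congr 2
    omega
  have h3 : charRem χ M t = (∑ i ∈ Finset.range (⌊t⌋₊ - M), χ ((M + 1 + i : ℕ) : ZMod q)
      - charMean χ * ((⌊t⌋₊ - M : ℕ) : ℂ)) - charMean χ * ((t - ⌊t⌋₊ : ℝ) : ℂ) := by
    rw [charRem, h2, Nat.cast_sub hM]; push_cast; ring
  rw [h3]
  refine (norm_sub_le _ _).trans ?_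
  have h4 : ‖charMean χ * ((t - ⌊t⌋₊ : ℝ) : ℂ)‖ ≤ 1 := by
    rw [norm_mul, Complex.norm_real, Real.norm_eq_abs]
    have := Nat.floor_le ht0
    have := (Nat.lt_floor_add_one t).le
    have : |t - ⌊t⌋₊| ≤ 1 := by rw [abs_le]; constructor <;> linarith
    exact mul_le_one₀ (norm_charMean_le χ) (abs_nonneg _) this
  linarith

lemma measurable_charRem {q : ℕ} [NeZero q] (χ : DirichletCharacter ℂ q) (M : ℕ) :
    Measurable (charRem χ M) := by
  unfold charRem
  have : Measurable (fun n : ℕ => ∑ k ∈ Finset.Ioc M n, χ (k : ZMod q)) := measurable_from_top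
  exact (this.comp Nat.measurable_floor).sub (by fun_prop)

/-- The truncated remainder. -/
noncomputable def charTail {q : ℕ} [NeZero q] (χ : DirichletCharacter ℂ q) (M : ℕ) (s : ℂ) : ℂ :=
  ∫ t in Set.Ioi (M : ℝ), charRem χ M t * (t : ℂ) ^ (-(s + 1))

lemma norm_charTail_integrand_le {q : ℕ} [NeZero q] (χ : DirichletCharacter ℂ q) {M : ℕ}
    (s : ℂ) {t : ℝ} (ht : t ∈ Set.Ioi (M : ℝ)) :
    ‖charRem χ M t * (t : ℂ) ^ (-(s + 1))‖ ≤ 3 * q * t ^ (-s.re - 1) := by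
  have ht0 : 0 < t := lt_of_le_of_lt (by positivity) (Set.mem_Ioi.mp ht)
  rw [norm_mul, Complex.norm_cpow_eq_rpow_re_of_pos ht0]
  have : (-(s + 1)).re = -s.re - 1 := by simp; ring
  rw [this]
  gcongr
  exact norm_charRem_le χ M (le_of_lt ht)

lemma integrableOn_charTail {q : ℕ} [NeZero q] (χ : DirichletCharacter ℂ q) {M : ℕ} (hM : 0 < M)
    {s : ℂ} (hs : 0 < s.re) :
    MeasureTheory.IntegrableOn (fun t : ℝ => charRem χ M t * (t : ℂ) ^ (-(s + 1)))
      (Set.Ioi (M : ℝ)) := by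
  have hM' : (0 : ℝ) < M := by exact_mod_cast hM
  have h := (integrableOn_Ioi_rpow_of_lt (a := -s.re - 1) (by linarith) hM').const_mul (3 * q : ℝ)
  refine MeasureTheory.Integrable.mono' h ?_ ?_
  · exact ((measurable_charRem χ M).mul (by fun_prop)).aestronglyMeasurable
  · filter_upwards [MeasureTheory.ae_restrict_mem measurableSet_Ioi] with t ht
    exact norm_charTail_integrand_le χ s ht

lemma norm_charTail_le {q : ℕ} [NeZero q] (χ : DirichletCharacter ℂ q) {M : ℕ} (hM : 0 < M)
    {s : ℂ} (hs : 0 < s.re) : ‖charTail χ M s‖ ≤ 3 * q * (M : ℝ) ^ (-s.re) / s.re := by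
  have hM' : (0 : ℝ) < M := by exact_mod_cast hM
  have h := (integrableOn_Ioi_rpow_of_lt (a := -s.re - 1) (by linarith) hM').const_mul (3 * q : ℝ)
  calc _ ≤ ∫ t in Set.Ioi (M : ℝ), 3 * q * t ^ (-s.re - 1) := by
        refine MeasureTheory.norm_integral_le_of_norm_le h ?_
        filter_upwards [MeasureTheory.ae_restrict_mem measurableSet_Ioi] with t ht
        exact norm_charTail_integrand_le χ s ht
    _ = _ := by
        rw [MeasureTheory.integral_const_mul, integral_Ioi_rpow_of_lt (by linarith) hM']
        rw [show -s.re - 1 + 1 = -s.re by ring]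
        field_simp

lemma differentiableAt_charTail {q : ℕ} [NeZero q] (χ : DirichletCharacter ℂ q) {M : ℕ}
    (hM : 0 < M) {s : ℂ} (hs : 0 < s.re) : DifferentiableAt ℂ (charTail χ M) s := by
  have hM' : (0 : ℝ) < M := by exact_mod_cast hM
  set f : ℝ → ℂ := (Set.Ioi (M : ℝ)).indicator (charRem χ M) with hf
  have hmeas : Measurable f := (measurable_charRem χ M).indicator measurableSet_Ioi
  have hbd : ∀ t, ‖f t‖ ≤ 3 * q := by
    intro t
    by_cases h : t ∈ Set.Ioi (M : ℝ)
    · rw [hf, Set.indicator_of_mem h]; exact norm_charRem_le χ M (le_of_lt h)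
    · rw [hf, Set.indicator_of_notMem h]; simp
  have heq : charTail χ M = fun s => mellin f (-s) := by
    funext s
    rw [mellin, charTail]
    have : ∀ t : ℝ, (t : ℂ) ^ (-s - 1) • f t =
        (Set.Ioi (M : ℝ)).indicator (fun t : ℝ => charRem χ M t * (t : ℂ) ^ (-(s + 1))) t := by
      intro t
      rw [hf, smul_eq_mul]
      by_cases h : t ∈ Set.Ioi (M : ℝ)
      · rw [Set.indicator_of_mem h, Set.indicator_of_mem h, mul_comm]; ring_nf
      · rw [Set.indicator_of_notMem h, Set.indicator_of_notMem h, mul_zero]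
    simp_rw [this]
    rw [MeasureTheory.setIntegral_indicator measurableSet_Ioi]
    congr 2
    ext t; simp only [Set.mem_inter_iff, Set.mem_Ioi]
    exact ⟨fun h => ⟨hM'.trans h, h⟩, fun h => h.2⟩
  rw [heq]
  refine DifferentiableAt.fun_comp' (f := fun s : ℂ => -s) s ?_ (by fun_prop)
  refine mellin_differentiableAt_of_isBigO_rpow (a := 0) (b := -s.re - 1) ?_ ?_ (by simpa using hs)
    ?_ (by simp)
  · refine (MeasureTheory.LocallyIntegrable.locallyIntegrableOn ?_ _)
    refine (MeasureTheory.locallyIntegrable_const (3 * q : ℝ)).mono hmeas.aestronglyMeasurable ?_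
    filter_upwards with t
    rw [Real.norm_of_nonneg (by positivity)]
    exact hbd t
  · simp only [neg_zero, Real.rpow_zero]
    exact Asymptotics.IsBigO.of_bound (3 * q) (by filter_upwards with t; simpa using hbd t)
  · refine Asymptotics.IsBigO.of_bound 0 ?_
    have : Set.Ioo (0 : ℝ) M ∈ nhdsWithin 0 (Set.Ioi 0) := Ioo_mem_nhdsGT hM'
    filter_upwards [this] with t ht
    rw [hf, Set.indicator_of_notMem (by simp [ht.2.le])]
    simp

/-- The approximation of `L(s, χ)` by a partial sum, in the half-plane `1 < re s`. -/
lemma LFunction_eq_truncated_of_one_lt {q : ℕ} [NeZero q] (χ : DirichletCharacter ℂ q) {M : ℕ}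
    (hM : 0 < M) {s : ℂ} (hs : 1 < s.re) :
    DirichletCharacter.LFunction χ s = ∑ k ∈ Finset.Icc 1 M, χ (k : ZMod q) * (k : ℂ) ^ (-s) +
      charMean χ * (M : ℂ) ^ (1 - s) / (s - 1) + s * charTail χ M s := by
  have hM' : (0 : ℝ) < M := by exact_mod_cast hM
  have hs0 : s ≠ 0 := by rintro rfl; simp at hs; linarith
  have hs1 : s - 1 ≠ 0 := by
    intro h; rw [sub_eq_zero] at h; rw [h] at hs; simp at hs
  rw [DirichletCharacter.LFunction_eq_LSeries χ hs]
  have hbig : ∀ g : ℕ → ℂ, (∀ n, ‖g n‖ ≤ 1) →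
      (fun n ↦ ∑ k ∈ Finset.Icc 1 n, ‖g k‖) =O[Filter.atTop] fun n ↦ (n : ℝ) ^ (1 : ℝ) := by
    intro g hg
    refine Asymptotics.IsBigO.of_bound 1 (Filter.Eventually.of_forall fun n => ?_)
    rw [Real.rpow_one, one_mul, Real.norm_of_nonneg (Finset.sum_nonneg fun _ _ => norm_nonneg _)]
    calc _ ≤ ∑ k ∈ Finset.Icc 1 n, (1 : ℝ) := Finset.sum_le_sum fun k _ => hg k
      _ = n := by simp
      _ ≤ _ := Real.le_norm_self _
  set g : ℕ → ℂ := fun n => if n ≤ M then 0 else χ (n : ZMod q) with hg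
  set h : ℕ → ℂ := fun n => if n ≤ M then χ (n : ZMod q) else 0 with hh
  have hg1 : ∀ n, ‖g n‖ ≤ 1 := by
    intro n; rw [hg]; dsimp only; split_ifs <;> simp [χ.norm_le_one]
  have hh1 : ∀ n, ‖h n‖ ≤ 1 := by
    intro n; rw [hh]; dsimp only; split_ifs <;> simp [χ.norm_le_one]
  have hgh : (fun n : ℕ => χ (n : ZMod q)) = h + g := by
    funext n; simp only [hg, hh, Pi.add_apply]; split_ifs <;> simp
  rw [hgh, LSeries_add (LSeriesSummable_of_sum_norm_bigO (hbig h hh1) zero_le_one hs)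
    (LSeriesSummable_of_sum_norm_bigO (hbig g hg1) zero_le_one hs),
    LSeries_eq_mul_integral' g zero_le_one hs (hbig g hg1), add_assoc]
  congr 1
  · rw [LSeries, tsum_eq_sum (s := Finset.Icc 1 M)]
    · refine Finset.sum_congr rfl fun k hk => ?_
      rw [Finset.mem_Icc] at hk
      rw [LSeries.term_of_ne_zero (by omega), hh]
      simp only [hk.2, if_true]
      rw [Complex.cpow_neg, div_eq_mul_inv]
    · intro k hk
      rcases Nat.eq_zero_or_pos k with rfl | hk0
      · simp
      · rw [LSeries.term_of_ne_zero (by omega), hh]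
        rw [Finset.mem_Icc] at hk
        simp only [show ¬ k ≤ M by omega, if_false, zero_div]
  · have hsum : ∀ t : ℝ, ∑ k ∈ Finset.Icc 1 ⌊t⌋₊, g k =
        ∑ k ∈ Finset.Ioc M ⌊t⌋₊, χ (k : ZMod q) := by
      intro t
      rw [hg]
      rw [Finset.sum_ite, Finset.sum_const_zero, zero_add]
      refine Finset.sum_congr ?_ fun _ _ => rfl
      ext k; simp only [Finset.mem_filter, Finset.mem_Icc, Finset.mem_Ioc]; omega
    have h1 : ∫ t in Set.Ioi (1 : ℝ), (∑ k ∈ Finset.Icc 1 ⌊t⌋₊, g k) * (t : ℂ) ^ (-(s + 1)) =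
        ∫ t in Set.Ioi (M : ℝ), (∑ k ∈ Finset.Icc 1 ⌊t⌋₊, g k) * (t : ℂ) ^ (-(s + 1)) := by
      refine MeasureTheory.setIntegral_eq_of_subset_of_forall_sdiff_eq_zero measurableSet_Ioi ?_ ?_
      · exact Set.Ioi_subset_Ioi (by exact_mod_cast hM)
      · intro t ht
        have : ¬ ((M : ℝ) < t) := ht.2
        have : ⌊t⌋₊ ≤ M := by
          have := Nat.floor_le_floor (not_lt.mp this)
          simpa using this
        rw [hsum, Finset.Ioc_eq_empty_of_le this]; simp
    have h2 : ∀ t ∈ Set.Ioi (M : ℝ), (∑ k ∈ Finset.Icc 1 ⌊t⌋₊, g k) * (t : ℂ) ^ (-(s + 1)) =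
        charRem χ M t * (t : ℂ) ^ (-(s + 1)) +
        (charMean χ * (t : ℂ) ^ (-s) - charMean χ * M * (t : ℂ) ^ (-(s + 1))) := by
      intro t ht
      have ht0 : (t : ℂ) ≠ 0 := by exact_mod_cast (hM'.trans ht).ne'
      rw [hsum, charRem, show -s = -(s + 1) + 1 by ring, Complex.cpow_add _ _ ht0, Complex.cpow_one]
      ring
    have i1 : MeasureTheory.IntegrableOn (fun t : ℝ => (t : ℂ) ^ (-s)) (Set.Ioi (M : ℝ)) :=
      integrableOn_Ioi_cpow_of_lt (by simpa using hs) hM'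
    have i2 : MeasureTheory.IntegrableOn (fun t : ℝ => (t : ℂ) ^ (-(s + 1))) (Set.Ioi (M : ℝ)) :=
      integrableOn_Ioi_cpow_of_lt (by simp; linarith) hM'
    have i3 : MeasureTheory.IntegrableOn (fun t : ℝ => charMean χ * (t : ℂ) ^ (-s) -
        charMean χ * M * (t : ℂ) ^ (-(s + 1))) (Set.Ioi (M : ℝ)) :=
      (i1.const_mul _).sub (i2.const_mul _)
    rw [h1, MeasureTheory.setIntegral_congr_fun measurableSet_Ioi h2,
      MeasureTheory.integral_add (integrableOn_charTail χ hM (by linarith)) i3,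
      MeasureTheory.integral_sub (i1.const_mul _) (i2.const_mul _),
      MeasureTheory.integral_const_mul, MeasureTheory.integral_const_mul,
      integral_Ioi_cpow_of_lt (by simpa using hs) hM',
      integral_Ioi_cpow_of_lt (by simp; linarith) hM', charTail]
    have hMc : ((M : ℝ) : ℂ) ≠ 0 := by exact_mod_cast hM'.ne'
    rw [show -(s + 1) + 1 = -s by ring, show -s + 1 = 1 + -s by ring, show (1 : ℂ) - s = 1 + -s by ring,
      Complex.cpow_add _ _ hMc, Complex.cpow_one]
    have hs1' : 1 + -s ≠ 0 := by
      intro h; apply hs1; linear_combination -h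
    push_cast
    rw [Complex.cpow_add _ _ (by exact_mod_cast hMc), Complex.cpow_one]
    field_simp
    ring

lemma isPreconnected_punctured_halfPlane : IsPreconnected ({z : ℂ | 0 < z.re} \ {1}) := by
  have e : ({z : ℂ | 0 < z.re} \ {1}) = (({z : ℂ | 0 < z.re} ∩ {z : ℂ | 0 < z.im}) ∪
      {z : ℂ | 1 < z.re}) ∪ ({z : ℂ | 0 < z.re} ∩ {z : ℂ | z.im < 0}) ∪
      ({z : ℂ | 0 < z.re} ∩ {z : ℂ | z.re < 1}) := by
    ext z
    have : z = 1 ↔ z.re = 1 ∧ z.im = 0 := by rw [Complex.ext_iff]; simp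
    simp only [Set.mem_sdiff, Set.mem_ofPred_eq, Set.mem_singleton_iff, this, Set.mem_union,
      Set.mem_inter_iff]
    constructor
    · rintro ⟨h1, h2⟩
      rcases lt_trichotomy z.re 1 with h | h | h
      · exact .inr ⟨h1, h⟩
      · rcases lt_trichotomy z.im 0 with h' | h' | h'
        · exact .inl (.inr ⟨h1, h'⟩)
        · exact absurd ⟨h, h'⟩ h2
        · exact .inl (.inl (.inl ⟨h1, h'⟩))
      · exact .inl (.inl (.inr h))
    · rintro (((h | h) | h) | h)
      · exact ⟨h.1, fun h' => h.2.ne' h'.2⟩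
      · exact ⟨by linarith, fun h' => h.ne' h'.1⟩
      · exact ⟨h.1, fun h' => h.2.ne h'.2⟩
      · exact ⟨h.1, fun h' => h.2.ne h'.1⟩
  have c0 : Convex ℝ {z : ℂ | 0 < z.re} := convex_halfSpace_re_gt 0
  rw [e]
  refine IsPreconnected.union (1 / 2 + Complex.I) ?_ ?_ (IsPreconnected.union (2 - Complex.I) ?_ ?_
    (IsPreconnected.union (2 + Complex.I) ?_ ?_ ?_ ?_) ?_) ?_
  · exact .inl (.inl ⟨by norm_num, by norm_num⟩)
  · exact ⟨by norm_num, by norm_num⟩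
  · exact .inr (by norm_num)
  · exact ⟨by norm_num, by norm_num⟩
  · exact ⟨by norm_num, by norm_num⟩
  · show (1 : ℝ) < (2 + Complex.I).re
    norm_num
  · exact (c0.inter (convex_halfSpace_im_gt 0)).isPreconnected
  · exact (convex_halfSpace_re_gt 1).isPreconnected
  · exact (c0.inter (convex_halfSpace_im_lt 0)).isPreconnected
  · exact (c0.inter (convex_halfSpace_re_lt 1)).isPreconnected

/-- The approximation of `L(s, χ)` by a partial sum, in the half-plane `0 < re s`. -/
lemma LFunction_eq_truncated {q : ℕ} [NeZero q] (χ : DirichletCharacter ℂ q) {M : ℕ}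
    (hM : 0 < M) {s : ℂ} (hs : 0 < s.re) (hs1 : s ≠ 1) :
    DirichletCharacter.LFunction χ s = ∑ k ∈ Finset.Icc 1 M, χ (k : ZMod q) * (k : ℂ) ^ (-s) +
      charMean χ * (M : ℂ) ^ (1 - s) / (s - 1) + s * charTail χ M s := by
  have hMc : (M : ℂ) ≠ 0 := by exact_mod_cast hM.ne'
  set U : Set ℂ := {z | 0 < z.re} \ {1} with hU
  have hopen : IsOpen {z : ℂ | 0 < z.re} := isOpen_lt continuous_const Complex.continuous_re
  have hUo : IsOpen U := hopen.sdiff isClosed_singleton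
  have hUc : IsPreconnected U := isPreconnected_punctured_halfPlane
  have hL : AnalyticOnNhd ℂ (DirichletCharacter.LFunction χ) U := by
    refine DifferentiableOn.analyticOnNhd (fun z hz => ?_) hUo
    exact (χ.differentiableAt_LFunction z (.inl hz.2)).differentiableWithinAt
  have hR : AnalyticOnNhd ℂ (fun s : ℂ => ∑ k ∈ Finset.Icc 1 M, χ (k : ZMod q) * (k : ℂ) ^ (-s) +
      charMean χ * (M : ℂ) ^ (1 - s) / (s - 1) + s * charTail χ M s) U := by
    refine DifferentiableOn.analyticOnNhd (fun z hz => DifferentiableAt.differentiableWithinAt ?_) hUo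
    have h1 := differentiableAt_charTail χ hM (s := z) hz.1
    have h2 : z - 1 ≠ 0 := sub_ne_zero.mpr hz.2
    have h3 : ∀ k ∈ Finset.Icc 1 M, DifferentiableAt ℂ (fun s : ℂ => χ (k : ZMod q) * (k : ℂ) ^ (-s)) z := by
      intro k hk
      have : (k : ℂ) ≠ 0 := by
        rw [Finset.mem_Icc] at hk; exact_mod_cast (by omega : k ≠ 0)
      exact (DifferentiableAt.const_cpow (by fun_prop) (.inl this)).const_mul _
    have h4 : DifferentiableAt ℂ (fun s : ℂ => (M : ℂ) ^ (1 - s)) z :=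
      DifferentiableAt.const_cpow (by fun_prop) (.inl hMc)
    exact ((DifferentiableAt.fun_sum h3).add ((h4.const_mul _).div (by fun_prop) h2)).add
      (differentiableAt_id.mul h1)
  have h2U : (2 : ℂ) ∈ U := by
    refine ⟨by simp, by simp⟩
  have hev : DirichletCharacter.LFunction χ =ᶠ[nhds 2] (fun s : ℂ => ∑ k ∈ Finset.Icc 1 M,
      χ (k : ZMod q) * (k : ℂ) ^ (-s) +
      charMean χ * (M : ℂ) ^ (1 - s) / (s - 1) + s * charTail χ M s) := by
    have : {z : ℂ | 1 < z.re} ∈ nhds (2 : ℂ) :=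
      (isOpen_lt continuous_const Complex.continuous_re).mem_nhds (by simp)
    filter_upwards [this] with z hz
    exact LFunction_eq_truncated_of_one_lt χ hM hz
  exact hL.eqOn_of_preconnected_of_eventuallyEq hR hUc h2U hev ⟨hs, hs1⟩

lemma norm_sum_char_cpow_le {q : ℕ} [NeZero q] (χ : DirichletCharacter ℂ q) {M : ℕ} (hM : 0 < M)
    {η : ℝ} (hη : 0 < η) {s : ℂ} (hs : 1 - η ≤ s.re) :
    ‖∑ k ∈ Finset.Icc 1 M, χ (k : ZMod q) * (k : ℂ) ^ (-s)‖ ≤ (M : ℝ) ^ η * (1 + Real.log M) := by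
  have hM' : (1 : ℝ) ≤ M := by exact_mod_cast hM
  calc _ ≤ ∑ k ∈ Finset.Icc 1 M, ‖χ (k : ZMod q) * (k : ℂ) ^ (-s)‖ := norm_sum_le _ _
    _ ≤ ∑ k ∈ Finset.Icc 1 M, (M : ℝ) ^ η * (k : ℝ)⁻¹ := by
      refine Finset.sum_le_sum fun k hk => ?_
      rw [Finset.mem_Icc] at hk
      have hk0 : (1 : ℝ) ≤ k := by exact_mod_cast hk.1
      have hkM : (k : ℝ) ≤ M := by exact_mod_cast hk.2
      have hk0' : (0 : ℝ) < k := by linarith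
      rw [norm_mul, Complex.norm_natCast_cpow_of_pos (by omega)]
      calc _ ≤ 1 * (k : ℝ) ^ (-s).re := by gcongr; exact χ.norm_le_one _
        _ ≤ (k : ℝ) ^ (η + -1) := by
          rw [one_mul]
          apply Real.rpow_le_rpow_of_exponent_le hk0
          simp; linarith
        _ = (k : ℝ) ^ η * (k : ℝ)⁻¹ := by
          rw [Real.rpow_add hk0', Real.rpow_neg_one]
        _ ≤ _ := by gcongr
    _ = (M : ℝ) ^ η * ∑ k ∈ Finset.Icc 1 M, (k : ℝ)⁻¹ := by rw [Finset.mul_sum]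
    _ ≤ _ := by
      gcongr
      have := harmonic_le_one_add_log M
      rw [harmonic_eq_sum_Icc] at this
      push_cast at this
      exact this

/-- The analytic conductor-like quantity controlling the size of `L(s, χ)`. -/
noncomputable def condSize (q : ℕ) (s : ℂ) : ℝ := q * (‖s‖ + 2)

lemma two_le_condSize (q : ℕ) [NeZero q] (s : ℂ) : 2 ≤ condSize q s := by
  have hq : (1 : ℝ) ≤ q := by exact_mod_cast Nat.pos_of_neZero q
  unfold condSize
  nlinarith [norm_nonneg s]

lemma norm_LFunction_le_aux {q : ℕ} [NeZero q] (χ : DirichletCharacter ℂ q) {η : ℝ} (hη : 0 < η)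
    (hη2 : η ≤ 1 / 2) {s : ℂ} (hs : 1 - η ≤ s.re) (hs1 : s ≠ 1) :
    ‖DirichletCharacter.LFunction χ s‖ ≤
      2 * (7 + 1 / η) * condSize q s ^ (2 * η) * (1 + ‖charMean χ‖ / ‖s - 1‖) := by
  set Q := condSize q s with hQ
  have hQ2 : 2 ≤ Q := two_le_condSize q s
  set M := ⌈Q⌉₊ with hMdef
  have hMQ : Q ≤ M := Nat.le_ceil Q
  have hMQ2 : (M : ℝ) ≤ 2 * Q := by
    have := (Nat.ceil_lt_add_one (by linarith : 0 ≤ Q)).le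
    linarith
  have hM1 : (1 : ℝ) ≤ M := by linarith
  have hM0 : (0 : ℝ) < M := by linarith
  have hM : 0 < M := by exact_mod_cast hM0
  have hσ : 1 / 2 ≤ s.re := by linarith
  have hs1' : 0 < ‖s - 1‖ := norm_pos_iff.mpr (sub_ne_zero.mpr hs1)
  rw [LFunction_eq_truncated χ hM (by linarith) hs1]
  have b1 := norm_sum_char_cpow_le χ hM hη hs
  have b2 : ‖charMean χ * (M : ℂ) ^ (1 - s) / (s - 1)‖ ≤ (M : ℝ) ^ η * (‖charMean χ‖ / ‖s - 1‖) := by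
    rw [norm_div, norm_mul, Complex.norm_natCast_cpow_of_pos hM]
    have : (M : ℝ) ^ (1 - s).re ≤ (M : ℝ) ^ η :=
      Real.rpow_le_rpow_of_exponent_le hM1 (by simp; linarith)
    rw [mul_comm, mul_div_assoc]
    gcongr
  have b3 : ‖s * charTail χ M s‖ ≤ (M : ℝ) ^ η * 6 := by
    rw [norm_mul]
    have hM2 : (M : ℝ) ^ (-s.re) ≤ (M : ℝ) ^ η * (M : ℝ)⁻¹ := by
      rw [← Real.rpow_neg_one, ← Real.rpow_add hM0]
      exact Real.rpow_le_rpow_of_exponent_le hM1 (by linarith)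
    have hsq : ‖s‖ * q ≤ M := by
      refine le_trans ?_ hMQ
      rw [hQ, condSize]
      have : (0 : ℝ) ≤ q := by positivity
      nlinarith
    have hσ0 : 0 < s.re := by linarith
    calc _ ≤ ‖s‖ * (3 * q * (M : ℝ) ^ (-s.re) / s.re) := by
          gcongr; exact norm_charTail_le χ hM (by linarith)
      _ ≤ ‖s‖ * (3 * q * ((M : ℝ) ^ η * (M : ℝ)⁻¹) / (1 / 2)) := by
          gcongr
      _ = 6 * (M : ℝ) ^ η * ((‖s‖ * q) * (M : ℝ)⁻¹) := by ring
      _ ≤ 6 * (M : ℝ) ^ η * (M * (M : ℝ)⁻¹) := by gcongr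
      _ = _ := by rw [mul_inv_cancel₀ hM0.ne']; ring
  have b4 : Real.log M ≤ (M : ℝ) ^ η / η := Real.log_le_rpow_div hM0.le hη
  have hMη : 1 ≤ (M : ℝ) ^ η := Real.one_le_rpow hM1 hη.le
  have hκ : 0 ≤ ‖charMean χ‖ / ‖s - 1‖ := by positivity
  have b5 : (M : ℝ) ^ η * (M : ℝ) ^ η ≤ 2 * Q ^ (2 * η) := by
    rw [← Real.rpow_add hM0, ← two_mul]
    calc (M : ℝ) ^ (2 * η) ≤ (2 * Q) ^ (2 * η) := by gcongr
      _ = 2 ^ (2 * η) * Q ^ (2 * η) := by rw [Real.mul_rpow] <;> linarith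
      _ ≤ 2 ^ (1 : ℝ) * Q ^ (2 * η) := by
        gcongr
        · norm_num
        · linarith
      _ = _ := by rw [Real.rpow_one]
  calc _ ≤ (M : ℝ) ^ η * (1 + Real.log M) + (M : ℝ) ^ η * (‖charMean χ‖ / ‖s - 1‖)
        + (M : ℝ) ^ η * 6 := (norm_add₃_le).trans (by gcongr)
    _ ≤ (M : ℝ) ^ η * (1 + (M : ℝ) ^ η / η) + (M : ℝ) ^ η * (‖charMean χ‖ / ‖s - 1‖)
        + (M : ℝ) ^ η * 6 := by gcongr
    _ = (M : ℝ) ^ η * (7 + (M : ℝ) ^ η / η + ‖charMean χ‖ / ‖s - 1‖) := by ring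
    _ ≤ (M : ℝ) ^ η * ((M : ℝ) ^ η * ((7 + 1 / η) * (1 + ‖charMean χ‖ / ‖s - 1‖))) := by
      gcongr
      have : (M : ℝ) ^ η * ((7 + 1 / η) * (1 + ‖charMean χ‖ / ‖s - 1‖)) =
        (7 * (M : ℝ) ^ η + (M : ℝ) ^ η / η) +
          ((M : ℝ) ^ η * (7 + 1 / η)) * (‖charMean χ‖ / ‖s - 1‖) := by ring
      rw [this]
      have h1 : 1 ≤ (M : ℝ) ^ η * (7 + 1 / η) := by
        have : 0 < 1 / η := by positivity
        nlinarith
      nlinarith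
    _ = ((M : ℝ) ^ η * (M : ℝ) ^ η) * ((7 + 1 / η) * (1 + ‖charMean χ‖ / ‖s - 1‖)) := by ring
    _ ≤ (2 * Q ^ (2 * η)) * ((7 + 1 / η) * (1 + ‖charMean χ‖ / ‖s - 1‖)) := by gcongr
    _ = _ := by ring

/-- The `L`-function of `χ`, with the pole removed when `χ` is trivial. -/
noncomputable def regL {q : ℕ} [NeZero q] (χ : DirichletCharacter ℂ q) (s : ℂ) : ℂ :=
  if χ = 1 then DirichletCharacter.LFunctionTrivChar₁ q s / (s + 1)
  else DirichletCharacter.LFunction χ s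

lemma regL_one_of_ne {q : ℕ} [NeZero q] {s : ℂ} (hs : s ≠ 1) :
    regL (1 : DirichletCharacter ℂ q) s =
      DirichletCharacter.LFunction (1 : DirichletCharacter ℂ q) s * ((s - 1) / (s + 1)) := by
  simp only [regL, if_true, DirichletCharacter.LFunctionTrivChar₁, Function.update_of_ne hs,
    DirichletCharacter.LFunctionTrivChar]
  ring

lemma regL_of_ne_one {q : ℕ} [NeZero q] {χ : DirichletCharacter ℂ q} (hχ : χ ≠ 1) :
    regL χ = DirichletCharacter.LFunction χ := by
  funext s; simp [regL, hχ]

lemma differentiableAt_regL {q : ℕ} [NeZero q] (χ : DirichletCharacter ℂ q) {s : ℂ}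
    (hs : 0 < s.re) : DifferentiableAt ℂ (regL χ) s := by
  by_cases h : χ = 1
  · have : regL χ = fun s => DirichletCharacter.LFunctionTrivChar₁ q s / (s + 1) := by
      funext s; simp [regL, h]
    rw [this]
    refine (DirichletCharacter.differentiable_LFunctionTrivChar₁ q s).div (by fun_prop) ?_
    intro h0
    have := congrArg Complex.re h0
    simp at this; linarith
  · rw [regL_of_ne_one h]
    exact DirichletCharacter.differentiable_LFunction h s

lemma one_le_norm_add_one {s : ℂ} (hs : 0 < s.re) : 1 ≤ ‖s + 1‖ := by
  have := Complex.re_le_norm (s + 1)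
  simp at this; linarith

lemma norm_regL_le {ε : ℝ} (hε : 0 < ε) (hε1 : ε ≤ 1) :
    ∃ C : ℝ, 1 ≤ C ∧ ∀ (q : ℕ) [NeZero q] (χ : DirichletCharacter ℂ q) (s : ℂ),
      1 - ε / 2 ≤ s.re → ‖regL χ s‖ ≤ C * condSize q s ^ ε := by
  refine ⟨2 * (7 + 2 / ε) * 4, ?_, ?_⟩
  · have : 0 < 2 / ε := by positivity
    linarith
  intro q _ χ
  have main : ∀ s : ℂ, 1 - ε / 2 ≤ s.re → s ≠ 1 →
      ‖regL χ s‖ ≤ 2 * (7 + 2 / ε) * 4 * condSize q s ^ ε := by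
    intro s hs hs1
    have hQ := two_le_condSize q s
    have h := norm_LFunction_le_aux χ (η := ε / 2) (by positivity) (by linarith) hs hs1
    have hs1' : 0 < ‖s - 1‖ := norm_pos_iff.mpr (sub_ne_zero.mpr hs1)
    have hA : 0 ≤ 2 * (7 + 1 / (ε / 2)) * condSize q s ^ (2 * (ε / 2)) := by positivity
    have e : 2 * (7 + 1 / (ε / 2)) * condSize q s ^ (2 * (ε / 2)) =
      2 * (7 + 2 / ε) * condSize q s ^ ε := by
      rw [show 2 * (ε / 2) = ε by ring]; field_simp
    rw [e] at h hA
    by_cases h1 : χ = 1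
    · subst h1
      have hs0 : 0 < s.re := by linarith
      have hp := one_le_norm_add_one hs0
      rw [regL_one_of_ne hs1, norm_mul, norm_div]
      have hc := norm_charMean_le (1 : DirichletCharacter ℂ q)
      have h3 : ‖s - 1‖ ≤ ‖s + 1‖ + 2 := by
        calc ‖s - 1‖ = ‖(s + 1) - 2‖ := by ring_nf
          _ ≤ _ := (norm_sub_le _ _).trans (by simp)
      calc _ ≤ (2 * (7 + 2 / ε) * condSize q s ^ ε * (1 + 1 / ‖s - 1‖)) * (‖s - 1‖ / ‖s + 1‖) := by
            gcongr
            refine h.trans ?_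
            gcongr
        _ = 2 * (7 + 2 / ε) * condSize q s ^ ε * ((‖s - 1‖ + 1) / ‖s + 1‖) := by
            field_simp
        _ ≤ 2 * (7 + 2 / ε) * condSize q s ^ ε * 4 := by
            gcongr
            rw [div_le_iff₀ (by linarith)]
            linarith
        _ = _ := by ring
    · rw [regL_of_ne_one h1]
      rw [charMean_eq_zero h1] at h
      simp only [norm_zero, zero_div, add_zero, mul_one] at h
      linarith
  intro s hs
  by_cases hs1 : s = 1
  · subst hs1
    have hc : Continuous fun z : ℂ => 2 * (7 + 2 / ε) * 4 * condSize q z ^ ε := by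
      unfold condSize
      refine continuous_const.mul (Continuous.rpow_const (by fun_prop) fun z => .inr hε.le)
    refine le_of_tendsto_of_tendsto (b := nhdsWithin (1 : ℂ) {1}ᶜ)
      ((differentiableAt_regL χ (by simp)).continuousAt.norm.tendsto.mono_left nhdsWithin_le_nhds)
      (hc.continuousAt.tendsto.mono_left nhdsWithin_le_nhds) ?_
    have : {z : ℂ | 1 - ε / 2 < z.re} ∈ nhds (1 : ℂ) :=
      (isOpen_lt continuous_const Complex.continuous_re).mem_nhds (by simp [hε])
    filter_upwards [mem_nhdsWithin_of_mem_nhds this, self_mem_nhdsWithin] with z hz hz1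
    exact main z (le_of_lt hz) hz1
  · exact main s hs hs1

lemma norm_LFunction_le_regL {q : ℕ} [NeZero q] (χ : DirichletCharacter ℂ q) {s : ℂ}
    (hs : 0 < s.re) (hs1 : s ≠ 1) :
    ‖DirichletCharacter.LFunction χ s‖ ≤ ‖regL χ s‖ * (1 + 2 / ‖s - 1‖) := by
  have hs1' : 0 < ‖s - 1‖ := norm_pos_iff.mpr (sub_ne_zero.mpr hs1)
  by_cases h1 : χ = 1
  · subst h1
    have hp := one_le_norm_add_one hs
    rw [regL_one_of_ne hs1, norm_mul, norm_div, mul_assoc]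
    refine le_mul_of_one_le_right (norm_nonneg _) ?_
    have h3 : ‖s + 1‖ ≤ ‖s - 1‖ + 2 := by
      calc ‖s + 1‖ = ‖(s - 1) + 2‖ := by ring_nf
        _ ≤ _ := (norm_add_le _ _).trans (by simp)
    rw [show ‖s - 1‖ / ‖s + 1‖ * (1 + 2 / ‖s - 1‖) = (‖s - 1‖ + 2) / ‖s + 1‖ by field_simp]
    rwa [le_div_iff₀ (by linarith), one_mul]
  · rw [regL_of_ne_one h1]
    refine le_mul_of_one_le_right (norm_nonneg _) ?_
    have : 0 < 2 / ‖s - 1‖ := by positivity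
    linarith

lemma norm_regL_le_LFunction {q : ℕ} [NeZero q] (χ : DirichletCharacter ℂ q) {s : ℂ}
    (hs1 : s ≠ 1) :
    ‖DirichletCharacter.LFunction χ s‖ * min 1 (‖s - 1‖ / ‖s + 1‖) ≤ ‖regL χ s‖ := by
  by_cases h1 : χ = 1
  · subst h1
    rw [regL_one_of_ne hs1, norm_mul, norm_div]
    gcongr
    exact min_le_right _ _
  · rw [regL_of_ne_one h1]
    exact mul_le_of_le_one_right (norm_nonneg _) (min_le_left _ _)

open Complex in
open scoped ComplexOrder in
lemma one_le_re_LSeries_two {f : ℕ → ℂ} (hf0 : 0 ≤ f) (hf1 : f 1 = 1)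
    (hsum : LSeriesSummable f 2) : 1 ≤ (LSeries f 2).re := by
  have h1 : LSeries.term f 2 1 = 1 := by simp [LSeries.term, hf1]
  have h2 : LSeries.term f 2 1 ≤ LSeries f 2 := by
    refine Summable.le_tsum hsum 1 fun n _ ↦ ?_
    exact_mod_cast LSeries.term_nonneg (hf0 n) 2
  rw [h1] at h2
  simpa using (Complex.le_def.1 h2).1

open Complex in
lemma iteratedDeriv_inv_sub_one_two (m : ℕ) :
    iteratedDeriv m (fun s : ℂ ↦ (s - 1)⁻¹) 2 = (-1) ^ m * m.factorial := by
  have h := congrFun (iter_deriv_inv_linear_sub m (1 : ℂ) 1) 2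
  simp only [one_mul, one_pow, mul_one] at h
  rw [iteratedDeriv_eq_iterate, h]
  norm_num

open scoped ComplexOrder in
/-- Differentiated Dirichlet series with nonnegative coefficients, with the pole at `1` removed:
the Taylor coefficients at `2`. -/
lemma re_iteratedDeriv_dslope_ge {f : ℕ → ℂ} (hf0 : 0 ≤ f)
    (hsum : ∀ s : ℂ, 1 < s.re → LSeriesSummable f s) {K : ℂ → ℂ}
    (hKL : ∀ s : ℂ, 1 < s.re → K s = (s - 1) * LSeries f s) (m : ℕ) :
    -(K 1).re ≤ ((-1) ^ m * (m.factorial : ℂ)⁻¹ * iteratedDeriv m (dslope K 1) 2).re := by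
  have habs : LSeries.abscissaOfAbsConv f < (2 : ℝ) := by
    refine lt_of_le_of_lt (hsum (3 / 2 : ℝ) (by norm_num)).abscissaOfAbsConv_le ?_
    rw [Complex.ofReal_re]
    exact_mod_cast (by norm_num : (3 / 2 : ℝ) < 2)
  have hopen : IsOpen {s : ℂ | 1 < s.re} := isOpen_lt continuous_const Complex.continuous_re
  have h2 : (2 : ℂ) ∈ {s : ℂ | 1 < s.re} := by simp
  have heq : Set.EqOn (dslope K 1) (fun s ↦ LSeries f s - K 1 * (s - 1)⁻¹) {s : ℂ | 1 < s.re} := by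
    intro s hs
    have hs' : 1 < s.re := hs
    have hne : s ≠ 1 := by rintro rfl; simp at hs'
    have hne' : s - 1 ≠ 0 := sub_ne_zero.2 hne
    simp only [dslope_of_ne _ hne, slope_def_field, hKL s hs']
    field_simp
  have hL : ContDiffAt ℂ m (LSeries f) 2 := by
    have : AnalyticOnNhd ℂ (LSeries f) {s | LSeries.abscissaOfAbsConv f < s.re} :=
      LSeries_analyticOnNhd f
    refine (this 2 ?_).contDiffAt
    simpa using habs
  have hI : ContDiffAt ℂ m (fun s : ℂ ↦ (s - 1)⁻¹) 2 := by
    refine ContDiffAt.inv (by fun_prop) (by norm_num)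
  rw [heq.iteratedDeriv_of_isOpen hopen m h2,
    iteratedDeriv_fun_sub hL (contDiffAt_const.mul hI), iteratedDeriv_const_mul_field,
    iteratedDeriv_inv_sub_one_two]
  have hpos := LSeries.iteratedDeriv_alternating hf0 habs m
  have hsq : ((-1 : ℂ) ^ m) * (-1) ^ m = 1 := by rw [← pow_add, Even.neg_one_pow ⟨m, rfl⟩]
  have hfac : (m.factorial : ℂ) ≠ 0 := by exact_mod_cast m.factorial_ne_zero
  have hre : 0 ≤ ((-1) ^ m * iteratedDeriv m (LSeries f) 2).re := by
    have := (Complex.le_def.1 hpos).1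
    simpa using this
  have : (-1) ^ m * (m.factorial : ℂ)⁻¹ *
      (iteratedDeriv m (LSeries f) 2 - K 1 * ((-1) ^ m * (m.factorial : ℂ))) =
      ((m.factorial : ℝ)⁻¹ : ℝ) * ((-1) ^ m * iteratedDeriv m (LSeries f) 2) - K 1 := by
    push_cast
    field_simp
    linear_combination (-K 1 * m.factorial) * hsq
  rw [this, Complex.sub_re, Complex.re_ofReal_mul]
  have : 0 ≤ (m.factorial : ℝ)⁻¹ * ((-1) ^ m * iteratedDeriv m (LSeries f) 2).re := by positivity
  linarith

open scoped ComplexOrder in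
/-- Estermann's lower bound for the residue of a Dirichlet series with nonnegative coefficients
that is nonpositive at a point `β < 1` close to `1`. -/
lemma residue_ge_of_nonpos {f : ℕ → ℂ} (hf0 : 0 ≤ f) (hf1 : f 1 = 1)
    (hsum : ∀ s : ℂ, 1 < s.re → LSeriesSummable f s) {K : ℂ → ℂ}
    (hK : DifferentiableOn ℂ K {s | 0 < s.re})
    (hKL : ∀ s : ℂ, 1 < s.re → K s = (s - 1) * LSeries f s) {M : ℝ} (hM1 : 1 ≤ M)
    (hM : ∀ s ∈ Metric.closedBall (2 : ℂ) (4 / 3), ‖K s‖ ≤ M) {β : ℝ} (hβ : 7 / 8 ≤ β)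
    (hβ1 : β < 1) (h0 : 0 ≤ (K β).re) :
    (1 - β) / 2 * Real.exp (-1) * (84 * M) ^ (-(6 * (1 - β))) ≤ (K 1).re := by
  set Λ := (K 1).re with hΛ
  set G := dslope K 1 with hG
  have hopen : IsOpen {s : ℂ | 0 < s.re} := isOpen_lt continuous_const Complex.continuous_re
  have hGd : DifferentiableOn ℂ G {s | 0 < s.re} :=
    (Complex.differentiableOn_dslope (hopen.mem_nhds (by simp))).2 hK
  have hball : Metric.closedBall (2 : ℂ) (4 / 3) ⊆ {s | 0 < s.re} := by
    intro s hs
    have h1 : |(s - 2).re| ≤ 4 / 3 :=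
      (Complex.abs_re_le_norm _).trans (by simpa [dist_eq_norm] using hs)
    have h2 := (abs_le.1 h1).1
    simp at h2
    show 0 < s.re
    linarith
  have hGs : ∀ z ∈ Metric.sphere (2 : ℂ) (4 / 3), ‖G z‖ ≤ 6 * M := by
    intro z hz
    have hz' : ‖z - 2‖ = 4 / 3 := by simpa [dist_eq_norm] using hz
    have h1 : 1 / 3 ≤ ‖z - 1‖ := by
      have : ‖z - 2‖ ≤ ‖z - 1‖ + ‖(1 : ℂ)‖ := by
        rw [show z - 2 = z - 1 - 1 by ring]
        exact norm_sub_le _ _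
      rw [hz', norm_one] at this
      linarith
    have hne : z ≠ 1 := by
      rintro rfl
      norm_num at h1
    rw [hG, dslope_of_ne _ hne, slope_def_field, norm_div, div_le_iff₀ (by linarith)]
    have h2 : ‖K z - K 1‖ ≤ M + M := by
      refine (norm_sub_le _ _).trans (add_le_add (hM _ (Metric.sphere_subset_closedBall hz))
        (hM _ ?_))
      simp [dist_eq_norm]; norm_num
    nlinarith
  set c : ℕ → ℂ := fun m ↦ (-1) ^ m * (m.factorial : ℂ)⁻¹ * iteratedDeriv m G 2 with hc
  have hclow : ∀ m, -Λ ≤ (c m).re := fun m ↦ re_iteratedDeriv_dslope_ge hf0 hsum hKL m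
  have hc0 : 1 - Λ ≤ (c 0).re := by
    have h2 : c 0 = LSeries f 2 - K 1 := by
      simp only [hc, pow_zero, Nat.factorial_zero, Nat.cast_one, inv_one, mul_one, one_mul,
        iteratedDeriv_zero, hG]
      rw [dslope_of_ne _ (by norm_num), slope_def_field, hKL 2 (by simp)]
      norm_num
    rw [h2, Complex.sub_re]
    linarith [one_le_re_LSeries_two hf0 hf1 (hsum 2 (by simp))]
  have hcup : ∀ m, ‖c m‖ ≤ 6 * M * (3 / 4) ^ m := by
    intro m
    have h1 := Complex.norm_iteratedDeriv_le_of_forall_mem_sphere_norm_le (f := G) m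
      (by norm_num : (0 : ℝ) < 4 / 3)
      ((hGd.mono (by rw [closure_ball _ (by norm_num)]; exact hball)).diffContOnCl) hGs
    have hfac : (0 : ℝ) < m.factorial := by exact_mod_cast m.factorial_pos
    simp only [hc, norm_mul, norm_pow, norm_neg, norm_one, one_pow, one_mul, norm_inv,
      Complex.norm_natCast]
    calc (m.factorial : ℝ)⁻¹ * ‖iteratedDeriv m G 2‖
        ≤ (m.factorial : ℝ)⁻¹ * (m.factorial * (6 * M) / (4 / 3) ^ m) := by gcongr
      _ = 6 * M * (3 / 4) ^ m := by
        rw [show (3 / 4 : ℝ) = (4 / 3)⁻¹ by norm_num, inv_pow]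
        field_simp
  have hβmem : (β : ℂ) ∈ Metric.ball (2 : ℂ) (4 / 3) := by
    rw [Metric.mem_ball, dist_eq_norm, show (β : ℂ) - 2 = ((β - 2 : ℝ) : ℂ) by push_cast; ring,
      Complex.norm_real, Real.norm_eq_abs, abs_lt]
    constructor <;> linarith
  have htay := Complex.hasSum_taylorSeries_on_ball
    (hGd.mono (Metric.ball_subset_closedBall.trans hball)) hβmem
  set r : ℝ := 2 - β with hr
  have hr1 : 1 < r := by linarith
  have hr2 : r ≤ 9 / 8 := by linarith
  have hre : HasSum (fun m ↦ (c m).re * r ^ m) (G β).re := by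
    convert Complex.hasSum_re htay using 2 with m
    have : (m.factorial : ℂ)⁻¹ • ((β : ℂ) - 2) ^ m • iteratedDeriv m G 2 =
        ((r ^ m : ℝ) : ℂ) * c m := by
      have h2 : ((β : ℂ) - 2) ^ m = (-1) ^ m * (r : ℂ) ^ m := by
        rw [← mul_pow, hr]; push_cast; ring
      simp only [smul_eq_mul, hc, h2]
      push_cast
      ring
    rw [this, Complex.re_ofReal_mul, mul_comm]
  have hGβ : (G β).re ≤ Λ / (1 - β) := by
    have hne : (β : ℂ) ≠ 1 := by exact_mod_cast hβ1.ne
    rw [hG, dslope_of_ne _ hne, slope_def_field,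
      show (β : ℂ) - 1 = ((β - 1 : ℝ) : ℂ) by push_cast; ring, Complex.div_ofReal_re,
      Complex.sub_re, ← hΛ, show β - 1 = -(1 - β) by ring, div_neg, ← neg_div]
    gcongr
    linarith
  set N : ℕ := ⌈6 * Real.log (84 * M)⌉₊ with hN
  have hlogM : 0 ≤ Real.log (84 * M) := Real.log_nonneg (by linarith)
  have hNlow : 6 * Real.log (84 * M) ≤ N := Nat.le_ceil _
  have hNup : (N : ℝ) < 6 * Real.log (84 * M) + 1 := Nat.ceil_lt_add_one (by positivity)
  have hpow : (27 / 32 : ℝ) ^ N * (84 * M) ≤ 1 := by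
    have h1 : (27 / 32 : ℝ) ≤ Real.exp (-(1 / 6)) := by
      have := Real.add_one_le_exp (-(1 / 6) : ℝ)
      have h3 : Real.exp (1 / 6) ≤ 32 / 27 := by
        have h4 := Real.exp_bound' (x := 1 / 6) (by norm_num) (by norm_num) (n := 3) (by norm_num)
        refine h4.trans ?_
        norm_num [Finset.sum_range_succ, Nat.factorial]
      rw [Real.exp_neg, le_inv_comm₀ (by norm_num) (Real.exp_pos _)]
      norm_num at h3 ⊢
      exact h3
    calc (27 / 32 : ℝ) ^ N * (84 * M) ≤ Real.exp (-(1 / 6)) ^ N * (84 * M) := by gcongr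
      _ = Real.exp (-(N / 6) + Real.log (84 * M)) := by
        rw [← Real.exp_nat_mul, Real.exp_add, Real.exp_log (by linarith)]
        ring_nf
      _ ≤ 1 := Real.exp_le_one_iff.2 (by linarith)
  have htail : ∀ m, -(6 * M * (27 / 32) ^ N) * (27 / 32) ^ m ≤ (c (m + N)).re * r ^ (m + N) := by
    intro m
    have h1 : |(c (m + N)).re * r ^ (m + N)| ≤ 6 * M * (27 / 32) ^ (m + N) := by
      rw [abs_mul, abs_of_pos (pow_pos (by linarith : 0 < r) _)]
      calc |(c (m + N)).re| * r ^ (m + N) ≤ 6 * M * (3 / 4) ^ (m + N) * (9 / 8) ^ (m + N) := by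
            gcongr
            exact (Complex.abs_re_le_norm _).trans (hcup _)
        _ = 6 * M * (27 / 32) ^ (m + N) := by
          rw [mul_assoc, ← mul_pow]; norm_num
    have := (abs_le.1 h1).1
    rw [pow_add] at this
    linarith
  have hgeo : HasSum (fun m : ℕ ↦ -(6 * M * (27 / 32) ^ N) * (27 / 32 : ℝ) ^ m)
      (-(6 * M * (27 / 32) ^ N) * (1 - 27 / 32)⁻¹) :=
    (hasSum_geometric_of_lt_one (by norm_num) (by norm_num)).mul_left _
  have htail' : -(6 * M * (27 / 32) ^ N) * (1 - 27 / 32)⁻¹ ≤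
      (G β).re - ∑ m ∈ Finset.range N, (c m).re * r ^ m :=
    hasSum_le htail hgeo ((hasSum_nat_add_iff' N).2 hre)
  have hN0 : 0 < N := by
    rw [hN, Nat.ceil_pos]
    have : 0 < Real.log (84 * M) := Real.log_pos (by linarith)
    linarith
  have hhead : 1 - Λ * ((r ^ N - 1) / (r - 1)) ≤ ∑ m ∈ Finset.range N, (c m).re * r ^ m := by
    rw [← geom_sum_eq hr1.ne', Finset.mul_sum]
    have h1 : (1 : ℝ) = ∑ m ∈ Finset.range N, if m = 0 then 1 else 0 := by
      rw [Finset.sum_ite_eq' (Finset.range N) 0 (fun _ ↦ (1 : ℝ)), if_pos (by simpa using hN0)]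
    nth_rw 1 [h1]
    rw [← Finset.sum_sub_distrib]
    refine Finset.sum_le_sum fun m _ ↦ ?_
    split_ifs with h
    · subst h; simpa using hc0
    · have := mul_le_mul_of_nonneg_right (hclow m) (pow_pos (by linarith : 0 < r) m).le
      linarith
  have hr1' : r - 1 = 1 - β := by rw [hr]; ring
  rw [hr1'] at hhead
  have hpos : 0 < 1 - β := by linarith
  have hmain : 1 / 2 ≤ Λ * r ^ N / (1 - β) := by
    have h1 : Λ * r ^ N / (1 - β) = Λ * ((r ^ N - 1) / (1 - β)) + Λ / (1 - β) := by
      field_simp; ring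
    have h2 : 6 * M * (27 / 32) ^ N * (1 - 27 / 32)⁻¹ ≤ 1 / 2 := by
      norm_num
      nlinarith
    rw [h1]
    linarith
  have hrN : r ^ N ≤ Real.exp 1 * (84 * M) ^ (6 * (1 - β)) := by
    calc r ^ N ≤ Real.exp (1 - β) ^ N := by
          gcongr
          have := Real.add_one_le_exp (1 - β)
          linarith
      _ = Real.exp (N * (1 - β)) := (Real.exp_nat_mul _ _).symm
      _ ≤ Real.exp (1 + Real.log (84 * M) * (6 * (1 - β))) := by
          gcongr
          nlinarith
      _ = _ := by rw [Real.exp_add, Real.rpow_def_of_pos (by linarith)]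
  have hΛpos : 0 < Λ := by
    by_contra hneg
    have : Λ * r ^ N / (1 - β) ≤ 0 := by
      refine div_nonpos_of_nonpos_of_nonneg (mul_nonpos_of_nonpos_of_nonneg (by linarith) ?_)
        hpos.le
      positivity
    linarith
  rw [Real.rpow_neg (by linarith), Real.exp_neg]
  rw [div_le_div_iff₀ (by norm_num) hpos] at hmain
  have hY : 0 < (84 * M) ^ (6 * (1 - β)) := Real.rpow_pos_of_pos (by linarith) _
  have he := Real.exp_pos 1
  have h5 : (1 - β) / 2 ≤ Λ * (Real.exp 1 * (84 * M) ^ (6 * (1 - β))) := by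
    have := mul_le_mul_of_nonneg_left hrN hΛpos.le
    linarith
  rw [mul_assoc, ← mul_inv, ← div_eq_mul_inv, div_le_iff₀ (by positivity)]
  exact h5

/-- The arithmetic function `f` is normalised and `P` is its logarithmic derivative. -/
def HasLogDerivative (f P : ArithmeticFunction ℂ) : Prop :=
  f 1 = 1 ∧ ∀ n : ℕ, (Real.log n : ℂ) * f n = (f * P) n

lemma HasLogDerivative.mul {f g P Q : ArithmeticFunction ℂ} (hf : HasLogDerivative f P)
    (hg : HasLogDerivative g Q) : HasLogDerivative (f * g) (P + Q) := by
  refine ⟨by simp [ArithmeticFunction.mul_apply, hf.1, hg.1], fun n ↦ ?_⟩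
  have h1 : (Real.log n : ℂ) * (f * g) n = ((f * P) * g) n + (f * (g * Q)) n := by
    simp only [ArithmeticFunction.mul_apply (f := f * P), ArithmeticFunction.mul_apply (g := g * Q),
      ← hf.2, ← hg.2]
    rw [ArithmeticFunction.mul_apply, Finset.mul_sum, ← Finset.sum_add_distrib]
    refine Finset.sum_congr rfl fun p hp ↦ ?_
    obtain ⟨h1, h2⟩ := Nat.mem_divisorsAntidiagonal.1 hp
    have ha : p.1 ≠ 0 := fun h ↦ h2 (by rw [← h1, h, zero_mul])
    have hb : p.2 ≠ 0 := fun h ↦ h2 (by rw [← h1, h, mul_zero])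
    rw [← h1, Nat.cast_mul, Real.log_mul (by exact_mod_cast ha) (by exact_mod_cast hb)]
    push_cast
    ring
  rw [h1, ← ArithmeticFunction.add_apply]
  congr 1
  ring

open scoped ComplexOrder in
lemma HasLogDerivative.nonneg {f P : ArithmeticFunction ℂ} (hf : HasLogDerivative f P)
    (hP : ∀ n, 0 ≤ P n) (n : ℕ) : 0 ≤ f n := by
  induction n using Nat.strong_induction_on with
  | _ n ih =>
  rcases Nat.lt_or_ge n 2 with h | h
  · interval_cases n
    · simp
    · rw [hf.1]; exact zero_le_one
  have hP1 : P 1 = 0 := by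
    have := hf.2 1
    simpa [ArithmeticFunction.mul_apply, hf.1] using this.symm
  have hlog : 0 < Real.log n := Real.log_pos (by exact_mod_cast h)
  have h1 : 0 ≤ (Real.log n : ℂ) * f n := by
    rw [hf.2, ArithmeticFunction.mul_apply]
    refine Finset.sum_nonneg fun p hp ↦ ?_
    obtain ⟨h1, h2⟩ := Nat.mem_divisorsAntidiagonal.1 hp
    by_cases hp2 : p.2 = 1
    · simp [hp2, hP1]
    · refine mul_nonneg (ih _ ?_) (hP _)
      have hp1 : p.1 ≠ 0 := fun h ↦ h2 (by rw [← h1, h, zero_mul])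
      have hp2' : p.2 ≠ 0 := fun h ↦ h2 (by rw [← h1, h, mul_zero])
      rw [← h1]
      exact lt_mul_of_one_lt_right (Nat.pos_of_ne_zero hp1) (by omega)
  have h2 : f n = ((Real.log n)⁻¹ : ℝ) * ((Real.log n : ℂ) * f n) := by
    rw [← mul_assoc, ← Complex.ofReal_mul, inv_mul_cancel₀ hlog.ne', Complex.ofReal_one, one_mul]
  rw [h2]
  exact mul_nonneg (by exact_mod_cast (inv_pos.2 hlog).le) h1

section CharacterCoefficients

variable {q : ℕ}

/-- A Dirichlet character as an arithmetic function. -/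
noncomputable def charArith (χ : DirichletCharacter ℂ q) : ArithmeticFunction ℂ :=
  ⟨fun n ↦ if n = 0 then 0 else χ n, by simp⟩

/-- The von Mangoldt function twisted by a Dirichlet character. -/
noncomputable def charMangoldt (χ : DirichletCharacter ℂ q) : ArithmeticFunction ℂ :=
  ⟨fun n ↦ χ n * (ArithmeticFunction.vonMangoldt n : ℂ), by simp⟩

lemma charArith_apply (χ : DirichletCharacter ℂ q) {n : ℕ} (hn : n ≠ 0) : charArith χ n = χ n :=
  if_neg hn

lemma charMangoldt_apply (χ : DirichletCharacter ℂ q) (n : ℕ) :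
    charMangoldt χ n = χ n * (ArithmeticFunction.vonMangoldt n : ℂ) := rfl

lemma hasLogDerivative_charArith (χ : DirichletCharacter ℂ q) :
    HasLogDerivative (charArith χ) (charMangoldt χ) := by
  refine ⟨by simp [charArith_apply], fun n ↦ ?_⟩
  rcases eq_or_ne n 0 with rfl | hn
  · simp
  rw [charArith_apply χ hn, ArithmeticFunction.mul_apply,
    ← ArithmeticFunction.vonMangoldt_sum,
    ← Nat.sum_divisorsAntidiagonal' (fun _ i ↦ ArithmeticFunction.vonMangoldt i)]
  push_cast
  rw [Finset.sum_mul]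
  refine Finset.sum_congr rfl fun p hp ↦ ?_
  obtain ⟨h1, h2⟩ := Nat.mem_divisorsAntidiagonal.1 hp
  have ha : p.1 ≠ 0 := fun h ↦ h2 (by rw [← h1, h, zero_mul])
  rw [charArith_apply χ ha, charMangoldt_apply, ← h1]
  push_cast
  rw [map_mul]
  ring

lemma LSeriesSummable_charArith (χ : DirichletCharacter ℂ q) {s : ℂ} (hs : 1 < s.re) :
    LSeriesSummable (charArith χ) s :=
  (LSeriesSummable_congr s fun hn ↦ charArith_apply χ hn).2
    (DirichletCharacter.LSeriesSummable_of_one_lt_re χ hs)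

lemma LSeries_charArith [NeZero q] (χ : DirichletCharacter ℂ q) {s : ℂ} (hs : 1 < s.re) :
    LSeries (charArith χ) s = DirichletCharacter.LFunction χ s := by
  rw [DirichletCharacter.LFunction_eq_LSeries χ hs]
  exact LSeries_congr (fun hn ↦ charArith_apply χ hn) s

open scoped ComplexOrder in
/-- A real character takes only real values, of absolute value at most one. -/
lemma one_add_char_nonneg {χ : DirichletCharacter ℂ q} (hχ : χ ^ 2 = 1) (a : ZMod q) :
    0 ≤ 1 + χ a := by
  by_cases ha : IsUnit a
  · have h : χ a ^ 2 = 1 := by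
      rw [← MulChar.pow_apply' χ two_ne_zero, hχ, MulChar.one_apply ha]
    rcases sq_eq_one_iff.1 h with h | h <;> rw [h]
    · exact add_nonneg zero_le_one zero_le_one
    · simp
  · rw [MulChar.map_nonunit χ ha]
    simp

open scoped ComplexOrder in
lemma charMangoldt_one_add_nonneg {χ : DirichletCharacter ℂ q} (hχ : χ ^ 2 = 1) (n : ℕ) :
    0 ≤ (charMangoldt (1 : DirichletCharacter ℂ q) + charMangoldt χ) n := by
  rw [ArithmeticFunction.add_apply, charMangoldt_apply, charMangoldt_apply, ← add_mul]
  refine mul_nonneg ?_ (by exact_mod_cast ArithmeticFunction.vonMangoldt_nonneg)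
  by_cases hn : IsUnit (n : ZMod q)
  · rw [MulChar.one_apply hn]
    exact one_add_char_nonneg hχ _
  · simp [MulChar.map_nonunit _ hn]

open scoped ComplexOrder in
lemma charMangoldt_four_nonneg {χ ψ : DirichletCharacter ℂ q} (hχ : χ ^ 2 = 1) (hψ : ψ ^ 2 = 1)
    (n : ℕ) : 0 ≤ (charMangoldt (1 : DirichletCharacter ℂ q) + charMangoldt χ +
      (charMangoldt ψ + charMangoldt (χ * ψ))) n := by
  simp only [ArithmeticFunction.add_apply, charMangoldt_apply, ← add_mul]
  refine mul_nonneg ?_ (by exact_mod_cast ArithmeticFunction.vonMangoldt_nonneg)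
  by_cases hn : IsUnit (n : ZMod q)
  · rw [MulChar.one_apply hn, MulChar.mul_apply]
    have h := mul_nonneg (one_add_char_nonneg hχ n) (one_add_char_nonneg hψ n)
    convert h using 1
    ring
  · simp [MulChar.map_nonunit _ hn]

end CharacterCoefficients

lemma norm_regL_le_closedBall : ∃ C : ℝ, 1 ≤ C ∧ ∀ (q : ℕ) [NeZero q] (χ : DirichletCharacter ℂ q),
    ∀ s ∈ Metric.closedBall (2 : ℂ) (4 / 3), ‖regL χ s‖ ≤ C * q := by
  obtain ⟨C, hC1, hC⟩ := norm_regL_le (ε := 2 / 3) (by norm_num) (by norm_num)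
  refine ⟨C * 6, by linarith, fun q _ χ s hs ↦ ?_⟩
  have hs' : ‖s - 2‖ ≤ 4 / 3 := by simpa [dist_eq_norm] using hs
  have h1 := (abs_le.1 ((Complex.abs_re_le_norm _).trans hs')).1
  simp at h1
  have hq : (1 : ℝ) ≤ q := by exact_mod_cast NeZero.one_le
  have hn : ‖s‖ ≤ 4 := by
    have : ‖s‖ ≤ ‖s - 2‖ + ‖(2 : ℂ)‖ := by simpa using norm_add_le (s - 2) 2
    have h2 : ‖(2 : ℂ)‖ = 2 := by simp
    linarith
  have hcs : condSize q s ≤ 6 * q := by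
    unfold condSize; nlinarith
  have h2 := two_le_condSize q s
  calc ‖regL χ s‖ ≤ C * condSize q s ^ (2 / 3 : ℝ) := hC q χ s (by linarith)
    _ ≤ C * condSize q s ^ (1 : ℝ) := by
      gcongr
      · linarith
      · norm_num
    _ ≤ C * 6 * q := by rw [Real.rpow_one]; nlinarith

open scoped ComplexOrder in
lemma norm_regL_one_mul_ge {C : ℝ} (hC : 1 ≤ C) {β : ℝ} (hβ : 7 / 8 ≤ β) (hβ1 : β < 1) :
    ∃ c : ℝ, 0 < c ∧ ∀ (q : ℕ) [NeZero q] (f : ℕ → ℂ) (H : ℂ → ℂ), 0 ≤ f → f 1 = 1 →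
      (∀ s : ℂ, 1 < s.re → LSeriesSummable f s) → DifferentiableOn ℂ H {s | 0 < s.re} →
      (∀ s : ℂ, 1 < s.re → LSeries f s =
        DirichletCharacter.LFunction (1 : DirichletCharacter ℂ q) s * H s) →
      (∀ s ∈ Metric.closedBall (2 : ℂ) (4 / 3),
        ‖regL (1 : DirichletCharacter ℂ q) s * H s‖ ≤ (C * q) ^ 4) →
      0 ≤ (regL (1 : DirichletCharacter ℂ q) β * H β).re →
      c * (q : ℝ) ^ (-(24 * (1 - β))) ≤ ‖regL (1 : DirichletCharacter ℂ q) 1‖ * ‖H 1‖ := by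
  refine ⟨(1 - β) / 2 * Real.exp (-1) * (420 * C ^ 4) ^ (-(6 * (1 - β))) / 2, ?_, ?_⟩
  · have : 0 < 1 - β := by linarith
    positivity
  intro q _ f H hf0 hf1 hsum hH hL hbd h0
  have hq : (1 : ℝ) ≤ q := by exact_mod_cast NeZero.one_le
  set K : ℂ → ℂ := fun s ↦ (s + 1) * (regL (1 : DirichletCharacter ℂ q) s * H s) with hK
  have h := residue_ge_of_nonpos (K := K) (M := 5 * (C * q) ^ 4) (β := β) hf0 hf1 hsum ?_ ?_ ?_ ?_
    hβ hβ1 ?_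
  · have h1 : (K 1).re ≤ 2 * (‖regL (1 : DirichletCharacter ℂ q) 1‖ * ‖H 1‖) := by
      refine (Complex.re_le_norm _).trans (le_of_eq ?_)
      simp only [hK, norm_mul]
      norm_num
    have h2 : (84 * (5 * (C * (q : ℝ)) ^ 4)) ^ (-(6 * (1 - β))) =
        (420 * C ^ 4) ^ (-(6 * (1 - β))) * (q : ℝ) ^ (-(24 * (1 - β))) := by
      rw [show (84 * (5 * (C * (q : ℝ)) ^ 4)) = (420 * C ^ 4) * (q : ℝ) ^ (4 : ℝ) by
        norm_cast; push_cast; ring, Real.mul_rpow (by positivity) (by positivity),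
        ← Real.rpow_mul (by positivity)]
      congr 2
      ring
    rw [h2] at h
    nlinarith
  · intro s hs
    exact ((differentiableAt_id.add_const 1).differentiableWithinAt).mul
      ((differentiableAt_regL _ hs).differentiableWithinAt.mul (hH s hs))
  · intro s hs
    have hne : s ≠ 1 := by rintro rfl; simp at hs
    have hne2 : s + 1 ≠ 0 := by
      intro h
      have := congrArg Complex.re h
      simp at this
      linarith
    simp only [hK]
    rw [hL s hs, regL_one_of_ne hne]
    field_simp
  · have : 1 ≤ C * q := by nlinarith
    nlinarith [one_le_pow₀ this (n := 4)]
  · intro s hs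
    have hs' : ‖s - 2‖ ≤ 4 / 3 := by simpa [dist_eq_norm] using hs
    have h2 : ‖s + 1‖ ≤ 5 := by
      have h3 : ‖s + 1‖ ≤ ‖s - 2‖ + ‖(3 : ℂ)‖ := by
        rw [show s + 1 = s - 2 + 3 by ring]
        exact norm_add_le _ _
      have h4 : ‖(3 : ℂ)‖ = 3 := by simp
      linarith
    simp only [hK, norm_mul (s + 1)]
    exact mul_le_mul h2 (hbd s hs) (norm_nonneg _) (by norm_num)
  · simp only [hK]
    rw [show ((β : ℂ) + 1) = ((β + 1 : ℝ) : ℂ) by push_cast; ring, Complex.re_ofReal_mul]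
    have : 0 ≤ β + 1 := by linarith
    positivity

/-- Two-character version of the lower bound. -/
lemma norm_regL_two_ge {β : ℝ} (hβ : 7 / 8 ≤ β) (hβ1 : β < 1) :
    ∃ c : ℝ, 0 < c ∧ ∀ (q : ℕ) [NeZero q] (χ : DirichletCharacter ℂ q), χ ^ 2 = 1 → χ ≠ 1 →
      0 ≤ (regL (1 : DirichletCharacter ℂ q) β * regL χ β).re →
      c * (q : ℝ) ^ (-(24 * (1 - β))) ≤
        ‖regL (1 : DirichletCharacter ℂ q) 1‖ * ‖regL χ 1‖ := by
  obtain ⟨C, hC1, hC⟩ := norm_regL_le_closedBall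
  obtain ⟨c, hc, h⟩ := norm_regL_one_mul_ge hC1 hβ hβ1
  refine ⟨c, hc, fun q _ χ hχ hχ1 h0 ↦ ?_⟩
  have hq : (1 : ℝ) ≤ q := by exact_mod_cast NeZero.one_le
  have hD := (hasLogDerivative_charArith (1 : DirichletCharacter ℂ q)).mul
    (hasLogDerivative_charArith χ)
  refine h q (charArith 1 * charArith χ : ArithmeticFunction ℂ) (regL χ)
    (hD.nonneg (charMangoldt_one_add_nonneg hχ)) hD.1 (fun s hs ↦ ?_) ?_ (fun s hs ↦ ?_) ?_ h0
  · exact ArithmeticFunction.LSeriesSummable_mul (LSeriesSummable_charArith _ hs)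
      (LSeriesSummable_charArith _ hs)
  · exact fun s hs ↦ (differentiableAt_regL _ hs).differentiableWithinAt
  · rw [ArithmeticFunction.LSeries_mul' (LSeriesSummable_charArith _ hs)
      (LSeriesSummable_charArith _ hs), LSeries_charArith _ hs, LSeries_charArith _ hs,
      regL_of_ne_one hχ1]
  · intro s hs
    have hCq : 1 ≤ C * q := by nlinarith
    rw [norm_mul]
    calc _ ≤ (C * q) * (C * q) := by
          gcongr
          · exact hC q _ s hs
          · exact hC q _ s hs
      _ = (C * q) ^ 2 := by ring
      _ ≤ (C * q) ^ 4 := pow_le_pow_right₀ hCq (by norm_num)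

/-- Four-character version of the lower bound. -/
lemma norm_regL_four_ge {β : ℝ} (hβ : 7 / 8 ≤ β) (hβ1 : β < 1) :
    ∃ c : ℝ, 0 < c ∧ ∀ (q : ℕ) [NeZero q] (χ ψ : DirichletCharacter ℂ q), χ ^ 2 = 1 → ψ ^ 2 = 1 →
      χ ≠ 1 → ψ ≠ 1 → χ * ψ ≠ 1 → regL χ β = 0 →
      c * (q : ℝ) ^ (-(24 * (1 - β))) ≤ ‖regL (1 : DirichletCharacter ℂ q) 1‖ *
        (‖regL χ 1‖ * ‖regL ψ 1‖ * ‖regL (χ * ψ) 1‖) := by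
  obtain ⟨C, hC1, hC⟩ := norm_regL_le_closedBall
  obtain ⟨c, hc, h⟩ := norm_regL_one_mul_ge hC1 hβ hβ1
  refine ⟨c, hc, fun q _ χ ψ hχ hψ hχ1 hψ1 hχψ1 h0 ↦ ?_⟩
  have hD := ((hasLogDerivative_charArith (1 : DirichletCharacter ℂ q)).mul
    (hasLogDerivative_charArith χ)).mul ((hasLogDerivative_charArith ψ).mul
    (hasLogDerivative_charArith (χ * ψ)))
  rw [← norm_mul, ← norm_mul]
  refine h q (charArith 1 * charArith χ * (charArith ψ * charArith (χ * ψ)) :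
    ArithmeticFunction ℂ) (fun s ↦ regL χ s * regL ψ s * regL (χ * ψ) s)
    (hD.nonneg (charMangoldt_four_nonneg hχ hψ)) hD.1 (fun s hs ↦ ?_) ?_ (fun s hs ↦ ?_) ?_ ?_
  · exact ArithmeticFunction.LSeriesSummable_mul (ArithmeticFunction.LSeriesSummable_mul
      (LSeriesSummable_charArith _ hs) (LSeriesSummable_charArith _ hs))
      (ArithmeticFunction.LSeriesSummable_mul
      (LSeriesSummable_charArith _ hs) (LSeriesSummable_charArith _ hs))
  · exact fun s hs ↦ (((differentiableAt_regL _ hs).mul (differentiableAt_regL _ hs)).mul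
      (differentiableAt_regL _ hs)).differentiableWithinAt
  · rw [ArithmeticFunction.LSeries_mul' (ArithmeticFunction.LSeriesSummable_mul
      (LSeriesSummable_charArith _ hs) (LSeriesSummable_charArith _ hs))
      (ArithmeticFunction.LSeriesSummable_mul
      (LSeriesSummable_charArith _ hs) (LSeriesSummable_charArith _ hs)),
      ArithmeticFunction.LSeries_mul' (LSeriesSummable_charArith _ hs)
      (LSeriesSummable_charArith _ hs), ArithmeticFunction.LSeries_mul'
      (LSeriesSummable_charArith _ hs) (LSeriesSummable_charArith _ hs), LSeries_charArith _ hs,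
      LSeries_charArith _ hs, LSeries_charArith _ hs, LSeries_charArith _ hs,
      regL_of_ne_one hχ1, regL_of_ne_one hψ1, regL_of_ne_one hχψ1]
    ring
  · intro s hs
    rw [norm_mul, norm_mul, norm_mul]
    have hCq : 0 ≤ C * q := by positivity
    calc _ ≤ (C * q) * ((C * q) * (C * q) * (C * q)) := by
          gcongr
          all_goals exact hC q _ s hs
      _ = (C * q) ^ 4 := by ring
  · simp [h0]

lemma two_pow_card_primeFactors_le {ε : ℝ} (hε : 0 < ε) :
    ∃ C : ℝ, 1 ≤ C ∧ ∀ q : ℕ, q ≠ 0 → (2 : ℝ) ^ q.primeFactors.card ≤ C * (q : ℝ) ^ ε := by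
  set P : ℕ := ⌈(2 : ℝ) ^ (1 / ε)⌉₊ with hP
  refine ⟨2 ^ P, one_le_pow₀ (by norm_num), fun q hq ↦ ?_⟩
  have h1 : ∀ p ∈ q.primeFactors, (2 : ℝ) ≤ (if p < P then 2 else 1) * (p : ℝ) ^ ε := by
    intro p hp
    have hp1 : (1 : ℝ) ≤ p := by exact_mod_cast (Nat.prime_of_mem_primeFactors hp).one_le
    split_ifs with h
    · nlinarith [Real.one_le_rpow hp1 hε.le]
    · rw [one_mul]
      have h2 : (2 : ℝ) ^ (1 / ε) ≤ p := (Nat.le_ceil _).trans (by exact_mod_cast not_lt.1 h)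
      calc (2 : ℝ) = ((2 : ℝ) ^ (1 / ε)) ^ ε := by
            rw [← Real.rpow_mul (by norm_num), one_div_mul_cancel hε.ne', Real.rpow_one]
        _ ≤ (p : ℝ) ^ ε := by gcongr
  calc (2 : ℝ) ^ q.primeFactors.card = ∏ p ∈ q.primeFactors, (2 : ℝ) := by simp
    _ ≤ ∏ p ∈ q.primeFactors, (if p < P then 2 else 1) * (p : ℝ) ^ ε :=
      Finset.prod_le_prod (fun _ _ ↦ by norm_num) h1
    _ = (2 : ℝ) ^ (q.primeFactors.filter (· < P)).card * ((∏ p ∈ q.primeFactors, p : ℕ) : ℝ) ^ ε := by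
      rw [Finset.prod_mul_distrib, Finset.prod_ite, Finset.prod_const, Finset.prod_const_one,
        mul_one, Real.finsetProd_rpow _ _ (fun _ _ ↦ by positivity)]
      push_cast
      rfl
    _ ≤ 2 ^ P * (q : ℝ) ^ ε := by
      gcongr
      · norm_num
      · calc (q.primeFactors.filter (· < P)).card ≤ (Finset.range P).card := by
              refine Finset.card_le_card fun p hp ↦ ?_
              simpa using (Finset.mem_filter.1 hp).2
          _ = P := Finset.card_range P
      · exact Nat.le_of_dvd (Nat.pos_of_ne_zero hq) (Nat.prod_primeFactors_dvd q)

lemma norm_regL_at_one_le {ε : ℝ} (hε : 0 < ε) (hε1 : ε ≤ 1) :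
    ∃ C : ℝ, 1 ≤ C ∧ ∀ (q : ℕ) [NeZero q] (χ : DirichletCharacter ℂ q),
      ‖regL χ 1‖ ≤ C * (q : ℝ) ^ ε := by
  obtain ⟨C, hC1, hC⟩ := norm_regL_le hε hε1
  refine ⟨C * 3, by linarith, fun q _ χ ↦ (hC q χ 1 (by simp; linarith)).trans ?_⟩
  have : condSize q 1 = 3 * q := by simp [condSize]; ring
  rw [this, Real.mul_rpow (by norm_num) (by positivity), mul_assoc]
  gcongr
  calc (3 : ℝ) ^ ε ≤ 3 ^ (1 : ℝ) := Real.rpow_le_rpow_of_exponent_le (by norm_num) hε1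
    _ = 3 := Real.rpow_one 3

lemma charTail_of_im_eq_zero {q : ℕ} [NeZero q] (χ : DirichletCharacter ℂ q) {M : ℕ}
    (h : ∀ t : ℝ, (charRem χ M t).im = 0) (β : ℝ) :
    charTail χ M β = ((∫ t in Set.Ioi (M : ℝ), (charRem χ M t).re * t ^ (-(β + 1)) : ℝ) : ℂ) := by
  rw [charTail, ← integral_complex_ofReal]
  refine MeasureTheory.setIntegral_congr_fun measurableSet_Ioi fun t ht ↦ ?_
  have ht0 : 0 ≤ t := le_trans (by positivity) (le_of_lt ht)
  have h1 : charRem χ M t = ((charRem χ M t).re : ℂ) := Complex.ext (by simp) (by simp [h t])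
  rw [h1]
  push_cast
  rw [Complex.ofReal_cpow ht0]
  push_cast
  simp

lemma im_char_eq_zero {q : ℕ} {χ : DirichletCharacter ℂ q} (hχ : χ ^ 2 = 1) (a : ZMod q) :
    (χ a).im = 0 := by
  have := (Complex.le_def.1 (one_add_char_nonneg hχ a)).2
  simpa using this.symm

lemma im_LFunction_eq_zero {q : ℕ} [NeZero q] {χ : DirichletCharacter ℂ q} (hχ : χ ^ 2 = 1)
    (hχ1 : χ ≠ 1) {β : ℝ} (hβ : 0 < β) : (DirichletCharacter.LFunction χ β).im = 0 := by
  have hcont : Continuous fun σ : ℝ ↦ (DirichletCharacter.LFunction χ σ).im :=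
    Complex.continuous_im.comp ((DirichletCharacter.differentiable_LFunction hχ1).continuous.comp
      Complex.continuous_ofReal)
  have key : ∀ σ : ℝ, σ ≠ 1 → 0 < σ → (DirichletCharacter.LFunction χ σ).im = 0 := by
    intro σ hσ1 hσ
    have h : ∀ t : ℝ, (charRem χ 1 t).im = 0 := by
      intro t
      simp [charRem, charMean_eq_zero hχ1, im_char_eq_zero hχ]
    rw [LFunction_eq_truncated χ one_pos (by simpa using hσ) (by exact_mod_cast hσ1),
      charMean_eq_zero hχ1, charTail_of_im_eq_zero χ h]
    simp
  rcases eq_or_ne β 1 with rfl | h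
  · have hcl : IsClosed {σ : ℝ | (DirichletCharacter.LFunction χ σ).im = 0} :=
      isClosed_eq hcont continuous_const
    have hsub : Set.Ioi (1 : ℝ) ⊆ {σ : ℝ | (DirichletCharacter.LFunction χ σ).im = 0} :=
      fun σ hσ ↦ key σ (ne_of_gt hσ) (lt_trans one_pos hσ)
    have := closure_minimal hsub hcl
    rw [closure_Ioi] at this
    exact this (Set.mem_Ici.2 le_rfl)
  · exact key β h hβ

lemma riemannZeta_of_lt_one {β : ℝ} (hβ : 0 < β) (hβ1 : β < 1) :
    ∃ y : ℝ, y ≤ 0 ∧ riemannZeta β = y := by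
  have hrem : ∀ t : ℝ, 1 ≤ t →
      charRem (1 : DirichletCharacter ℂ 1) 1 t = ((⌊t⌋₊ - t : ℝ) : ℂ) := by
    intro t ht
    have h1 : ∀ k : ZMod 1, (1 : DirichletCharacter ℂ 1) k = 1 := fun k ↦
      MulChar.one_apply (isUnit_of_subsingleton k)
    have hfl : 1 ≤ ⌊t⌋₊ := Nat.le_floor (by simpa using ht)
    simp [charRem, charMean, h1, Nat.cast_sub hfl]
  have htail : charTail (1 : DirichletCharacter ℂ 1) 1 β =
      ((∫ t in Set.Ioi (1 : ℝ), (⌊t⌋₊ - t : ℝ) * t ^ (-(β + 1)) : ℝ) : ℂ) := by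
    rw [charTail, ← integral_complex_ofReal, Nat.cast_one]
    refine MeasureTheory.setIntegral_congr_fun measurableSet_Ioi fun t ht ↦ ?_
    have ht1 : 1 ≤ t := le_of_lt ht
    rw [hrem t ht1]
    push_cast
    rw [Complex.ofReal_cpow (by linarith)]
    push_cast
    rfl
  have hneg : ∫ t in Set.Ioi (1 : ℝ), (⌊t⌋₊ - t : ℝ) * t ^ (-(β + 1)) ≤ 0 := by
    refine MeasureTheory.setIntegral_nonpos measurableSet_Ioi fun t ht ↦ ?_
    have ht0 : 0 < t := lt_trans one_pos ht
    exact mul_nonpos_of_nonpos_of_nonneg (by linarith [Nat.floor_le ht0.le])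
      (Real.rpow_nonneg ht0.le _)
  refine ⟨1 + 1 / (β - 1) + β * ∫ t in Set.Ioi (1 : ℝ), (⌊t⌋₊ - t : ℝ) * t ^ (-(β + 1)), ?_, ?_⟩
  · have h1 : 1 + 1 / (β - 1) ≤ 0 := by
      have : 1 + 1 / (β - 1) = β / (β - 1) := by
        have : β - 1 ≠ 0 := by linarith
        field_simp; ring
      rw [this]
      exact div_nonpos_of_nonneg_of_nonpos hβ.le (by linarith)
    nlinarith
  · have hm : charMean (1 : DirichletCharacter ℂ 1) = 1 := by
      have h1 : ∀ k : ZMod 1, (1 : DirichletCharacter ℂ 1) k = 1 := fun k ↦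
        MulChar.one_apply (isUnit_of_subsingleton k)
      simp [charMean, h1]
    have := LFunction_eq_truncated (1 : DirichletCharacter ℂ 1) one_pos (s := (β : ℂ))
      (by simpa using hβ) (by exact_mod_cast hβ1.ne)
    rw [DirichletCharacter.LFunction_modOne_eq, htail, hm] at this
    rw [this]
    simp
    exact MulChar.one_apply (isUnit_of_subsingleton _)

/-- The regularised principal `L`-function is nonnegative on `(0, 1)`. -/
lemma regL_one_of_lt_one (q : ℕ) [NeZero q] {β : ℝ} (hβ : 0 < β) (hβ1 : β < 1) :
    ∃ y : ℝ, 0 ≤ y ∧ regL (1 : DirichletCharacter ℂ q) β = y := by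
  obtain ⟨z, hz, hzeq⟩ := riemannZeta_of_lt_one hβ hβ1
  have hne : (β : ℂ) ≠ 1 := by exact_mod_cast hβ1.ne
  have h := DirichletCharacter.LFunctionTrivChar_eq_mul_riemannZeta (N := q) hne
  rw [DirichletCharacter.LFunctionTrivChar, hzeq] at h
  refine ⟨(∏ p ∈ q.primeFactors, (1 - (p : ℝ) ^ (-β))) * z * ((β - 1) / (β + 1)), ?_, ?_⟩
  · have h1 : 0 ≤ ∏ p ∈ q.primeFactors, (1 - (p : ℝ) ^ (-β)) := by
      refine Finset.prod_nonneg fun p hp ↦ sub_nonneg.2 ?_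
      exact Real.rpow_le_one_of_one_le_of_nonpos
        (by exact_mod_cast (Nat.prime_of_mem_primeFactors hp).one_le) (by linarith)
    refine mul_nonneg_of_nonpos_of_nonpos (mul_nonpos_of_nonneg_of_nonpos h1 hz) ?_
    exact div_nonpos_of_nonpos_of_nonneg (by linarith) (by linarith)
  · rw [regL_one_of_ne hne, h]
    push_cast
    congr 2
    refine Finset.prod_congr rfl fun p _ ↦ ?_
    rw [Complex.ofReal_cpow (by positivity)]
    push_cast
    rfl

open scoped ComplexOrder in
lemma re_LFunction_two_pos {q : ℕ} [NeZero q] {χ : DirichletCharacter ℂ q} (hχ : χ ^ 2 = 1)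
    (hχ1 : χ ≠ 1) : 0 < (DirichletCharacter.LFunction χ (2 : ℝ)).re := by
  have h2 : 1 < (2 : ℂ).re := by simp
  have hD := (hasLogDerivative_charArith (1 : DirichletCharacter ℂ q)).mul
    (hasLogDerivative_charArith χ)
  have hS : LSeriesSummable (charArith (1 : DirichletCharacter ℂ q)) 2 :=
    LSeriesSummable_charArith _ h2
  have hS' : LSeriesSummable (charArith χ) 2 := LSeriesSummable_charArith _ h2
  have h1 := one_le_re_LSeries_two (f := (charArith 1 * charArith χ : ArithmeticFunction ℂ))
    (hD.nonneg (charMangoldt_one_add_nonneg hχ)) hD.1 (ArithmeticFunction.LSeriesSummable_mul hS hS')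
  have h3 := one_le_re_LSeries_two (f := charArith (1 : DirichletCharacter ℂ q)) (fun n ↦ ?_)
    (hasLogDerivative_charArith (1 : DirichletCharacter ℂ q)).1 hS
  · rw [ArithmeticFunction.LSeries_mul' hS hS', Complex.mul_re, LSeries_charArith χ h2] at h1
    have him := im_LFunction_eq_zero hχ hχ1 (β := 2) (by norm_num)
    push_cast at him ⊢
    rw [him, mul_zero, sub_zero] at h1
    by_contra hneg
    nlinarith
  · refine (hasLogDerivative_charArith (1 : DirichletCharacter ℂ q)).nonneg (fun n ↦ ?_) n
    rw [charMangoldt_apply]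
    refine mul_nonneg ?_ (by
      exact_mod_cast (ArithmeticFunction.vonMangoldt_nonneg : 0 ≤ ArithmeticFunction.vonMangoldt n))
    by_cases hn : IsUnit (n : ZMod q)
    · rw [MulChar.one_apply hn]; exact zero_le_one
    · rw [MulChar.map_nonunit _ hn]

lemma re_LFunction_nonneg_of_ne_zero {q : ℕ} [NeZero q] {χ : DirichletCharacter ℂ q}
    (hχ : χ ^ 2 = 1) (hχ1 : χ ≠ 1) {β : ℝ} (hβ : 0 < β) (hβ1 : β < 1)
    (hne : ∀ σ : ℝ, β ≤ σ → σ < 1 → DirichletCharacter.LFunction χ σ ≠ 0) :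
    0 ≤ (DirichletCharacter.LFunction χ β).re := by
  by_contra hneg
  have hcont : Continuous fun σ : ℝ ↦ (DirichletCharacter.LFunction χ σ).re :=
    Complex.continuous_re.comp ((DirichletCharacter.differentiable_LFunction hχ1).continuous.comp
      Complex.continuous_ofReal)
  have hβ2 : β ≤ 2 := by linarith
  have hivt := intermediate_value_Icc hβ2 hcont.continuousOn
  obtain ⟨σ, hσ, hσ0⟩ := hivt (show (0 : ℝ) ∈ Set.Icc _ _ from
    ⟨(not_le.1 hneg).le, (re_LFunction_two_pos hχ hχ1).le⟩)
  have hz : DirichletCharacter.LFunction χ σ = 0 :=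
    Complex.ext hσ0 (im_LFunction_eq_zero hχ hχ1 (by linarith [hσ.1]))
  rcases lt_or_ge σ 1 with h | h
  · exact hne σ hσ.1 h hz
  · exact DirichletCharacter.LFunction_ne_zero_of_one_le_re χ (.inl hχ1) (by simpa using h) hz

open DirichletCharacter in
lemma regL_changeLevel {q Q : ℕ} [NeZero q] [NeZero Q] (h : q ∣ Q) {χ : DirichletCharacter ℂ q}
    (hχ : χ ≠ 1) (s : ℂ) :
    regL (changeLevel h χ) s = regL χ s * ∏ p ∈ Q.primeFactors, (1 - χ p * p ^ (-s)) := by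
  rw [regL_of_ne_one hχ, regL_of_ne_one ((changeLevel_eq_one_iff h).not.2 hχ),
    LFunction_changeLevel h χ (.inl hχ)]

lemma norm_euler_factor_le {q : ℕ} (χ : DirichletCharacter ℂ q) {p : ℕ} (hp : p.Prime) :
    ‖1 - χ p * (p : ℂ) ^ (-1 : ℂ)‖ ≤ 2 ∧ 1 / 2 ≤ ‖1 - χ p * (p : ℂ) ^ (-1 : ℂ)‖ := by
  have h2 : (2 : ℝ) ≤ p := by exact_mod_cast hp.two_le
  have h : ‖χ p * (p : ℂ) ^ (-1 : ℂ)‖ ≤ 1 / 2 := by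
    rw [norm_mul, Complex.cpow_neg_one, norm_inv, Complex.norm_natCast]
    calc _ ≤ 1 * (p : ℝ)⁻¹ := by gcongr; exact χ.norm_le_one _
      _ ≤ 1 / 2 := by rw [one_mul, inv_le_comm₀ (by linarith) (by norm_num)]; simpa using h2
  constructor
  · refine (norm_sub_le _ _).trans ?_
    rw [norm_one]; linarith
  · have := norm_sub_norm_le (1 : ℂ) (χ p * (p : ℂ) ^ (-1 : ℂ))
    rw [norm_one] at this; linarith

lemma norm_prod_euler_factor_le {q : ℕ} (Q : ℕ) (χ : DirichletCharacter ℂ q) :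
    ‖∏ p ∈ Q.primeFactors, (1 - χ p * (p : ℂ) ^ (-1 : ℂ))‖ ≤ 2 ^ Q.primeFactors.card := by
  rw [norm_prod, ← Finset.prod_const]
  exact Finset.prod_le_prod (fun _ _ ↦ norm_nonneg _) fun p hp ↦
    (norm_euler_factor_le χ (Nat.prime_of_mem_primeFactors hp)).1

lemma le_norm_prod_euler_factor {q : ℕ} (Q : ℕ) (χ : DirichletCharacter ℂ q) :
    1 ≤ 2 ^ Q.primeFactors.card * ‖∏ p ∈ Q.primeFactors, (1 - χ p * (p : ℂ) ^ (-1 : ℂ))‖ := by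
  rw [norm_prod, ← Finset.prod_const, ← Finset.prod_mul_distrib]
  refine Finset.one_le_prod fun p hp ↦ ?_
  linarith [(norm_euler_factor_le χ (Nat.prime_of_mem_primeFactors hp)).2]

lemma one_le_norm_regL_one_at_one (q : ℕ) [NeZero q] :
    1 ≤ 2 * 2 ^ q.primeFactors.card * ‖regL (1 : DirichletCharacter ℂ q) 1‖ := by
  have h : regL (1 : DirichletCharacter ℂ q) 1 =
      (∏ p ∈ q.primeFactors, (1 - (1 : DirichletCharacter ℂ 1) p * (p : ℂ) ^ (-1 : ℂ))) / 2 := by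
    simp only [regL, if_true, DirichletCharacter.LFunctionTrivChar₁, Function.update_self]
    norm_num
    refine Finset.prod_congr rfl fun p _ ↦ ?_
    rw [MulChar.one_apply (isUnit_of_subsingleton _), one_mul, Complex.cpow_neg_one]
  have h2 := le_norm_prod_euler_factor q (1 : DirichletCharacter ℂ 1)
  rw [h, norm_div, show ‖(2 : ℂ)‖ = 2 by simp]
  linarith

lemma siegel_of_no_zero {ε : ℝ} (hε : 0 < ε) (hε1 : ε ≤ 1)
    (hno : ∀ (q : ℕ) [NeZero q] (χ : DirichletCharacter ℂ q), χ ^ 2 = 1 → χ ≠ 1 →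
      ∀ σ : ℝ, 1 - ε / 48 ≤ σ → σ < 1 → regL χ σ ≠ 0) :
    ∃ c : ℝ, 0 < c ∧ ∀ (q : ℕ) [NeZero q] (χ : DirichletCharacter ℂ q), χ ^ 2 = 1 → χ ≠ 1 →
      c ≤ (q : ℝ) ^ ε * ‖regL χ 1‖ := by
  obtain ⟨c, hc, h⟩ := norm_regL_two_ge (β := 1 - ε / 48) (by linarith) (by linarith)
  obtain ⟨C, hC1, hC⟩ := norm_regL_at_one_le (ε := ε / 2) (by linarith) (by linarith)
  refine ⟨c / C, by positivity, fun q _ χ hχ hχ1 ↦ ?_⟩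
  have hq : (0 : ℝ) < q := by exact_mod_cast Nat.pos_of_neZero q
  have h1 := h q χ hχ hχ1 ?_
  · rw [show -(24 * (1 - (1 - ε / 48))) = -(ε / 2) by ring, Real.rpow_neg hq.le,
      ← div_eq_mul_inv, div_le_iff₀ (by positivity)] at h1
    rw [div_le_iff₀ (by positivity), show ε = ε / 2 + ε / 2 by ring, Real.rpow_add hq]
    have h2 := hC q 1
    set Y := (q : ℝ) ^ (ε / 2)
    have hY : 0 < Y := by positivity
    calc c ≤ ‖regL (1 : DirichletCharacter ℂ q) 1‖ * ‖regL χ 1‖ * Y := h1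
      _ ≤ C * Y * ‖regL χ 1‖ * Y := by gcongr
      _ = _ := by ring
  · obtain ⟨y, hy, hyeq⟩ := regL_one_of_lt_one q (β := 1 - ε / 48) (by linarith) (by linarith)
    rw [hyeq, Complex.re_ofReal_mul, regL_of_ne_one hχ1]
    refine mul_nonneg hy (re_LFunction_nonneg_of_ne_zero hχ hχ1 (by linarith) (by linarith) ?_)
    intro σ h1 h2
    rw [← regL_of_ne_one hχ1]
    exact hno q χ hχ hχ1 σ h1 h2

open DirichletCharacter in
lemma siegel_of_zero {ε : ℝ} (hε1 : ε ≤ 1) {q₁ : ℕ} [NeZero q₁]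
    {χ₁ : DirichletCharacter ℂ q₁} (hχ₁ : χ₁ ^ 2 = 1) (hχ₁1 : χ₁ ≠ 1) {σ : ℝ}
    (hσ : 1 - ε / 48 ≤ σ) (hσ1 : σ < 1) (h0 : regL χ₁ σ = 0) :
    ∃ c : ℝ, 0 < c ∧ ∀ (q : ℕ) [NeZero q] (χ : DirichletCharacter ℂ q), χ ^ 2 = 1 → χ ≠ 1 →
      c ≤ (q : ℝ) ^ ε * ‖regL χ 1‖ := by
  obtain ⟨c, hc, h⟩ := norm_regL_four_ge (β := σ) (by linarith) hσ1
  obtain ⟨C, hC1, hC⟩ := norm_regL_at_one_le (ε := ε / 8) (by linarith) (by linarith)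
  obtain ⟨C₂, hC₂1, hC₂⟩ := two_pow_card_primeFactors_le (ε := ε / 8) (by linarith)
  have hL₁ : 0 < ‖regL χ₁ 1‖ := by
    rw [regL_of_ne_one hχ₁1, norm_pos_iff]
    exact LFunction_apply_one_ne_zero hχ₁1
  have hq₁ : (0 : ℝ) < q₁ := by exact_mod_cast Nat.pos_of_neZero q₁
  refine ⟨min (c / (C ^ 3 * C₂)) (‖regL χ₁ 1‖ / C₂ ^ 2) / (q₁ : ℝ) ^ ε, by positivity,
    fun q _ χ hχ hχ1 ↦ ?_⟩
  have hq : (0 : ℝ) < q := by exact_mod_cast Nat.pos_of_neZero q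
  have : NeZero (q₁ * q) := ⟨mul_ne_zero (NeZero.ne _) (NeZero.ne _)⟩
  set Q := q₁ * q with hQ
  have hQ1 : (1 : ℝ) ≤ Q := by exact_mod_cast NeZero.one_le
  have hd₁ : q₁ ∣ Q := dvd_mul_right _ _
  have hd : q ∣ Q := dvd_mul_left _ _
  set Y := (Q : ℝ) ^ (ε / 8) with hY
  have hY1 : 1 ≤ Y := Real.one_le_rpow hQ1 (by linarith)
  have hY8 : (q₁ : ℝ) ^ ε * (q : ℝ) ^ ε = Y ^ 8 := by
    rw [hY, ← Real.rpow_natCast, ← Real.rpow_mul (by linarith), ← Real.mul_rpow hq₁.le hq.le, hQ]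
    push_cast
    congr 1
    ring
  have hω := hC₂ Q (NeZero.ne Q)
  rw [div_le_iff₀ (by positivity)]
  suffices hmain : min (c / (C ^ 3 * C₂)) (‖regL χ₁ 1‖ / C₂ ^ 2) ≤ Y ^ 8 * ‖regL χ 1‖ by
    rw [← hY8] at hmain
    linarith
  by_cases hprod : changeLevel hd₁ χ₁ * changeLevel hd χ = 1
  · refine (min_le_right _ _).trans ?_
    have heq : changeLevel hd₁ χ₁ = changeLevel hd χ := by
      have h2 : changeLevel hd χ * changeLevel hd χ = 1 := by
        rw [← map_mul, ← sq, hχ, map_one]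
      exact mul_right_cancel (hprod.trans h2.symm)
    have h3 := regL_changeLevel hd₁ hχ₁1 1
    rw [heq, regL_changeLevel hd hχ1 1] at h3
    have h4 := congrArg norm h3
    rw [norm_mul, norm_mul] at h4
    have h5 := norm_prod_euler_factor_le Q χ
    have h6 := le_norm_prod_euler_factor Q χ₁
    set A := ‖∏ p ∈ Q.primeFactors, (1 - χ p * (p : ℂ) ^ (-1 : ℂ))‖
    set B := ‖∏ p ∈ Q.primeFactors, (1 - χ₁ p * (p : ℂ) ^ (-1 : ℂ))‖
    set W := (2 : ℝ) ^ Q.primeFactors.card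
    have hW : 0 < W := by positivity
    rw [div_le_iff₀ (by positivity)]
    calc ‖regL χ₁ 1‖ ≤ ‖regL χ₁ 1‖ * (W * B) := le_mul_of_one_le_right hL₁.le h6
      _ = W * (‖regL χ 1‖ * A) := by rw [h4]; ring
      _ ≤ (C₂ * Y) * (‖regL χ 1‖ * (C₂ * Y)) := by gcongr; exact h5.trans hω
      _ = Y ^ 2 * ‖regL χ 1‖ * C₂ ^ 2 := by ring
      _ ≤ Y ^ 8 * ‖regL χ 1‖ * C₂ ^ 2 := by gcongr; norm_num
  · refine (min_le_left _ _).trans ?_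
    have h1 := h Q (changeLevel hd₁ χ₁) (changeLevel hd χ) (by rw [← map_pow, hχ₁, map_one])
      (by rw [← map_pow, hχ, map_one]) ((changeLevel_eq_one_iff hd₁).not.2 hχ₁1)
      ((changeLevel_eq_one_iff hd).not.2 hχ1) hprod
      (by rw [regL_changeLevel hd₁ hχ₁1, h0, zero_mul])
    have h2 : (Y ^ 4)⁻¹ ≤ (Q : ℝ) ^ (-(24 * (1 - σ))) := by
      rw [hY, ← Real.rpow_natCast, ← Real.rpow_mul (by linarith), ← Real.rpow_neg (by linarith)]
      refine Real.rpow_le_rpow_of_exponent_le hQ1 ?_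
      push_cast
      linarith
    have h3 : ‖regL (changeLevel hd χ) 1‖ ≤ ‖regL χ 1‖ * (C₂ * Y) := by
      rw [regL_changeLevel hd hχ1, norm_mul]
      gcongr
      exact (norm_prod_euler_factor_le Q χ).trans hω
    rw [div_le_iff₀ (by positivity)]
    have h4 : c ≤ Y ^ 4 * (c * (Q : ℝ) ^ (-(24 * (1 - σ)))) := by
      calc c = Y ^ 4 * (c * (Y ^ 4)⁻¹) := by field_simp
        _ ≤ _ := by gcongr
    calc c ≤ Y ^ 4 * (c * (Q : ℝ) ^ (-(24 * (1 - σ)))) := h4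
      _ ≤ Y ^ 4 * ((C * Y) * ((C * Y) * (‖regL χ 1‖ * (C₂ * Y)) * (C * Y))) := by
        refine mul_le_mul_of_nonneg_left (h1.trans ?_) (by positivity)
        gcongr
        all_goals exact hC Q _
      _ = Y ^ 8 * ‖regL χ 1‖ * (C ^ 3 * C₂) := by ring

/-- Siegel's lower bound for real characters. -/
theorem siegel {ε : ℝ} (hε : 0 < ε) (hε1 : ε ≤ 1) :
    ∃ c : ℝ, 0 < c ∧ ∀ (q : ℕ) [NeZero q] (χ : DirichletCharacter ℂ q), χ ^ 2 = 1 →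
      c ≤ (q : ℝ) ^ ε * ‖regL χ 1‖ := by
  have hmain : ∃ c : ℝ, 0 < c ∧ ∀ (q : ℕ) [NeZero q] (χ : DirichletCharacter ℂ q), χ ^ 2 = 1 →
      χ ≠ 1 → c ≤ (q : ℝ) ^ ε * ‖regL χ 1‖ := by
    by_cases hno : ∀ (q : ℕ) [NeZero q] (χ : DirichletCharacter ℂ q), χ ^ 2 = 1 → χ ≠ 1 →
      ∀ σ : ℝ, 1 - ε / 48 ≤ σ → σ < 1 → regL χ σ ≠ 0
    · exact siegel_of_no_zero hε hε1 hno
    · push Not at hno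
      obtain ⟨q₁, _, χ₁, h1, h2, σ, h3, h4, h5⟩ := hno
      exact siegel_of_zero hε1 h1 h2 h3 h4 h5
  obtain ⟨c, hc, h⟩ := hmain
  obtain ⟨C, hC1, hC⟩ := two_pow_card_primeFactors_le hε
  refine ⟨min c (1 / (2 * C)), by positivity, fun q _ χ hχ ↦ ?_⟩
  by_cases hχ1 : χ = 1
  · subst hχ1
    refine (min_le_right _ _).trans ?_
    rw [div_le_iff₀ (by positivity)]
    have h1 := one_le_norm_regL_one_at_one q
    have h2 := hC q (NeZero.ne q)
    calc (1 : ℝ) ≤ 2 * 2 ^ q.primeFactors.card * ‖regL (1 : DirichletCharacter ℂ q) 1‖ := h1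
      _ ≤ 2 * (C * (q : ℝ) ^ ε) * ‖regL (1 : DirichletCharacter ℂ q) 1‖ := by gcongr
      _ = _ := by ring
  · exact (min_le_left _ _).trans (h q χ hχ hχ1)

lemma condSize_le {q : ℕ} {s w : ℂ} {K : ℝ} (h : ‖w‖ + 2 ≤ K * (‖s‖ + 2)) :
    condSize q w ≤ K * condSize q s := by
  unfold condSize
  have hq : (0 : ℝ) ≤ q := by positivity
  nlinarith

lemma condSize_rpow_le {q : ℕ} [NeZero q] {s w : ℂ} {K δ : ℝ} (hδ : 0 ≤ δ) (hδ1 : δ ≤ 1)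
    (hK : 1 ≤ K) (h : ‖w‖ + 2 ≤ K * (‖s‖ + 2)) :
    condSize q w ^ δ ≤ K * condSize q s ^ δ := by
  have h1 := two_le_condSize q w
  have h2 := two_le_condSize q s
  calc condSize q w ^ δ ≤ (K * condSize q s) ^ δ := by
        gcongr
        exact condSize_le h
    _ = K ^ δ * condSize q s ^ δ := Real.mul_rpow (by linarith) (by linarith)
    _ ≤ K * condSize q s ^ δ := by
      gcongr
      calc K ^ δ ≤ K ^ (1 : ℝ) := Real.rpow_le_rpow_of_exponent_le hK hδ1
        _ = K := Real.rpow_one K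

lemma norm_deriv_regL_le {δ : ℝ} (hδ : 0 < δ) (hδ1 : δ ≤ 1) :
    ∃ C : ℝ, 1 ≤ C ∧ ∀ (q : ℕ) [NeZero q] (χ : DirichletCharacter ℂ q) (s : ℂ),
      1 ≤ s.re → ‖deriv (regL χ) s‖ ≤ C * condSize q s ^ δ := by
  obtain ⟨C, hC1, hC⟩ := norm_regL_le hδ hδ1
  refine ⟨C * 2 / (δ / 2), ?_, fun q _ χ s hs ↦ ?_⟩
  · rw [le_div_iff₀ (by positivity)]; linarith
  have hre : ∀ w ∈ Metric.closedBall s (δ / 2), 1 - δ / 2 ≤ w.re := by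
    intro w hw
    have h1 : ‖w - s‖ ≤ δ / 2 := by simpa [dist_eq_norm] using hw
    have h2 := (abs_le.1 ((Complex.abs_re_le_norm _).trans h1)).1
    simp at h2
    linarith
  have := Complex.norm_deriv_le_of_forall_mem_sphere_norm_le (f := regL χ) (c := s)
    (R := δ / 2) (C := C * (2 * condSize q s ^ δ)) (by positivity) ?_ ?_
  · refine this.trans (le_of_eq ?_)
    ring
  · refine DifferentiableOn.diffContOnCl ?_
    rw [closure_ball _ (by positivity)]
    exact fun w hw ↦ (differentiableAt_regL χ (by linarith [hre w hw])).differentiableWithinAt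
  · intro w hw
    have hw' := Metric.sphere_subset_closedBall hw
    refine (hC q χ w (hre w hw')).trans ?_
    gcongr
    refine condSize_rpow_le hδ.le hδ1 (by norm_num) ?_
    have h1 : ‖w - s‖ ≤ δ / 2 := by simpa [dist_eq_norm] using hw'
    have h2 : ‖w‖ ≤ ‖w - s‖ + ‖s‖ := by simpa using norm_add_le (w - s) s
    linarith [norm_nonneg s]

lemma norm_regL_sub_le {δ : ℝ} (hδ : 0 < δ) (hδ1 : δ ≤ 1) :
    ∃ C : ℝ, 1 ≤ C ∧ ∀ (q : ℕ) [NeZero q] (χ : DirichletCharacter ℂ q) (s w : ℂ),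
      1 ≤ s.re → 1 ≤ w.re → ‖w‖ ≤ ‖s‖ + 2 →
      ‖regL χ s - regL χ w‖ ≤ C * condSize q s ^ δ * ‖s - w‖ := by
  obtain ⟨C, hC1, hC⟩ := norm_deriv_regL_le hδ hδ1
  refine ⟨C * 2, by linarith, fun q _ χ s w hs hw hsw ↦ ?_⟩
  have hconv : Convex ℝ ({z : ℂ | 1 ≤ z.re} ∩ Metric.closedBall 0 (‖s‖ + 2)) :=
    (convex_halfSpace_re_ge 1).inter (convex_closedBall 0 _)
  refine hconv.norm_image_sub_le_of_norm_deriv_le (f := regL χ)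
    (fun z hz ↦ differentiableAt_regL χ (lt_of_lt_of_le one_pos hz.1)) (fun z hz ↦ ?_)
    (x := w) (y := s) ⟨hw, by simpa using hsw⟩ ⟨hs, by simp⟩
  refine (hC q χ z hz.1).trans ?_
  rw [mul_assoc]
  gcongr
  refine condSize_rpow_le hδ.le hδ1 (by norm_num) ?_
  have : ‖z‖ ≤ ‖s‖ + 2 := by simpa using hz.2
  linarith [norm_nonneg s]

/-- Consequence of the inequality `3 + 4 cos θ + cos 2θ ≥ 0`. -/
lemma norm_LFunction_pow_four_ge {δ : ℝ} (hδ : 0 < δ) (hδ1 : δ ≤ 1) :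
    ∃ C : ℝ, 1 ≤ C ∧ ∀ (q : ℕ) [NeZero q] (χ : DirichletCharacter ℂ q) (x y ρ : ℝ),
      0 < x → x ≤ 1 → 0 < ρ → ρ ≤ 1 → (χ ^ 2 = 1 → ρ ≤ ‖(x + 2 * Complex.I * y : ℂ)‖) →
      x ^ 3 * ρ ≤ (C * condSize q (1 + x + Complex.I * y) ^ δ) ^ 4 *
        ‖DirichletCharacter.LFunction χ (1 + x + Complex.I * y)‖ ^ 4 := by
  obtain ⟨C, hC1, hC⟩ := norm_regL_le hδ hδ1
  refine ⟨C * 6, by linarith, fun q _ χ x y ρ hx hx1 hρ hρ1 hχρ ↦ ?_⟩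
  set s : ℂ := 1 + x + Complex.I * y with hs
  set X := condSize q s ^ δ with hX
  have hXpos : 0 < X := Real.rpow_pos_of_pos (by linarith [two_le_condSize q s]) _
  have h341 := DirichletCharacter.norm_LFunction_product_ge_one χ hx y
  rw [norm_mul, norm_mul, norm_pow, norm_pow] at h341
  have hsre : s.re = 1 + x := by simp [hs]
  have hsim : s.im = y := by simp [hs]
  have hnorm : 1 + x ≤ ‖s‖ := by
    rw [← hsre]; exact Complex.re_le_norm s
  have h0 : ‖DirichletCharacter.LFunctionTrivChar q (1 + x)‖ ≤ C * (2 * X) * (3 / x) := by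
    have hne : (1 + x : ℂ) ≠ 1 := by simp [hx.ne']
    have h1 := norm_LFunction_le_regL (1 : DirichletCharacter ℂ q) (s := 1 + x)
      (by simp; linarith) hne
    refine h1.trans ?_
    have h2 : ‖(1 + x : ℂ) - 1‖ = x := by
      rw [add_sub_cancel_left, Complex.norm_real, Real.norm_of_nonneg hx.le]
    have h3 : ‖(1 + x : ℂ)‖ = 1 + x := by
      rw [show (1 + x : ℂ) = ((1 + x : ℝ) : ℂ) by push_cast; ring, Complex.norm_real,
        Real.norm_of_nonneg (by linarith)]
    gcongr
    · refine (hC q 1 _ (by simp; linarith)).trans ?_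
      gcongr
      exact condSize_rpow_le hδ.le hδ1 (by norm_num) (by rw [h3]; linarith)
    · rw [h2, show 3 / x = 1 / x + 2 / x by ring]
      gcongr
      rw [le_div_iff₀ hx]; linarith
  have h2 : ‖DirichletCharacter.LFunction (χ ^ 2) (1 + x + 2 * Complex.I * y)‖ ≤
      C * (2 * X) * (3 / ρ) := by
    set w : ℂ := 1 + x + 2 * Complex.I * y with hw
    have hwre : w.re = 1 + x := by simp [hw]
    have hww : ‖w‖ + 2 ≤ 2 * (‖s‖ + 2) := by
      have : w = 2 * s - (1 + x : ℝ) := by rw [hw, hs]; push_cast; ring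
      have h4 : ‖w‖ ≤ 2 * ‖s‖ + (1 + x) := by
        rw [this]
        refine (norm_sub_le _ _).trans ?_
        rw [norm_mul, Complex.norm_real, Real.norm_of_nonneg (by linarith)]
        simp
      linarith
    have hreg : ‖regL (χ ^ 2) w‖ ≤ C * (2 * X) := by
      refine (hC q _ _ (by rw [hwre]; linarith)).trans ?_
      gcongr
      exact condSize_rpow_le hδ.le hδ1 (by norm_num) hww
    have hρ3 : 1 ≤ 3 / ρ := by rw [le_div_iff₀ hρ]; linarith
    by_cases hχ : χ ^ 2 = 1
    · have hwne : w ≠ 1 := by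
        intro h; rw [h] at hwre; simp at hwre; linarith
      refine (norm_LFunction_le_regL (χ ^ 2) (by rw [hwre]; linarith) hwne).trans ?_
      gcongr
      have h5 : ρ ≤ ‖w - 1‖ := by
        refine (hχρ hχ).trans (le_of_eq ?_)
        rw [hw]; ring_nf
      rw [show 3 / ρ = 1 / ρ + 2 / ρ by ring]
      gcongr
      rw [le_div_iff₀ hρ]; linarith
    · rw [← regL_of_ne_one hχ]
      refine hreg.trans (le_mul_of_one_le_right (by positivity) hρ3)
  set L := ‖DirichletCharacter.LFunction χ s‖ with hL
  have h5 : 1 ≤ (C * (2 * X) * (3 / x)) ^ 3 * L ^ 4 * (C * (2 * X) * (3 / ρ)) := by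
    refine le_trans h341 ?_
    gcongr
  calc x ^ 3 * ρ ≤ x ^ 3 * ρ *
        ((C * (2 * X) * (3 / x)) ^ 3 * L ^ 4 * (C * (2 * X) * (3 / ρ))) :=
        le_mul_of_one_le_right (by positivity) h5
    _ = (C * 6 * X) ^ 4 * L ^ 4 := by
      field_simp; ring

lemma norm_regL_pow_four_ge {δ : ℝ} (hδ : 0 < δ) (hδ1 : δ ≤ 1) :
    ∃ C : ℝ, 1 ≤ C ∧ ∀ (q : ℕ) [NeZero q] (χ : DirichletCharacter ℂ q) (x y ρ : ℝ),
      0 < x → x ≤ 1 → 0 < ρ → ρ ≤ 1 → (χ ^ 2 = 1 → ρ ≤ ‖(x + 2 * Complex.I * y : ℂ)‖) →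
      x ^ 3 * ρ ^ 5 ≤ (C * condSize q (1 + x + Complex.I * y) ^ δ) ^ 4 *
        ‖regL χ (1 + x + Complex.I * y)‖ ^ 4 := by
  obtain ⟨C, hC1, hC⟩ := norm_LFunction_pow_four_ge hδ hδ1
  refine ⟨C * 6, by linarith, fun q _ χ x y ρ hx hx1 hρ hρ1 hχρ ↦ ?_⟩
  have h1 := hC q χ x y ρ hx hx1 hρ hρ1 hχρ
  set s : ℂ := 1 + x + Complex.I * y with hs
  have h2 := two_le_condSize q s
  have hreg : ρ * ‖DirichletCharacter.LFunction χ s‖ ≤ 6 * ‖regL χ s‖ := by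
    by_cases hχ : χ = 1
    · have hsne : s ≠ 1 := by
        intro h
        have := congrArg Complex.re h
        simp [hs] at this
        linarith
      have hρ' : ρ / 2 ≤ ‖s - 1‖ := by
        have h3 := hχρ (by rw [hχ, one_pow])
        have h4 : ‖(x + 2 * Complex.I * y : ℂ)‖ ≤ 2 * ‖s - 1‖ := by
          have h5 : s - 1 = x + Complex.I * y := by rw [hs]; ring
          rw [h5]
          have e1 : (x + 2 * Complex.I * y : ℂ) = (⟨x, 2 * y⟩ : ℂ) := by
            apply Complex.ext <;> simp
          have e2 : (x + Complex.I * y : ℂ) = (⟨x, y⟩ : ℂ) := by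
            apply Complex.ext <;> simp
          rw [e1, e2]
          refine (sq_le_sq₀ (norm_nonneg _) (by positivity)).1 ?_
          rw [mul_pow, Complex.sq_norm, Complex.sq_norm, Complex.normSq_mk, Complex.normSq_mk]
          nlinarith [mul_self_nonneg x]
        linarith
      have h3 := norm_regL_le_LFunction χ hsne
      have h4 : ρ / 6 ≤ min 1 (‖s - 1‖ / ‖s + 1‖) := by
        have hpos : 0 < ‖s + 1‖ :=
          lt_of_lt_of_le one_pos (one_le_norm_add_one (by simp [hs]; linarith))
        refine le_min (by linarith) ?_
        rw [le_div_iff₀ hpos]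
        have h5 : ‖s + 1‖ ≤ ‖s - 1‖ + 2 := by
          have := norm_add_le (s - 1) 2
          rw [show ‖(2 : ℂ)‖ = 2 by simp] at this
          rwa [show s - 1 + 2 = s + 1 by ring] at this
        nlinarith
      nlinarith [norm_nonneg (DirichletCharacter.LFunction χ s)]
    · rw [regL_of_ne_one hχ]
      nlinarith [norm_nonneg (DirichletCharacter.LFunction χ s)]
  have h3 : (ρ * ‖DirichletCharacter.LFunction χ s‖) ^ 4 ≤ (6 * ‖regL χ s‖) ^ 4 := by gcongr
  calc x ^ 3 * ρ ^ 5 = ρ ^ 4 * (x ^ 3 * ρ) := by ring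
    _ ≤ ρ ^ 4 * ((C * condSize q s ^ δ) ^ 4 * ‖DirichletCharacter.LFunction χ s‖ ^ 4) := by gcongr
    _ = (C * condSize q s ^ δ) ^ 4 * (ρ * ‖DirichletCharacter.LFunction χ s‖) ^ 4 := by ring
    _ ≤ (C * condSize q s ^ δ) ^ 4 * (6 * ‖regL χ s‖) ^ 4 := by gcongr
    _ = _ := by ring

lemma norm_regL_ge {ε : ℝ} (hε : 0 < ε) (hε1 : ε ≤ 1) :
    ∃ c : ℝ, 0 < c ∧ ∀ (q : ℕ) [NeZero q] (χ : DirichletCharacter ℂ q) (s : ℂ),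
      1 < s.re → s.re ≤ 2 → c ≤ condSize q s ^ ε * ‖regL χ s‖ := by
  set δ := ε / 37 with hδε
  have hδ : 0 < δ := by positivity
  have hδ1 : δ ≤ 1 := by rw [hδε]; linarith
  obtain ⟨C₁, hC₁1, hC₁⟩ := norm_regL_pow_four_ge hδ hδ1
  obtain ⟨C₂, hC₂1, hC₂⟩ := norm_regL_sub_le hδ hδ1
  obtain ⟨c', hc', hsiegel⟩ := siegel hδ hδ1
  set c₀ := min c' 1 with hc₀
  have hc₀pos : 0 < c₀ := lt_min hc' one_pos
  have hc₀1 : c₀ ≤ 1 := min_le_right _ _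
  set K := 4 * C₁ * C₂ with hK
  have hK1 : 1 ≤ K := by nlinarith
  set κ := (c₀ / (4 * C₂)) ^ 5 / K ^ 4 with hκ
  have hκpos : 0 < κ := by positivity
  refine ⟨κ ^ 2 / C₁, by positivity, fun q _ χ s hs1 hs2 ↦ ?_⟩
  have hcs := two_le_condSize q s
  set X := condSize q s ^ δ with hX
  have hX1 : 1 ≤ X := Real.one_le_rpow (by linarith) hδ.le
  have hXε : condSize q s ^ ε = X ^ 37 := by
    rw [hX, ← Real.rpow_natCast, ← Real.rpow_mul (by linarith), hδε]
    congr 1; push_cast; ring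
  rw [hXε]
  set r := c₀ / (4 * C₂) / X ^ 2 with hr
  have hrpos : 0 < r := by positivity
  have hrc : r ≤ c₀ / 4 := by
    rw [hr, div_div]
    gcongr
    have : 1 ≤ X ^ 2 := one_le_pow₀ hX1
    nlinarith
  have hr1 : r ≤ 1 := by linarith
  set η := r ^ 5 / (K ^ 4 * X ^ 8) with hη
  have hηpos : 0 < η := by positivity
  have hηr : η ≤ r := by
    have h1 : 1 ≤ K ^ 4 * X ^ 8 := one_le_mul_of_one_le_of_one_le (one_le_pow₀ hK1)
      (one_le_pow₀ hX1)
    calc η ≤ r ^ 5 := div_le_self (by positivity) h1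
      _ ≤ r := pow_le_of_le_one hrpos.le hr1 (by norm_num)
  have hη1 : η ≤ 1 := hηr.trans hr1
  have hηκ : η = κ / X ^ 18 := by
    rw [hη, hκ, hr]; field_simp
  suffices h : η ^ 2 / (C₁ * X) ≤ ‖regL χ s‖ by
    calc κ ^ 2 / C₁ = X ^ 37 * (η ^ 2 / (C₁ * X)) := by
          rw [hηκ]; field_simp
      _ ≤ _ := by gcongr
  have hXpos : 0 < X := by linarith
  have hC₁X : 1 ≤ C₁ * X := one_le_mul_of_one_le_of_one_le hC₁1 hX1
  have hseq : s = 1 + ((s.re - 1 : ℝ) : ℂ) + Complex.I * s.im := by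
    apply Complex.ext <;> simp
  rcases le_or_gt η (s.re - 1) with hcase | hcase
  · have h1 := hC₁ q χ (s.re - 1) s.im (s.re - 1) (by linarith) (by linarith) (by linarith)
      (by linarith) (fun _ ↦ by
        refine le_trans (le_of_eq ?_) (Complex.re_le_norm _)
        simp)
    rw [← hseq] at h1
    have h2 : (η ^ 2) ^ 4 ≤ (C₁ * X * ‖regL χ s‖) ^ 4 := by
      rw [mul_pow (C₁ * X)]
      refine le_trans ?_ h1
      calc (η ^ 2) ^ 4 = η ^ 3 * η ^ 5 := by ring
        _ ≤ _ := by gcongr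
    have h3 := (pow_le_pow_iff_left₀ (by positivity) (by positivity) (by norm_num)).1 h2
    rwa [div_le_iff₀' (by positivity)]
  by_cases hcase2 : χ ^ 2 = 1 ∧ |s.im| < r
  · obtain ⟨hχ, him⟩ := hcase2
    have h1 := hsiegel q χ hχ
    have h2 : (q : ℝ) ^ δ ≤ X := by
      rw [hX]
      gcongr
      unfold condSize
      have : (0 : ℝ) ≤ q := by positivity
      nlinarith [norm_nonneg s]
    have h3 : c₀ / X ≤ ‖regL χ 1‖ := by
      rw [div_le_iff₀' hXpos]
      refine (min_le_left _ _).trans (h1.trans ?_)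
      gcongr
    have h4 := hC₂ q χ s 1 hs1.le (by simp) (by simp; linarith [norm_nonneg s])
    have h5 : ‖s - 1‖ ≤ 2 * r := by
      have := Complex.norm_le_abs_re_add_abs_im (s - 1)
      simp only [Complex.sub_re, Complex.one_re, Complex.sub_im, Complex.one_im, sub_zero] at this
      rw [abs_of_pos (by linarith)] at this
      linarith
    have h6 : C₂ * X * ‖s - 1‖ ≤ c₀ / (2 * X) := by
      calc C₂ * X * ‖s - 1‖ ≤ C₂ * X * (2 * r) := by gcongr
        _ = c₀ / (2 * X) := by rw [hr]; field_simp; norm_num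
    have h7 : ‖regL χ 1‖ - ‖regL χ s - regL χ 1‖ ≤ ‖regL χ s‖ := by
      have := norm_sub_norm_le (regL χ 1) (regL χ s)
      rw [norm_sub_rev] at this
      linarith
    have h8 : c₀ / X = 2 * (c₀ / (2 * X)) := by field_simp
    have h9 : η ^ 2 / (C₁ * X) ≤ c₀ / (2 * X) := by
      rw [div_le_div_iff₀ (by positivity) (by positivity)]
      have : η ^ 2 ≤ c₀ / 4 := (pow_le_of_le_one hηpos.le hη1 (by norm_num)).trans (hηr.trans hrc)
      calc η ^ 2 * (2 * X) ≤ c₀ / 4 * (2 * X) := by gcongr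
        _ ≤ c₀ * (1 * X) := by nlinarith
        _ ≤ c₀ * (C₁ * X) := by gcongr
    linarith
  · set w : ℂ := 1 + (η : ℂ) + Complex.I * s.im with hw
    have hsw : s - w = ((s.re - 1 - η : ℝ) : ℂ) := by
      rw [hw]; nth_rewrite 1 [hseq]; push_cast; ring
    have hswn : ‖s - w‖ ≤ η := by
      rw [hsw, Complex.norm_real, Real.norm_eq_abs, abs_le]
      constructor <;> linarith
    have hws : ‖w‖ ≤ ‖s‖ + 1 := by
      have := norm_sub_norm_le w s
      rw [norm_sub_rev] at this
      linarith
    have h1 := hC₁ q χ η s.im r hηpos hη1 hrpos hr1 (fun hχ ↦ by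
      have h2 : r ≤ |s.im| := by
        by_contra h
        exact hcase2 ⟨hχ, by linarith⟩
      refine le_trans ?_ (Complex.abs_im_le_norm _)
      simp [abs_mul]
      linarith [abs_nonneg s.im])
    rw [← hw] at h1
    have hXw : condSize q w ^ δ ≤ 2 * X :=
      condSize_rpow_le hδ.le hδ1 (by norm_num) (by linarith [norm_nonneg s])
    have h2 := hC₂ q χ s w hs1.le (by simp [hw, hηpos.le]) (by linarith)
    have h3 : 2 * C₂ * X * η ≤ ‖regL χ w‖ := by
      by_contra hlt
      push Not at hlt
      have hcw := two_le_condSize q w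
      have h4 : η ^ 3 * r ^ 5 < (C₁ * (2 * X)) ^ 4 * (2 * C₂ * X * η) ^ 4 := by
        refine h1.trans_lt ?_
        calc _ ≤ (C₁ * (2 * X)) ^ 4 * ‖regL χ w‖ ^ 4 := by gcongr
          _ < _ := by gcongr
      have h5 : r ^ 5 = K ^ 4 * X ^ 8 * η := by rw [hη]; field_simp
      rw [h5, hK] at h4
      apply lt_irrefl _ (h4.trans_le (le_of_eq _))
      ring
    have h4 : C₂ * X * ‖s - w‖ ≤ C₂ * X * η := by gcongr
    have h5 : ‖regL χ w‖ - ‖regL χ s - regL χ w‖ ≤ ‖regL χ s‖ := by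
      have := norm_sub_norm_le (regL χ w) (regL χ s)
      rw [norm_sub_rev] at this
      linarith
    have h6 : η ≤ C₂ * X * η :=
      le_mul_of_one_le_left hηpos.le (one_le_mul_of_one_le_of_one_le hC₂1 hX1)
    have h7 : η ^ 2 / (C₁ * X) ≤ η :=
      (div_le_self (by positivity) hC₁X).trans (pow_le_of_le_one hηpos.le hη1 (by norm_num))
    linarith

lemma differentiableOn_dslope_regL {q : ℕ} [NeZero q] (χ : DirichletCharacter ℂ q) :
    DifferentiableOn ℂ (dslope (regL χ) 1) {s : ℂ | 0 < s.re} := by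
  have hopen : IsOpen {s : ℂ | 0 < s.re} := isOpen_lt continuous_const Complex.continuous_re
  rw [Complex.differentiableOn_dslope (hopen.mem_nhds (by simp))]
  exact fun w hw ↦ (differentiableAt_regL χ hw).differentiableWithinAt

lemma norm_dslope_regL_le {ε : ℝ} (hε : 0 < ε) (hε1 : ε ≤ 1) :
    ∃ C : ℝ, 1 ≤ C ∧ ∀ s : ℂ, 1 - ε / 2 ≤ s.re →
      ‖dslope (regL (1 : DirichletCharacter ℂ 1)) 1 s‖ ≤ C * condSize 1 s ^ ε := by
  obtain ⟨C, hC1, hC⟩ := norm_regL_le hε hε1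
  obtain ⟨M, hM⟩ := (isCompact_closedBall (1 : ℂ) (1 / 2)).exists_bound_of_continuousOn
    (f := dslope (regL (1 : DirichletCharacter ℂ 1)) 1)
    ((differentiableOn_dslope_regL _).continuousOn.mono fun w hw ↦ by
      have h1 : ‖w - 1‖ ≤ 1 / 2 := by simpa [dist_eq_norm] using hw
      have h2 := (abs_le.1 ((Complex.abs_re_le_norm _).trans h1)).1
      simp at h2
      show 0 < w.re
      linarith)
  set N := ‖regL (1 : DirichletCharacter ℂ 1) 1‖ with hN
  have hNpos : 0 ≤ N := norm_nonneg _
  have hMpos : 0 ≤ M := (norm_nonneg _).trans (hM 1 (by simp))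
  refine ⟨2 * C + 2 * N + M, by linarith, fun s hs ↦ ?_⟩
  have h1 : 1 ≤ condSize 1 s ^ ε := Real.one_le_rpow (by linarith [two_le_condSize 1 s]) hε.le
  by_cases hs1 : s ∈ Metric.closedBall (1 : ℂ) (1 / 2)
  · refine (hM s hs1).trans ?_
    nlinarith
  · have h2 : 1 / 2 ≤ ‖s - 1‖ := by
      simp [dist_eq_norm] at hs1
      linarith
    have hne : s ≠ 1 := by rintro rfl; simp at h2; norm_num at h2
    rw [dslope_of_ne _ hne, slope_def_field, norm_div, div_le_iff₀ (by linarith)]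
    have h3 := hC 1 1 s hs
    have h4 : ‖regL (1 : DirichletCharacter ℂ 1) s - regL 1 1‖ ≤ C * condSize 1 s ^ ε + N :=
      (norm_sub_le _ _).trans (by linarith)
    refine h4.trans ?_
    calc C * condSize 1 s ^ ε + N ≤ (2 * C + 2 * N + M) * condSize 1 s ^ ε * (1 / 2) := by
          nlinarith
      _ ≤ _ := by gcongr

lemma regL_level_one_one : regL (1 : DirichletCharacter ℂ 1) 1 = 1 / 2 := by
  rw [regL, if_pos rfl, DirichletCharacter.LFunctionTrivChar₁]
  simp
  norm_num

/-- Growth control of a logarithmic derivative near a point where the function is not small. -/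
lemma norm_ge_and_norm_logDeriv_le {f : ℂ → ℂ} {s : ℂ} {ρ U : ℝ} (hρ : 0 < ρ) (hU : 1 ≤ U)
    (hf : ∀ w ∈ Metric.closedBall s (2 * ρ), DifferentiableAt ℂ f w)
    (hfU : ∀ w ∈ Metric.closedBall s (2 * ρ), ‖f w‖ ≤ U) (hs : 1 / U ≤ ‖f s‖) :
    ∀ w ∈ Metric.closedBall s (ρ / (2 * U ^ 2)),
      f w ≠ 0 ∧ ‖deriv f w / f w‖ ≤ 2 * U ^ 2 / ρ := by
  have hsub : ∀ w ∈ Metric.closedBall s ρ, Metric.closedBall w ρ ⊆ Metric.closedBall s (2 * ρ) := by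
    intro w hw z hz
    rw [Metric.mem_closedBall] at *
    linarith [dist_triangle z w s]
  have hderiv : ∀ w ∈ Metric.closedBall s ρ, ‖deriv f w‖ ≤ U / ρ := by
    intro w hw
    refine Complex.norm_deriv_le_of_forall_mem_sphere_norm_le hρ
      (DifferentiableOn.diffContOnCl ?_)
      (fun z hz ↦ hfU z (hsub w hw (Metric.sphere_subset_closedBall hz)))
    rw [closure_ball _ hρ.ne']
    exact fun z hz ↦ (hf z (hsub w hw hz)).differentiableWithinAt
  have hr : ρ / (2 * U ^ 2) ≤ ρ := div_le_self hρ.le (by nlinarith)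
  intro w hw
  have hw' : w ∈ Metric.closedBall s ρ := Metric.closedBall_subset_closedBall hr hw
  have h1 : ‖f w - f s‖ ≤ U / ρ * ‖w - s‖ :=
    (convex_closedBall s ρ).norm_image_sub_le_of_norm_deriv_le
      (fun z hz ↦ hf z (Metric.closedBall_subset_closedBall (by linarith) hz)) hderiv
      (by simp [hρ.le]) hw'
  have h2 : U / ρ * ‖w - s‖ ≤ 1 / (2 * U) := by
    have : ‖w - s‖ ≤ ρ / (2 * U ^ 2) := by simpa [dist_eq_norm] using hw
    calc U / ρ * ‖w - s‖ ≤ U / ρ * (ρ / (2 * U ^ 2)) := by gcongr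
      _ = 1 / (2 * U) := by field_simp
  have h3 : 1 / (2 * U) ≤ ‖f w‖ := by
    have := norm_sub_norm_le (f s) (f w)
    rw [norm_sub_rev] at this
    have h4 : 1 / U = 2 * (1 / (2 * U)) := by field_simp
    linarith
  have hpos : 0 < 1 / (2 * U) := by positivity
  refine ⟨fun h ↦ ?_, ?_⟩
  · rw [h, norm_zero] at h3; linarith
  · rw [norm_div, div_le_iff₀ (by linarith)]
    calc ‖deriv f w‖ ≤ U / ρ := hderiv w hw'
      _ = 2 * U ^ 2 / ρ * (1 / (2 * U)) := by field_simp
      _ ≤ _ := by gcongr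

/-- The generating Dirichlet series of the error term in the prime number theorem for an
arithmetic progression. -/
noncomputable def errorSeries {q : ℕ} (a : ZMod q) (s : ℂ) : ℂ :=
  LSeries (fun n ↦ (ArithmeticFunction.vonMangoldt.residueClass a n : ℂ)) s -
    (q.totient : ℂ)⁻¹ * riemannZeta s

/-- The analytic continuation of `errorSeries`. -/
noncomputable def errorSeriesExt {q : ℕ} [NeZero q] (a : ZMod q) (s : ℂ) : ℂ :=
  -(q.totient : ℂ)⁻¹ * (∑ χ : DirichletCharacter ℂ q, χ a⁻¹ * (deriv (regL χ) s / regL χ s) +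
    (1 / (s + 1) + regL (1 : DirichletCharacter ℂ 1) s +
      2 * dslope (regL (1 : DirichletCharacter ℂ 1)) 1 s))

lemma logDeriv_regL_one {q : ℕ} [NeZero q] {s : ℂ} (hs : 1 < s.re) :
    deriv (DirichletCharacter.LFunction (1 : DirichletCharacter ℂ q)) s /
      DirichletCharacter.LFunction (1 : DirichletCharacter ℂ q) s =
    deriv (regL (1 : DirichletCharacter ℂ q)) s / regL (1 : DirichletCharacter ℂ q) s
      + 1 / (s + 1) - 1 / (s - 1) := by
  have hs1 : s ≠ 1 := by rintro rfl; simp at hs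
  have hs0 : s - 1 ≠ 0 := sub_ne_zero.2 hs1
  have hs2 : s + 1 ≠ 0 := by
    intro h
    have := congrArg Complex.re h
    simp at this
    linarith
  set L := DirichletCharacter.LFunction (1 : DirichletCharacter ℂ q) with hL
  have hLne : L s ≠ 0 :=
    DirichletCharacter.LFunction_ne_zero_of_one_le_re 1 (.inr hs1) hs.le
  have hLd : HasDerivAt L (deriv L s) s :=
    (DirichletCharacter.differentiableAt_LFunction 1 s (.inl hs1)).hasDerivAt
  have h1 : HasDerivAt (fun z : ℂ ↦ (z - 1) * L z / (z + 1))
      (((1 * L s + (s - 1) * deriv L s) * (s + 1) - (s - 1) * L s * 1) / (s + 1) ^ 2) s :=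
    (((hasDerivAt_id s).sub_const 1).mul hLd).div ((hasDerivAt_id s).add_const 1) hs2
  have heq : regL (1 : DirichletCharacter ℂ q) =ᶠ[nhds s] fun z : ℂ ↦ (z - 1) * L z / (z + 1) := by
    filter_upwards [isOpen_ne.mem_nhds hs1] with z hz
    rw [regL_one_of_ne hz, ← hL]
    ring
  rw [heq.deriv_eq, h1.deriv, heq.eq_of_nhds]
  field_simp
  ring

lemma errorSeries_eq_ext {q : ℕ} [NeZero q] {a : ZMod q} (ha : IsUnit a) {s : ℂ}
    (hs : 1 < s.re) : errorSeries a s = errorSeriesExt a s := by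
  have hs1 : s ≠ 1 := by rintro rfl; simp at hs
  have hs0 : s - 1 ≠ 0 := sub_ne_zero.2 hs1
  have hs2 : s + 1 ≠ 0 := by
    intro h
    have := congrArg Complex.re h
    simp at this
    linarith
  have ha' : IsUnit a⁻¹ := isUnit_of_dvd_one ⟨a, (ZMod.inv_mul_of_unit a ha).symm⟩
  rw [errorSeries, errorSeriesExt, ArithmeticFunction.vonMangoldt.LSeries_residueClass_eq ha hs,
    Fintype.sum_eq_add_sum_compl 1, Fintype.sum_eq_add_sum_compl 1,
    Finset.sum_congr rfl (g := fun χ : DirichletCharacter ℂ q ↦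
      χ a⁻¹ * (deriv (regL χ) s / regL χ s)), MulChar.one_apply ha', logDeriv_regL_one hs,
    dslope_of_ne _ hs1, slope_def_field, regL_level_one_one]
  · rw [regL_one_of_ne (q := 1) hs1, DirichletCharacter.LFunction_modOne_eq]
    field_simp
    ring
  · intro χ hχ
    rw [regL_of_ne_one (by simpa using hχ)]

lemma analyticAt_regL {q : ℕ} [NeZero q] (χ : DirichletCharacter ℂ q) {s : ℂ} (hs : 0 < s.re) :
    AnalyticAt ℂ (regL χ) s := by
  have hopen : IsOpen {s : ℂ | 0 < s.re} := isOpen_lt continuous_const Complex.continuous_re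
  exact DifferentiableOn.analyticAt (s := {s : ℂ | 0 < s.re})
    (fun w hw ↦ (differentiableAt_regL χ hw).differentiableWithinAt) (hopen.mem_nhds hs)

lemma differentiableAt_errorSeriesExt {q : ℕ} [NeZero q] (a : ZMod q) {s : ℂ} (hs : 0 < s.re)
    (hne : ∀ χ : DirichletCharacter ℂ q, regL χ s ≠ 0) :
    DifferentiableAt ℂ (errorSeriesExt a) s := by
  have hopen : IsOpen {s : ℂ | 0 < s.re} := isOpen_lt continuous_const Complex.continuous_re
  have h1 : s + 1 ≠ 0 := by
    intro h
    have := congrArg Complex.re h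
    simp at this
    linarith
  have h2 := (differentiableOn_dslope_regL (1 : DirichletCharacter ℂ 1)).differentiableAt
    (hopen.mem_nhds hs)
  have h3 := differentiableAt_regL (1 : DirichletCharacter ℂ 1) hs
  have h4 : DifferentiableAt ℂ (fun z ↦ ∑ χ : DirichletCharacter ℂ q,
      χ a⁻¹ * (deriv (regL χ) z / regL χ z)) s :=
    DifferentiableAt.fun_sum fun χ _ ↦
      ((analyticAt_regL χ hs).deriv.differentiableAt.fun_div
        (differentiableAt_regL χ hs) (hne χ)).const_mul _
  have h5 : DifferentiableAt ℂ (fun z : ℂ ↦ 1 / (z + 1)) s :=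
    (differentiableAt_const _).fun_div (differentiableAt_id.add_const _) h1
  exact (h4.fun_add ((h5.fun_add h3).fun_add (h2.const_mul 2))).const_mul _

lemma norm_errorSeriesExt_le {q : ℕ} [NeZero q] (a : ZMod q) {s : ℂ} {V : ℝ}
    (hV : ∀ χ : DirichletCharacter ℂ q, ‖deriv (regL χ) s / regL χ s‖ ≤ V) :
    ‖errorSeriesExt a s‖ ≤ V + (‖1 / (s + 1)‖ + ‖regL (1 : DirichletCharacter ℂ 1) s‖ +
      2 * ‖dslope (regL (1 : DirichletCharacter ℂ 1)) 1 s‖) := by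
  have hq : (1 : ℝ) ≤ q.totient := by
    exact_mod_cast Nat.totient_pos.2 (NeZero.pos q)
  set E := ‖1 / (s + 1)‖ + ‖regL (1 : DirichletCharacter ℂ 1) s‖ +
      2 * ‖dslope (regL (1 : DirichletCharacter ℂ 1)) 1 s‖ with hE
  have hE0 : 0 ≤ E := by positivity
  rw [errorSeriesExt, norm_mul, norm_neg, norm_inv, Complex.norm_natCast,
    inv_mul_le_iff₀ (by linarith)]
  have h1 : ‖∑ χ : DirichletCharacter ℂ q, χ a⁻¹ * (deriv (regL χ) s / regL χ s)‖ ≤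
      q.totient * V := by
    refine (norm_sum_le _ _).trans ?_
    calc _ ≤ ∑ χ : DirichletCharacter ℂ q, V := by
          refine Finset.sum_le_sum fun χ _ ↦ ?_
          rw [norm_mul]
          refine le_trans ?_ (hV χ)
          exact mul_le_of_le_one_left (norm_nonneg _) (χ.norm_le_one _)
      _ = q.totient * V := by
        rw [Finset.sum_const, nsmul_eq_mul, Finset.card_univ, ← Nat.card_eq_fintype_card,
          DirichletCharacter.card_eq_totient_of_hasEnoughRootsOfUnity]
  refine (norm_add_le _ _).trans ?_
  have h2 : ‖1 / (s + 1) + regL (1 : DirichletCharacter ℂ 1) s +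
      2 * dslope (regL (1 : DirichletCharacter ℂ 1)) 1 s‖ ≤ E := by
    refine (norm_add_le _ _).trans ?_
    rw [norm_mul, Complex.norm_ofNat]
    linarith [norm_add_le (1 / (s + 1)) (regL (1 : DirichletCharacter ℂ 1) s)]
  nlinarith

lemma condSize_one_le (q : ℕ) [NeZero q] (s : ℂ) : condSize 1 s ≤ condSize q s := by
  unfold condSize
  have : (1 : ℝ) ≤ q := by exact_mod_cast NeZero.pos q
  push_cast
  nlinarith [norm_nonneg s]

/-- All derivatives of the error series have small growth up to the line `re s = 1`. -/
lemma norm_iteratedDeriv_errorSeries_le (k : ℕ) :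
    ∃ C : ℝ, 0 < C ∧ ∀ (q : ℕ) [NeZero q] (a : ZMod q), IsUnit a → ∀ s : ℂ, 1 < s.re → s.re ≤ 2 →
      ‖iteratedDeriv k (errorSeries a) s‖ ≤ C * condSize q s ^ (1 / 2 : ℝ) := by
  set ε : ℝ := 1 / (4 * (k + 1)) with hε
  have hεpos : 0 < ε := by positivity
  have hε1 : ε ≤ 1 := by
    rw [hε, div_le_one (by positivity)]
    have : (0 : ℝ) ≤ k := by positivity
    linarith
  obtain ⟨C, hC1, hC⟩ := norm_regL_le hεpos hε1
  obtain ⟨c, hc, hlow⟩ := norm_regL_ge hεpos hε1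
  obtain ⟨C', hC'1, hC'⟩ := norm_dslope_regL_le hεpos hε1
  set ρ : ℝ := ε / 4 with hρ
  have hρpos : 0 < ρ := by positivity
  set K : ℝ := 2 * C + 1 / c with hK
  have hcinv : 0 < 1 / c := by positivity
  have hK1 : 1 ≤ K := by linarith
  refine ⟨k.factorial * ((2 / ρ + 1 + 2 * C + 4 * C') * (2 / ρ) ^ k) * K ^ (2 * (k + 1)),
    by positivity, fun q _ a ha s hs1 hs2 ↦ ?_⟩
  have hcs := two_le_condSize q s
  set Y := condSize q s ^ ε with hY
  have hY1 : 1 ≤ Y := Real.one_le_rpow (by linarith) hεpos.le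
  have hYhalf : condSize q s ^ (1 / 2 : ℝ) = Y ^ (2 * (k + 1)) := by
    rw [hY, ← Real.rpow_natCast, ← Real.rpow_mul (by linarith), hε]
    congr 1
    push_cast
    field_simp
    norm_num
  set U := K * Y with hU
  have hU1 : 1 ≤ U := one_le_mul_of_one_le_of_one_le hK1 hY1
  set r := ρ / (2 * U ^ 2) with hr
  have hrpos : 0 < r := by positivity
  have hrρ : r ≤ 2 * ρ := (div_le_self hρpos.le (by nlinarith)).trans (by linarith)
  have hre : ∀ w ∈ Metric.closedBall s (2 * ρ), 1 - ε / 2 ≤ w.re := by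
    intro w hw
    have h1 : ‖w - s‖ ≤ 2 * ρ := by simpa [dist_eq_norm] using hw
    have h2 := (abs_le.1 ((Complex.abs_re_le_norm _).trans h1)).1
    simp at h2
    linarith
  have hsize : ∀ w ∈ Metric.closedBall s (2 * ρ), condSize q w ^ ε ≤ 2 * Y := by
    intro w hw
    refine condSize_rpow_le hεpos.le hε1 (by norm_num) ?_
    have h1 : ‖w - s‖ ≤ 2 * ρ := by simpa [dist_eq_norm] using hw
    have h2 : ‖w‖ ≤ ‖w - s‖ + ‖s‖ := by simpa using norm_add_le (w - s) s
    linarith [norm_nonneg s]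
  have hsize1 : ∀ w ∈ Metric.closedBall s (2 * ρ), condSize 1 w ^ ε ≤ 2 * Y := by
    intro w hw
    refine le_trans ?_ (hsize w hw)
    have := two_le_condSize 1 w
    gcongr
    exact condSize_one_le q w
  have hlog : ∀ w ∈ Metric.closedBall s r, ∀ χ : DirichletCharacter ℂ q,
      regL χ w ≠ 0 ∧ ‖deriv (regL χ) w / regL χ w‖ ≤ 2 * U ^ 2 / ρ := by
    intro w hw χ
    refine norm_ge_and_norm_logDeriv_le hρpos hU1
      (fun z hz ↦ differentiableAt_regL χ (by linarith [hre z hz])) (fun z hz ↦ ?_) ?_ w hw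
    · refine (hC q χ z (hre z hz)).trans ?_
      calc C * condSize q z ^ ε ≤ C * (2 * Y) := by gcongr; exact hsize z hz
        _ ≤ U := by rw [hU, hK]; nlinarith
    · have h1 := hlow q χ s hs1 hs2
      rw [div_le_iff₀ (by linarith)]
      have h2 : 1 ≤ 1 / c * (Y * ‖regL χ s‖) := by
        rw [div_mul_eq_mul_div, le_div_iff₀ hc]; linarith
      have h3 : 0 ≤ 2 * C * (Y * ‖regL χ s‖) := by positivity
      rw [hU, hK]
      linarith
  have hext : errorSeries a =ᶠ[nhds s] errorSeriesExt a := by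
    have hopen : IsOpen {s : ℂ | 1 < s.re} := isOpen_lt continuous_const Complex.continuous_re
    filter_upwards [hopen.mem_nhds hs1] with z hz
    exact errorSeries_eq_ext ha hz
  rw [hext.iteratedDeriv_eq]
  have hUY : Y ≤ U ^ 2 := by
    have : Y ≤ U := le_mul_of_one_le_left (by linarith) hK1
    nlinarith
  have hcauchy := Complex.norm_iteratedDeriv_le_of_forall_mem_sphere_norm_le
    (f := errorSeriesExt a) (c := s) (R := r) k
    (C := (2 / ρ + 1 + 2 * C + 4 * C') * U ^ 2) hrpos ?_ ?_
  · refine hcauchy.trans (le_of_eq ?_)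
    rw [hYhalf, hr, div_eq_mul_inv, ← inv_pow, inv_div, mul_div_right_comm,
      mul_pow (2 / ρ), hU]
    ring_nf
  · refine DifferentiableOn.diffContOnCl ?_
    rw [closure_ball _ hrpos.ne']
    intro w hw
    refine (differentiableAt_errorSeriesExt a ?_ fun χ ↦ (hlog w hw χ).1).differentiableWithinAt
    linarith [hre w (Metric.closedBall_subset_closedBall hrρ hw)]
  · intro w hw
    have hw1 := Metric.sphere_subset_closedBall hw
    have hw2 := Metric.closedBall_subset_closedBall hrρ hw1
    have hwre := hre w hw2
    refine (norm_errorSeriesExt_le a fun χ ↦ (hlog w hw1 χ).2).trans ?_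
    have h1 : ‖1 / (w + 1)‖ ≤ 1 := by
      rw [norm_div, norm_one]
      exact div_le_one_of_le₀ (one_le_norm_add_one (by linarith)) (norm_nonneg _)
    have h2 : ‖regL (1 : DirichletCharacter ℂ 1) w‖ ≤ C * (2 * Y) :=
      (hC 1 1 w hwre).trans (by gcongr; exact hsize1 w hw2)
    have h3 : ‖dslope (regL (1 : DirichletCharacter ℂ 1)) 1 w‖ ≤ C' * (2 * Y) :=
      (hC' w hwre).trans (by gcongr; exact hsize1 w hw2)
    have h4 : C * (2 * Y) ≤ C * (2 * U ^ 2) := by gcongr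
    have h5 : C' * (2 * Y) ≤ C' * (2 * U ^ 2) := by gcongr
    have h6 : 1 ≤ U ^ 2 := one_le_pow₀ hU1
    have h7 : 2 * U ^ 2 / ρ = 2 / ρ * U ^ 2 := by ring
    nlinarith

lemma hasMellin_tent {s : ℂ} (hs : 0 < s.re) :
    HasMellin (fun u : ℝ ↦ ((max (1 - u) 0 : ℝ) : ℂ)) s (1 / (s * (s + 1))) := by
  have hs0 : s ≠ 0 := by rintro rfl; simp at hs
  have hs1 : s + 1 ≠ 0 := by
    intro h
    have := congrArg Complex.re h
    simp at this
    linarith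
  have h1 := hasMellin_one_Ioc hs
  have h2 := hasMellin_cpow_Ioc 1 (s := s) (by simp; linarith)
  have h3 := hasMellin_sub h1.1 h2.1
  rw [h1.2, h2.2] at h3
  have heq : Set.EqOn (fun t : ℝ ↦ (t : ℂ) ^ (s - 1) •
      (Set.indicator (Set.Ioc 0 1) (fun _ ↦ 1 : ℝ → ℂ) t -
        Set.indicator (Set.Ioc 0 1) (fun t ↦ (t : ℂ) ^ (1 : ℂ) : ℝ → ℂ) t))
      (fun t : ℝ ↦ (t : ℂ) ^ (s - 1) • ((max (1 - t) 0 : ℝ) : ℂ)) (Set.Ioi 0) := by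
    intro t ht
    have ht' : 0 < t := ht
    dsimp only
    congr 1
    by_cases h : t ≤ 1
    · have hm : t ∈ Set.Ioc (0 : ℝ) 1 := ⟨ht, h⟩
      rw [Set.indicator_of_mem hm, Set.indicator_of_mem hm, max_eq_left (by linarith)]
      simp
    · have hm : t ∉ Set.Ioc (0 : ℝ) 1 := fun h' ↦ h h'.2
      rw [Set.indicator_of_notMem hm, Set.indicator_of_notMem hm, max_eq_right (by linarith)]
      simp
  refine ⟨h3.1.congr_fun heq measurableSet_Ioi, ?_⟩
  rw [mellin, ← MeasureTheory.setIntegral_congr_fun measurableSet_Ioi heq]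
  refine h3.2.trans ?_
  field_simp
  ring

lemma norm_perronKernel_le {c : ℝ} (hc : 1 ≤ c) (t : ℝ) :
    ‖1 / (((c : ℂ) + t * Complex.I) * (c + t * Complex.I + 1))‖ ≤ (1 + ‖t‖ ^ 2) ^ (-2 / 2 : ℝ) := by
  set s : ℂ := (c : ℂ) + t * Complex.I with hs
  have hre : s.re = c := by simp [hs]
  have him : s.im = t := by simp [hs]
  have h1 : 1 + t ^ 2 ≤ ‖s‖ ^ 2 := by
    rw [Complex.sq_norm, Complex.normSq_apply, hre, him]; nlinarith
  have h2 : ‖s‖ ≤ ‖s + 1‖ := by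
    refine (sq_le_sq₀ (norm_nonneg _) (norm_nonneg _)).1 ?_
    rw [Complex.sq_norm, Complex.sq_norm, Complex.normSq_apply, Complex.normSq_apply]
    simp [hre, him]
    nlinarith
  rw [norm_div, norm_one, norm_mul, Real.norm_eq_abs, sq_abs,
    show (-2 / 2 : ℝ) = -1 by norm_num, Real.rpow_neg_one, one_div]
  apply inv_anti₀ (by positivity)
  nlinarith [norm_nonneg s]

lemma integrable_perronKernel {c : ℝ} (hc : 1 ≤ c) :
    MeasureTheory.Integrable
      (fun t : ℝ ↦ 1 / (((c : ℂ) + t * Complex.I) * (c + t * Complex.I + 1))) := by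
  have h1 : MeasureTheory.Integrable (fun t : ℝ ↦ (1 + ‖t‖ ^ 2) ^ (-2 / 2 : ℝ)) :=
    integrable_rpow_neg_one_add_norm_sq (by simp)
  refine h1.mono' (Continuous.aestronglyMeasurable ?_)
    (Filter.Eventually.of_forall fun t ↦ norm_perronKernel_le hc t)
  refine continuous_const.div (by fun_prop) fun t h ↦ ?_
  rcases mul_eq_zero.1 h with h | h <;>
  · have := congrArg Complex.re h
    simp at this
    linarith

lemma tent_eq_integral {c : ℝ} (hc : 1 ≤ c) {u : ℝ} (hu : 0 < u) :
    ((max (1 - u) 0 : ℝ) : ℂ) = (1 / (2 * Real.pi) : ℝ) • ∫ t : ℝ,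
      (u : ℂ) ^ (-((c : ℂ) + t * Complex.I)) *
        (1 / (((c : ℂ) + t * Complex.I) * (c + t * Complex.I + 1))) := by
  have hm : ∀ t : ℝ, mellin (fun u : ℝ ↦ ((max (1 - u) 0 : ℝ) : ℂ)) ((c : ℂ) + t * Complex.I) =
      1 / (((c : ℂ) + t * Complex.I) * (c + t * Complex.I + 1)) := fun t ↦
    (hasMellin_tent (by simp; linarith)).2
  have h := mellinInv_mellin_eq c (fun u : ℝ ↦ ((max (1 - u) 0 : ℝ) : ℂ)) hu
    (hasMellin_tent (by simp; linarith)).1 ?_ (by fun_prop)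
  · rw [← h, mellinInv]
    simp only [hm, smul_eq_mul]
  · unfold Complex.VerticalIntegrable
    simp only [hm]
    exact integrable_perronKernel hc

/-- Perron's formula with a Fejér-type weight. -/
lemma tsum_mul_tent_eq_integral {b : ℕ → ℂ} (hb0 : b 0 = 0) {c x : ℝ} (hc : 1 ≤ c) (hx : 0 < x)
    (hb : LSeriesSummable b c) :
    ∑' n, b n * ((max (1 - n / x) 0 : ℝ) : ℂ) = (1 / (2 * Real.pi) : ℝ) • ∫ t : ℝ,
      LSeries b (c + t * Complex.I) * (x : ℂ) ^ ((c : ℂ) + t * Complex.I) *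
        (1 / (((c : ℂ) + t * Complex.I) * (c + t * Complex.I + 1))) := by
  set k : ℝ → ℂ := fun t ↦ 1 / (((c : ℂ) + t * Complex.I) * (c + t * Complex.I + 1)) with hk
  have hxc : (x : ℂ) ≠ 0 := by exact_mod_cast hx.ne'
  set F : ℕ → ℝ → ℂ := fun n t ↦ LSeries.term b (c + t * Complex.I) n *
    (x : ℂ) ^ ((c : ℂ) + t * Complex.I) * k t with hF
  have hnorm : ∀ n t, ‖F n t‖ = ‖LSeries.term b c n‖ * x ^ c * ‖k t‖ := by
    intro n t
    rw [hF]
    dsimp only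
    rw [norm_mul, norm_mul, LSeries.norm_term_eq, LSeries.norm_term_eq,
      Complex.norm_cpow_eq_rpow_re_of_pos hx]
    simp
  have hcont : ∀ n, Continuous fun t : ℝ ↦ LSeries.term b (c + t * Complex.I) n := by
    intro n
    rcases eq_or_ne n 0 with rfl | hn
    · simpa using continuous_const
    · have hn' : (n : ℂ) ≠ 0 := by exact_mod_cast hn
      simp only [LSeries.term_of_ne_zero hn]
      refine continuous_const.div ?_ fun t ↦ by simp [Complex.cpow_eq_zero_iff, hn']
      exact Continuous.const_cpow (by fun_prop) (.inl hn')
  have hkint := integrable_perronKernel hc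
  have hFint : ∀ n, MeasureTheory.Integrable (F n) := by
    intro n
    refine (hkint.norm.const_mul (‖LSeries.term b c n‖ * x ^ c)).mono' ?_
      (Filter.Eventually.of_forall fun t ↦ (hnorm n t).le)
    refine (Continuous.aestronglyMeasurable ?_).mul hkint.aestronglyMeasurable
    exact (hcont n).mul (Continuous.const_cpow (by fun_prop) (.inl hxc))
  have hsum : Summable fun n ↦ ∫ t, ‖F n t‖ := by
    simp only [hnorm, MeasureTheory.integral_const_mul]
    exact (hb.norm.mul_right _).mul_right _
  have hterm : ∀ n, b n * ((max (1 - n / x) 0 : ℝ) : ℂ) = (1 / (2 * Real.pi) : ℝ) • ∫ t, F n t := by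
    intro n
    rcases eq_or_ne n 0 with rfl | hn
    · simp [hF, hb0]
    · have hn0 : (0 : ℝ) < n := by exact_mod_cast Nat.pos_of_ne_zero hn
      have hn' : (n : ℂ) ≠ 0 := by exact_mod_cast hn
      rw [tent_eq_integral hc (div_pos hn0 hx), mul_smul_comm, ← MeasureTheory.integral_const_mul]
      congr 1
      refine MeasureTheory.integral_congr_ae (Filter.Eventually.of_forall fun t ↦ ?_)
      simp only [hF, LSeries.term_of_ne_zero hn, hk]
      rw [Complex.ofReal_div, Complex.div_cpow_ofReal_nonneg hn0.le hx.le, Complex.ofReal_natCast, Complex.cpow_neg,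
        Complex.cpow_neg]
      have h1 : (n : ℂ) ^ ((c : ℂ) + t * Complex.I) ≠ 0 := by simp [Complex.cpow_eq_zero_iff, hn']
      have h2 : (x : ℂ) ^ ((c : ℂ) + t * Complex.I) ≠ 0 := by simp [Complex.cpow_eq_zero_iff, hxc]
      field_simp
  have hmain := MeasureTheory.integral_tsum_of_summable_integral_norm hFint hsum
  simp only [hterm]
  rw [tsum_const_smul'', hmain]
  congr 1
  refine MeasureTheory.integral_congr_ae (Filter.Eventually.of_forall fun t ↦ ?_)
  simp only [hF, hk, LSeries, tsum_mul_right]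

/-- The error term in the prime number theorem for arithmetic progressions, as an arithmetic
function. -/
noncomputable def errorCoeff {q : ℕ} (a : ZMod q) (n : ℕ) : ℝ :=
  ArithmeticFunction.vonMangoldt.residueClass a n - (q.totient : ℝ)⁻¹

lemma abs_errorCoeff_le {q : ℕ} [NeZero q] (a : ZMod q) (n : ℕ) :
    |errorCoeff a n| ≤ Real.log n + 1 := by
  have h1 := ArithmeticFunction.vonMangoldt.residueClass_nonneg a n
  have h2 := ArithmeticFunction.vonMangoldt.residueClass_le a n
  have h3 : ArithmeticFunction.vonMangoldt n ≤ Real.log n :=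
    ArithmeticFunction.vonMangoldt_le_log
  have h4 : (1 : ℝ) ≤ q.totient := by
    exact_mod_cast Nat.totient_pos.2 (NeZero.pos q)
  have h5 := inv_le_one_of_one_le₀ h4
  have h6 : 0 ≤ (q.totient : ℝ)⁻¹ := by positivity
  rw [errorCoeff, abs_le]
  constructor <;> linarith

lemma LSeriesSummable_errorCoeff {q : ℕ} (a : ZMod q) {s : ℂ} (hs : 1 < s.re) :
    LSeriesSummable (fun n ↦ (errorCoeff a n : ℂ)) s ∧
      LSeries (fun n ↦ (errorCoeff a n : ℂ)) s = errorSeries a s := by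
  have h1 : LSeriesSummable (fun n ↦
      (ArithmeticFunction.vonMangoldt.residueClass a n : ℂ)) s :=
    LSeriesSummable_of_abscissaOfAbsConv_lt_re
      ((ArithmeticFunction.vonMangoldt.abscissaOfAbsConv_residueClass_le_one a).trans_lt
        (by exact_mod_cast hs))
  have h2 : LSeriesSummable ((q.totient : ℂ)⁻¹ • (1 : ℕ → ℂ)) s :=
    (LSeriesSummable_one_iff.2 hs).smul _
  have heq : (fun n ↦ (errorCoeff a n : ℂ)) =
      (fun n ↦ (ArithmeticFunction.vonMangoldt.residueClass a n : ℂ)) -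
        (q.totient : ℂ)⁻¹ • (1 : ℕ → ℂ) := by
    ext n
    simp [errorCoeff]
  rw [heq]
  refine ⟨h1.sub h2, ?_⟩
  rw [LSeries_sub h1 h2, LSeries_smul, LSeries_one_eq_riemannZeta hs, errorSeries]

lemma abscissaOfAbsConv_errorCoeff_le {q : ℕ} (a : ZMod q) :
    LSeries.abscissaOfAbsConv (fun n ↦ (errorCoeff a n : ℂ)) ≤ 1 := by
  refine LSeries.abscissaOfAbsConv_le_of_forall_lt_LSeriesSummable fun y hy ↦ ?_
  exact (LSeriesSummable_errorCoeff a (by exact_mod_cast hy)).1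

lemma iterate_logMul_apply (f : ℕ → ℂ) (k n : ℕ) :
    (LSeries.logMul^[k] f) n = Complex.log n ^ k * f n := by
  induction k generalizing f with
  | zero => simp
  | succ k ih => rw [Function.iterate_succ_apply, ih, LSeries.logMul]; ring

lemma norm_LSeries_log_pow_le (k : ℕ) :
    ∃ C : ℝ, 0 < C ∧ ∀ (q : ℕ) [NeZero q] (a : ZMod q), IsUnit a → ∀ s : ℂ, 1 < s.re → s.re ≤ 2 →
      ‖LSeries (fun n ↦ ((Real.log n ^ k * errorCoeff a n : ℝ) : ℂ)) s‖ ≤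
        C * condSize q s ^ (1 / 2 : ℝ) ∧
      LSeriesSummable (fun n ↦ ((Real.log n ^ k * errorCoeff a n : ℝ) : ℂ)) s := by
  obtain ⟨C, hC, h⟩ := norm_iteratedDeriv_errorSeries_le k
  refine ⟨C, hC, fun q _ a ha s hs1 hs2 ↦ ?_⟩
  have heq : (fun n : ℕ ↦ ((Real.log n ^ k * errorCoeff a n : ℝ) : ℂ)) =
      LSeries.logMul^[k] (fun n ↦ (errorCoeff a n : ℂ)) := by
    ext n
    rw [iterate_logMul_apply, ← Complex.natCast_log]
    push_cast
    rfl
  have hlt : LSeries.abscissaOfAbsConv (fun n ↦ (errorCoeff a n : ℂ)) < s.re :=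
    (abscissaOfAbsConv_errorCoeff_le a).trans_lt (by exact_mod_cast hs1)
  rw [heq]
  constructor
  · have h1 := LSeries_iteratedDeriv (f := fun n ↦ (errorCoeff a n : ℂ)) k hlt
    have h2 : LSeries (fun n ↦ (errorCoeff a n : ℂ)) =ᶠ[nhds s] errorSeries a := by
      have hopen : IsOpen {s : ℂ | 1 < s.re} := isOpen_lt continuous_const Complex.continuous_re
      filter_upwards [hopen.mem_nhds hs1] with z hz
      exact (LSeriesSummable_errorCoeff a hz).2
    rw [h2.iteratedDeriv_eq] at h1
    have h3 := congrArg norm h1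
    rw [norm_mul, norm_pow, norm_neg, norm_one, one_pow, one_mul] at h3
    rw [← h3]
    exact h q a ha s hs1 hs2
  · apply LSeriesSummable_of_abscissaOfAbsConv_lt_re
    rwa [LSeries.absicssaOfAbsConv_logPowMul]

lemma norm_tsum_tent_le (k : ℕ) (hk : k ≠ 0) :
    ∃ C : ℝ, 0 < C ∧ ∀ (q : ℕ) [NeZero q] (a : ZMod q), IsUnit a → ∀ x : ℝ, 1 ≤ Real.log x →
      0 < x → |∑' n : ℕ, Real.log n ^ k * errorCoeff a n * max (1 - n / x) 0| ≤
        C * √q * x := by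
  obtain ⟨C, hC, h⟩ := norm_LSeries_log_pow_le k
  set J := ∫ t : ℝ, (1 + ‖t‖ ^ 2) ^ (-(3 / 2) / 2 : ℝ) with hJ
  have hJint : MeasureTheory.Integrable (fun t : ℝ ↦ (1 + ‖t‖ ^ 2) ^ (-(3 / 2) / 2 : ℝ)) :=
    integrable_rpow_neg_one_add_norm_sq (by simp; norm_num)
  have hJ0 : 0 ≤ J := MeasureTheory.integral_nonneg fun t ↦ by positivity
  refine ⟨C * 2 * Real.exp 1 * J + 1, by positivity, fun q _ a ha x hx hx0 ↦ ?_⟩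
  set b : ℕ → ℂ := fun n ↦ ((Real.log n ^ k * errorCoeff a n : ℝ) : ℂ) with hb
  set c : ℝ := 1 + 1 / Real.log x with hc
  have hlog : 0 < 1 / Real.log x := by positivity
  have hlog1 : 1 / Real.log x ≤ 1 := by rw [div_le_one (by linarith)]; exact hx
  have hc1 : 1 < c := by linarith
  have hc2 : c ≤ 2 := by linarith
  have hxc : x ^ c = Real.exp 1 * x := by
    rw [hc, Real.rpow_add hx0, Real.rpow_one, Real.rpow_def_of_pos hx0,
      mul_one_div_cancel (by linarith), mul_comm]
  have hb0 : b 0 = 0 := by simp [hb, hk]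
  have hperron := tsum_mul_tent_eq_integral hb0 hc1.le hx0
    (h q a ha c (by simpa using hc1) (by simpa using hc2)).2
  have hcast : ((∑' n : ℕ, Real.log n ^ k * errorCoeff a n * max (1 - n / x) 0 : ℝ) : ℂ) =
      ∑' n : ℕ, b n * ((max (1 - n / x) 0 : ℝ) : ℂ) := by
    rw [Complex.ofReal_tsum]
    refine tsum_congr fun n ↦ ?_
    rw [hb]; push_cast; rfl
  rw [← Real.norm_eq_abs, ← Complex.norm_real, hcast, hperron, norm_smul]
  have hbound : ∀ t : ℝ, ‖LSeries b (c + t * Complex.I) * (x : ℂ) ^ ((c : ℂ) + t * Complex.I) *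
        (1 / (((c : ℂ) + t * Complex.I) * (c + t * Complex.I + 1)))‖ ≤
      C * 2 * Real.exp 1 * √q * x * (1 + ‖t‖ ^ 2) ^ (-(3 / 2) / 2 : ℝ) := by
    intro t
    set s : ℂ := (c : ℂ) + t * Complex.I with hs
    have hre : s.re = c := by simp [hs]
    have him : s.im = t := by simp [hs]
    have hnsq : 1 + ‖t‖ ^ 2 ≤ ‖s‖ ^ 2 := by
      rw [Complex.sq_norm, Complex.normSq_apply, hre, him, Real.norm_eq_abs, sq_abs]; nlinarith
    have hn1 : 1 ≤ ‖s‖ := by nlinarith [norm_nonneg s, sq_nonneg ‖t‖]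
    have h2 : ‖s‖ ≤ ‖s + 1‖ := by
      refine (sq_le_sq₀ (norm_nonneg _) (norm_nonneg _)).1 ?_
      rw [Complex.sq_norm, Complex.sq_norm, Complex.normSq_apply, Complex.normSq_apply]
      simp [hre, him]
      nlinarith
    have hL := (h q a ha s (by rw [hre]; exact hc1) (by rw [hre]; exact hc2)).1
    have hcs : condSize q s ^ (1 / 2 : ℝ) ≤ √q * 2 * ‖s‖ ^ (1 / 2 : ℝ) := by
      rw [condSize, Real.sqrt_eq_rpow]
      calc ((q : ℝ) * (‖s‖ + 2)) ^ (1 / 2 : ℝ) ≤ (q * (2 ^ 2 * ‖s‖)) ^ (1 / 2 : ℝ) := by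
            gcongr; linarith
        _ = _ := by
          rw [Real.mul_rpow (by positivity) (by positivity),
            Real.mul_rpow (by positivity) (by positivity), ← Real.sqrt_eq_rpow (2 ^ 2),
            Real.sqrt_sq (by norm_num)]
          ring
    have hker : ‖s‖ ^ (1 / 2 : ℝ) * ‖1 / (s * (s + 1))‖ ≤ (1 + ‖t‖ ^ 2) ^ (-(3 / 2) / 2 : ℝ) := by
      rw [norm_div, norm_one, norm_mul]
      calc ‖s‖ ^ (1 / 2 : ℝ) * (1 / (‖s‖ * ‖s + 1‖)) ≤ ‖s‖ ^ (1 / 2 : ℝ) * (1 / (‖s‖ * ‖s‖)) := by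
            gcongr
        _ = (‖s‖ ^ 2) ^ (-(3 / 2) / 2 : ℝ) := by
          rw [← Real.rpow_natCast, ← Real.rpow_mul (by positivity), one_div (_ * _), ← sq,
            ← Real.rpow_natCast, ← Real.rpow_neg (by positivity), ← Real.rpow_add (by linarith)]
          norm_num
        _ ≤ _ := Real.rpow_le_rpow_of_nonpos (by positivity) hnsq (by norm_num)
    rw [norm_mul, norm_mul, Complex.norm_cpow_eq_rpow_re_of_pos hx0, hre, hxc]
    calc ‖LSeries b s‖ * (Real.exp 1 * x) * ‖1 / (s * (s + 1))‖
        ≤ C * (√q * 2 * ‖s‖ ^ (1 / 2 : ℝ)) * (Real.exp 1 * x) * ‖1 / (s * (s + 1))‖ := by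
          gcongr
          exact hL.trans (by gcongr)
      _ = C * 2 * Real.exp 1 * √q * x * (‖s‖ ^ (1 / 2 : ℝ) * ‖1 / (s * (s + 1))‖) := by ring
      _ ≤ _ := by gcongr
  have hJnorm := MeasureTheory.norm_integral_le_of_norm_le (hJint.const_mul
    (C * 2 * Real.exp 1 * √q * x)) (Filter.Eventually.of_forall hbound)
  rw [MeasureTheory.integral_const_mul, ← hJ] at hJnorm
  have hpi : ‖(1 / (2 * Real.pi) : ℝ)‖ ≤ 1 := by
    rw [Real.norm_of_nonneg (by positivity), div_le_one (by positivity)]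
    linarith [Real.two_le_pi]
  calc _ ≤ 1 * (C * 2 * Real.exp 1 * √q * x * J) := by gcongr
    _ ≤ _ := by
      have : 0 ≤ √q * x := by positivity
      nlinarith

lemma tsum_mul_tent_eq_sum (b : ℕ → ℝ) {N : ℕ} (hN : 0 < N) :
    (∑' n : ℕ, b n * max (1 - (n : ℝ) / N) 0) * N = ∑ n ∈ Finset.range N, b n * ((N : ℝ) - n) := by
  have hN' : (0 : ℝ) < N := by exact_mod_cast hN
  rw [tsum_eq_sum (s := Finset.range N), Finset.sum_mul]
  · refine Finset.sum_congr rfl fun n hn ↦ ?_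
    have : (n : ℝ) ≤ N := by exact_mod_cast (Finset.mem_range.1 hn).le
    rw [max_eq_left (by rw [sub_nonneg]; exact div_le_one_of_le₀ this hN'.le)]
    field_simp
  · intro n hn
    have : (N : ℝ) ≤ n := by exact_mod_cast not_lt.1 (fun h ↦ hn (Finset.mem_range.2 h))
    rw [max_eq_right (by rw [sub_nonpos, le_div_iff₀ hN']; linarith), mul_zero]

/-- Recovering partial sums from the sums with weights `N - n`. -/
lemma abs_sum_mul_le_of_weighted (b : ℕ → ℝ) {N H : ℕ} {M : ℝ}
    (hM : ∀ n < N + H, |b n| ≤ M) :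
    |∑ n ∈ Finset.range N, b n| * H ≤
      |∑ n ∈ Finset.range (N + H), b n * (((N + H : ℕ) : ℝ) - n)| +
      |∑ n ∈ Finset.range N, b n * ((N : ℝ) - n)| + H * (M * H) := by
  have h1 : ∑ n ∈ Finset.range (N + H), b n * (((N + H : ℕ) : ℝ) - n) =
      ∑ n ∈ Finset.range N, b n * ((N : ℝ) - n) + (∑ n ∈ Finset.range N, b n) * H +
      ∑ n ∈ Finset.range H, b (N + n) * ((H : ℝ) - n) := by
    rw [Finset.sum_range_add, Finset.sum_mul, ← Finset.sum_add_distrib]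
    congr 1
    · refine Finset.sum_congr rfl fun n _ ↦ ?_
      push_cast; ring
    · refine Finset.sum_congr rfl fun n _ ↦ ?_
      push_cast; ring
  have h2 : |∑ n ∈ Finset.range H, b (N + n) * ((H : ℝ) - n)| ≤ H * (M * H) := by
    refine (Finset.abs_sum_le_sum_abs _ _).trans ?_
    calc _ ≤ ∑ n ∈ Finset.range H, M * H := by
          refine Finset.sum_le_sum fun n hn ↦ ?_
          have hn' := Finset.mem_range.1 hn
          have h3 : (n : ℝ) ≤ H := by exact_mod_cast hn'.le
          have h4 := hM (N + n) (by omega)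
          rw [abs_mul]
          have h5 : |(H : ℝ) - n| ≤ H := by
            rw [abs_of_nonneg (by linarith)]
            linarith [(Nat.cast_nonneg n : (0 : ℝ) ≤ n)]
          exact mul_le_mul h4 h5 (abs_nonneg _) ((abs_nonneg _).trans h4)
      _ = _ := by rw [Finset.sum_const, Finset.card_range, nsmul_eq_mul]
  have h3 : (∑ n ∈ Finset.range N, b n) * H =
      ∑ n ∈ Finset.range (N + H), b n * (((N + H : ℕ) : ℝ) - n) -
      ∑ n ∈ Finset.range N, b n * ((N : ℝ) - n) -
      ∑ n ∈ Finset.range H, b (N + n) * ((H : ℝ) - n) := by rw [h1]; ring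
  rw [← abs_of_nonneg (Nat.cast_nonneg H : (0 : ℝ) ≤ H), ← abs_mul, h3,
    abs_of_nonneg (Nat.cast_nonneg H : (0 : ℝ) ≤ H)]
  refine (abs_sub _ _).trans (add_le_add (abs_sub _ _) h2)

lemma pow_le_factorial_mul {N : ℝ} (hN : 0 < N) (E : ℕ) (hl : 0 ≤ Real.log N) :
    Real.log N ^ E ≤ E.factorial * N := by
  have := Real.pow_div_factorial_le_exp (Real.log N) hl E
  rwa [Real.exp_log hN, div_le_iff₀' (by positivity)] at this

lemma abs_sum_log_pow_errorCoeff_le (E : ℕ) (hE : E ≠ 0) :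
    ∃ C : ℝ, 0 < C ∧ ∀ (q : ℕ) [NeZero q] (a : ZMod q), IsUnit a → ∀ N : ℕ, 1 ≤ Real.log N →
      |∑ n ∈ Finset.range N, Real.log n ^ (2 * E) * errorCoeff a n| ≤
        C * √q * N * Real.log N ^ (E + 1) := by
  obtain ⟨C, hC, h⟩ := norm_tsum_tent_le (2 * E) (by omega)
  refine ⟨5 * C + (E.factorial + 1) * 3 ^ (2 * E + 1), by positivity,
    fun q _ a ha N hN ↦ ?_⟩
  set b : ℕ → ℝ := fun n ↦ Real.log n ^ (2 * E) * errorCoeff a n with hb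
  set l := Real.log N with hl
  have hN0 : 0 < N := by
    rcases Nat.eq_zero_or_pos N with h0 | h0
    · rw [hl, h0] at hN; simp at hN; norm_num at hN
    · exact h0
  have hNr : (0 : ℝ) < N := by exact_mod_cast hN0
  have hq1 : 1 ≤ √(q : ℝ) := by
    rw [Real.one_le_sqrt]; exact_mod_cast NeZero.pos q
  have hT : ∀ m : ℕ, N ≤ m → |∑ n ∈ Finset.range m, b n * ((m : ℝ) - n)| ≤ C * √q * m ^ 2 := by
    intro m hm
    have hmr : (0 : ℝ) < m := by exact_mod_cast hN0.trans_le hm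
    have hm1 : 1 ≤ Real.log m := hN.trans (Real.log_le_log hNr (by exact_mod_cast hm))
    rw [← tsum_mul_tent_eq_sum b (hN0.trans_le hm), abs_mul, abs_of_pos hmr]
    calc _ ≤ C * √q * m * m := by gcongr; exact h q a ha m hm1 hmr
      _ = _ := by ring
  have hlE : (1 : ℝ) ≤ l ^ E := one_le_pow₀ hN
  set H := ⌈(N : ℝ) / l ^ E⌉₊ with hH
  have hHpos : 0 < (N : ℝ) / l ^ E := by positivity
  have hH1 : (N : ℝ) / l ^ E ≤ H := Nat.le_ceil _
  have hHN : H ≤ N := Nat.ceil_le.2 (div_le_self hNr.le hlE)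
  have hH0 : (0 : ℝ) < H := hHpos.trans_le hH1
  have hfact : l ^ E ≤ E.factorial * N := pow_le_factorial_mul hNr E (by linarith)
  have hH2 : (H : ℝ) ≤ (E.factorial + 1) * N / l ^ E := by
    have h1 : (H : ℝ) < (N : ℝ) / l ^ E + 1 := Nat.ceil_lt_add_one hHpos.le
    have h2 : 1 ≤ E.factorial * N / l ^ E := by rw [le_div_iff₀ (by positivity)]; linarith
    calc (H : ℝ) ≤ N / l ^ E + 1 := h1.le
      _ ≤ N / l ^ E + E.factorial * N / l ^ E := by linarith
      _ = _ := by ring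
  have hM : ∀ n < N + H, |b n| ≤ (3 * l) ^ (2 * E + 1) := by
    intro n hn
    have hlogn : Real.log n + 1 ≤ 3 * l ∧ 0 ≤ Real.log n := by
      refine ⟨?_, Real.log_natCast_nonneg n⟩
      rcases Nat.eq_zero_or_pos n with rfl | hn0
      · simp; linarith
      · have : Real.log n ≤ Real.log (2 * N) :=
          Real.log_le_log (by exact_mod_cast hn0) (by
            have : n ≤ 2 * N := by omega
            exact_mod_cast this)
        rw [Real.log_mul (by norm_num) hNr.ne'] at this
        have h2 : Real.log 2 ≤ 1 := by linarith [Real.log_two_lt_d9]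
        linarith
    rw [hb]
    dsimp only
    rw [abs_mul, abs_pow, abs_of_nonneg hlogn.2, pow_succ (3 * l)]
    gcongr
    · linarith [hlogn.1]
    · exact (abs_errorCoeff_le a n).trans hlogn.1
  have hmain := abs_sum_mul_le_of_weighted b (N := N) (H := H) hM
  have h1 := hT (N + H) (by omega)
  have h2 := hT N le_rfl
  have h3 : (((N + H : ℕ) : ℝ)) ^ 2 ≤ 4 * N ^ 2 := by
    have : ((N + H : ℕ) : ℝ) ≤ 2 * N := by
      have : N + H ≤ 2 * N := by omega
      exact_mod_cast this
    calc (((N + H : ℕ) : ℝ)) ^ 2 ≤ (2 * N) ^ 2 := by gcongr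
      _ = _ := by ring
  have h4 : |∑ n ∈ Finset.range N, b n| * H ≤
      (5 * C * √q * N ^ 2 / H + (3 * l) ^ (2 * E + 1) * H) * H := by
    have h5 : C * √q * ((N + H : ℕ) : ℝ) ^ 2 ≤ C * √q * (4 * N ^ 2) := by gcongr
    have h6 : (5 * C * √q * N ^ 2 / H + (3 * l) ^ (2 * E + 1) * H) * H =
        5 * C * √q * N ^ 2 + H * ((3 * l) ^ (2 * E + 1) * H) := by field_simp
    rw [h6]
    linarith
  have h5 := le_of_mul_le_mul_right h4 hH0
  refine h5.trans ?_
  have h6 : 5 * C * √q * N ^ 2 / H ≤ 5 * C * √q * N * l ^ (E + 1) := by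
    calc 5 * C * √q * N ^ 2 / H ≤ 5 * C * √q * N ^ 2 / (N / l ^ E) := by gcongr
      _ = 5 * C * √q * N * l ^ E := by field_simp
      _ ≤ _ := by gcongr; omega
  have h7 : (3 * l) ^ (2 * E + 1) * H ≤ (E.factorial + 1) * 3 ^ (2 * E + 1) * √q * N * l ^ (E + 1) := by
    calc (3 * l) ^ (2 * E + 1) * H ≤ (3 * l) ^ (2 * E + 1) * ((E.factorial + 1) * N / l ^ E) := by
          gcongr
      _ = (E.factorial + 1) * 3 ^ (2 * E + 1) * 1 * N * l ^ (E + 1) := by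
        rw [mul_pow, show 2 * E + 1 = E + (E + 1) by ring, pow_add l]
        field_simp
      _ ≤ _ := by gcongr
  linarith

/-- Partial summation against a nonnegative decreasing weight. -/
lemma abs_sum_mul_antitone_le {b w : ℕ → ℝ} {M N : ℕ} {K : ℝ} (hMN : M ≤ N)
    (hw0 : ∀ n, M ≤ n → 0 ≤ w n) (hw : ∀ n, M ≤ n → w (n + 1) ≤ w n)
    (hb : ∀ m, M ≤ m → m ≤ N → |∑ n ∈ Finset.Ico M m, b n| ≤ K) :
    |∑ n ∈ Finset.Ico M N, w n * b n| ≤ K * w M := by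
  have key : ∀ m, M ≤ m → m ≤ N → |∑ n ∈ Finset.Ico M m, w n * b n -
      w m * ∑ n ∈ Finset.Ico M m, b n| ≤ K * (w M - w m) := by
    intro m hm
    induction m, hm using Nat.le_induction with
    | base => simp
    | succ m hm ih =>
      intro hmN
      have h1 := ih (by omega)
      have h2 := hb (m + 1) (by omega) hmN
      have h3 : ∑ n ∈ Finset.Ico M (m + 1), w n * b n -
          w (m + 1) * ∑ n ∈ Finset.Ico M (m + 1), b n =
          (∑ n ∈ Finset.Ico M m, w n * b n - w m * ∑ n ∈ Finset.Ico M m, b n) +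
          (w m - w (m + 1)) * ∑ n ∈ Finset.Ico M (m + 1), b n := by
        rw [Finset.sum_Ico_succ_top hm, Finset.sum_Ico_succ_top hm]; ring
      rw [h3]
      refine (abs_add_le _ _).trans ?_
      have h4 : 0 ≤ w m - w (m + 1) := sub_nonneg.2 (hw m hm)
      rw [abs_mul, abs_of_nonneg h4]
      nlinarith
  have h1 := key N hMN le_rfl
  have h2 := hb N hMN le_rfl
  have h3 := hw0 N hMN
  have h4 : |w N * ∑ n ∈ Finset.Ico M N, b n| ≤ w N * K := by
    rw [abs_mul, abs_of_nonneg h3]; gcongr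
  have h5 := abs_add_le (∑ n ∈ Finset.Ico M N, w n * b n -
      w N * ∑ n ∈ Finset.Ico M N, b n) (w N * ∑ n ∈ Finset.Ico M N, b n)
  rw [sub_add_cancel] at h5
  linarith

/-- A form of the Siegel–Walfisz theorem. -/
lemma abs_sum_errorCoeff_le (E : ℕ) (hE : E ≠ 0) :
    ∃ C : ℝ, 0 < C ∧ ∀ (q : ℕ) [NeZero q] (a : ZMod q), IsUnit a → ∀ N : ℕ, 2 ≤ Real.log N →
      |∑ n ∈ Finset.range N, errorCoeff a n| ≤ C * √q * N * Real.log N / Real.log N ^ E := by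
  obtain ⟨C, hC, h⟩ := abs_sum_log_pow_errorCoeff_le E hE
  refine ⟨2 * C * 2 ^ (2 * E) + 4 * 2 ^ E * E.factorial, by positivity, fun q _ a ha N hN ↦ ?_⟩
  set l := Real.log N with hl
  have hN0 : 0 < N := by
    rcases Nat.eq_zero_or_pos N with h0 | h0
    · rw [hl, h0] at hN; simp at hN; norm_num at hN
    · exact h0
  have hNr : (0 : ℝ) < N := by exact_mod_cast hN0
  have hN1 : (1 : ℝ) ≤ N := by exact_mod_cast hN0
  have hq1 : 1 ≤ √(q : ℝ) := by
    rw [Real.one_le_sqrt]; exact_mod_cast NeZero.pos q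
  have hs1 : 1 ≤ √(N : ℝ) := by rwa [Real.one_le_sqrt]
  set M := ⌈√(N : ℝ)⌉₊ with hM
  have hM1 : √(N : ℝ) ≤ M := Nat.le_ceil _
  have hM2 : (M : ℝ) ≤ 2 * √(N : ℝ) := by
    linarith [Nat.ceil_lt_add_one (Real.sqrt_nonneg (N : ℝ))]
  have hMN : M ≤ N := Nat.ceil_le.2 (by
    rw [Real.sqrt_le_left (by linarith)]; nlinarith)
  have hMr : (0 : ℝ) < M := by linarith
  have hlM : l / 2 ≤ Real.log M := by
    have := Real.log_le_log (by linarith) hM1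
    rwa [Real.log_sqrt hNr.le] at this
  have hlMm : ∀ m : ℕ, M ≤ m → 1 ≤ Real.log m := fun m hm ↦ by
    have : Real.log M ≤ Real.log m := Real.log_le_log hMr (by exact_mod_cast hm)
    linarith
  have hS : ∀ m, M ≤ m → m ≤ N →
      |∑ n ∈ Finset.range m, Real.log n ^ (2 * E) * errorCoeff a n| ≤
        C * √q * N * l ^ (E + 1) := by
    intro m hm hmN
    have h1 := hlMm m hm
    refine (h q a ha m h1).trans ?_
    have h2 : (m : ℝ) ≤ N := by exact_mod_cast hmN
    have h3 : Real.log m ≤ l := Real.log_le_log (hMr.trans_le (by exact_mod_cast hm)) h2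
    gcongr
  have hIco : |∑ n ∈ Finset.Ico M N, (Real.log n ^ (2 * E))⁻¹ *
      (Real.log n ^ (2 * E) * errorCoeff a n)| ≤
      2 * (C * √q * N * l ^ (E + 1)) * (Real.log M ^ (2 * E))⁻¹ := by
    refine abs_sum_mul_antitone_le (w := fun n : ℕ ↦ (Real.log n ^ (2 * E))⁻¹) hMN
      (fun n hn ↦ ?_) (fun n hn ↦ ?_) (fun m hm hmN ↦ ?_)
    · have := hlMm n hn
      positivity
    · have := hlMm n hn
      have hn0 : (0 : ℝ) < n := hMr.trans_le (by exact_mod_cast hn)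
      apply inv_anti₀ (by positivity)
      gcongr
      linarith
    · rw [Finset.sum_Ico_eq_sub _ hm]
      refine (abs_sub _ _).trans ?_
      linarith [hS m hm hmN, hS M le_rfl hMN]
  have hIco' : |∑ n ∈ Finset.Ico M N, errorCoeff a n| ≤
      2 * C * 2 ^ (2 * E) * √q * N * l / l ^ E := by
    have h1 : ∑ n ∈ Finset.Ico M N, errorCoeff a n = ∑ n ∈ Finset.Ico M N,
        (Real.log n ^ (2 * E))⁻¹ * (Real.log n ^ (2 * E) * errorCoeff a n) := by
      refine Finset.sum_congr rfl fun n hn ↦ ?_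
      have := hlMm n (Finset.mem_Ico.1 hn).1
      field_simp
    rw [h1]
    refine hIco.trans ?_
    calc 2 * (C * √q * N * l ^ (E + 1)) * (Real.log M ^ (2 * E))⁻¹
        ≤ 2 * (C * √q * N * l ^ (E + 1)) * ((l / 2) ^ (2 * E))⁻¹ := by gcongr
      _ = _ := by
        rw [div_pow, show l ^ (2 * E) = l ^ E * l ^ E by ring, pow_succ]
        field_simp
  have hsmall : |∑ n ∈ Finset.range M, errorCoeff a n| ≤
      4 * 2 ^ E * E.factorial * √q * N * l / l ^ E := by
    refine (Finset.abs_sum_le_sum_abs _ _).trans ?_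
    have h1 : ∑ n ∈ Finset.range M, |errorCoeff a n| ≤ ∑ n ∈ Finset.range M, 2 * l := by
      refine Finset.sum_le_sum fun n hn ↦ (abs_errorCoeff_le a n).trans ?_
      have hnM := Finset.mem_range.1 hn
      rcases Nat.eq_zero_or_pos n with rfl | hn0
      · simp; linarith
      · have : Real.log n ≤ l := Real.log_le_log (by exact_mod_cast hn0)
          (by exact_mod_cast (hnM.le.trans hMN))
        linarith
    refine h1.trans ?_
    rw [Finset.sum_const, Finset.card_range, nsmul_eq_mul]
    have h2 : l ^ E ≤ 2 ^ E * E.factorial * √N := by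
      have := pow_le_factorial_mul (N := √(N : ℝ)) (by linarith) E
        (by rw [Real.log_sqrt hNr.le]; linarith)
      rw [Real.log_sqrt hNr.le, ← hl, div_pow, div_le_iff₀ (by positivity)] at this
      linarith
    rw [le_div_iff₀ (by positivity)]
    calc M * (2 * l) * l ^ E ≤ (2 * √N) * (2 * l) * (2 ^ E * E.factorial * √N) := by gcongr
      _ = 4 * 2 ^ E * E.factorial * 1 * (√N * √N) * l := by ring
      _ = 4 * 2 ^ E * E.factorial * 1 * N * l := by rw [Real.mul_self_sqrt hNr.le]
      _ ≤ _ := by gcongr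
  rw [← Finset.sum_range_add_sum_Ico _ hMN]
  refine (abs_add_le _ _).trans ((add_le_add hsmall hIco').trans (le_of_eq ?_))
  ring

lemma abs_theta_sub_sum_residueClass_le (x : ℝ) (hx : 1 ≤ x) (q : ℕ) (a : ℤ) :
    |theta x q a - ∑ n ∈ Finset.range ⌈x⌉₊,
        ArithmeticFunction.vonMangoldt.residueClass (a : ZMod q) n| ≤
      2 * √(⌈x⌉₊ : ℝ) * Real.log ⌈x⌉₊ := by
  set N := ⌈x⌉₊ with hN
  have hN1 : (1 : ℝ) ≤ N := hx.trans (Nat.le_ceil x)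
  have h1 : ∑ n ∈ Finset.range N, ArithmeticFunction.vonMangoldt.residueClass (a : ZMod q) n =
      theta x q a + ∑ n ∈ Finset.range N with ¬ n.Prime,
        ArithmeticFunction.vonMangoldt.residueClass (a : ZMod q) n := by
    rw [← Finset.sum_filter_add_sum_filter_not _ (fun n : ℕ ↦ n.Prime), theta,
      ← Finset.filter_filter, Finset.sum_filter (fun p : ℕ ↦ (p : ZMod q) = (a : ZMod q))]
    congr 1
    refine Finset.sum_congr rfl fun n hn ↦ ?_
    have hp : n.Prime := (Finset.mem_filter.1 hn).2
    simp only [ArithmeticFunction.vonMangoldt.residueClass, Set.indicator_apply,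
      Set.mem_ofPred_eq, ArithmeticFunction.vonMangoldt_apply_prime hp]
  have h2 : 0 ≤ ∑ n ∈ Finset.range N with ¬ n.Prime,
      ArithmeticFunction.vonMangoldt.residueClass (a : ZMod q) n :=
    Finset.sum_nonneg fun n _ ↦ ArithmeticFunction.vonMangoldt.residueClass_nonneg _ n
  have h3 : ∑ n ∈ Finset.range N with ¬ n.Prime,
      ArithmeticFunction.vonMangoldt.residueClass (a : ZMod q) n ≤
        Chebyshev.psi N - Chebyshev.theta N := by
    rw [Chebyshev.psi_sub_theta_eq_sum_not_prime, Nat.floor_natCast, Finset.sum_filter,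
      Finset.sum_filter]
    calc _ ≤ ∑ n ∈ Finset.range N, if ¬ n.Prime then ArithmeticFunction.vonMangoldt n else 0 := by
          refine Finset.sum_le_sum fun n _ ↦ ?_
          split_ifs
          · exact le_rfl
          · exact ArithmeticFunction.vonMangoldt.residueClass_le _ n
      _ ≤ ∑ n ∈ Finset.range (N + 1), if ¬ n.Prime then ArithmeticFunction.vonMangoldt n else 0 := by
          refine Finset.sum_le_sum_of_subset_of_nonneg (by simp) fun n _ _ ↦ ?_
          split_ifs
          · exact le_rfl
          · exact ArithmeticFunction.vonMangoldt_nonneg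
      _ = _ := by
          refine (Finset.sum_subset (fun n hn ↦ ?_) fun n hn hn' ↦ ?_).symm
          · rw [Finset.mem_Ioc] at hn
            exact Finset.mem_range.2 (by omega)
          · rw [Finset.mem_range] at hn
            rw [Finset.mem_Ioc] at hn'
            obtain rfl : n = 0 := by omega
            simp
  rw [h1, sub_add_cancel_left, abs_neg, abs_of_nonneg h2]
  exact h3.trans (Chebyshev.psi_sub_theta_le hN1)

lemma abs_theta_sub_le (k : ℕ) :
    ∃ C : ℝ, 0 < C ∧ ∀ (q : ℕ) (a : ℤ), q ≠ 0 → IsCoprime (q : ℤ) a → ∀ x : ℝ,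
      2 ≤ Real.log x → 0 < x →
      |theta x q a - x / (q.totient : ℝ)| ≤ C * √q * x / Real.log x ^ k := by
  obtain ⟨C, hC, h⟩ := abs_sum_errorCoeff_le (k + 1) k.succ_ne_zero
  set F : ℝ := ((2 * k + 2).factorial : ℝ) with hF
  refine ⟨2 * (C + 3 * F), by positivity, fun q a hq hqa x hx hx0 ↦ ?_⟩
  have : NeZero q := ⟨hq⟩
  have hx1 : 1 ≤ x := by
    by_contra! hlt
    linarith [Real.log_nonpos hx0.le hlt.le]
  have h1 := abs_theta_sub_sum_residueClass_le x hx1 q a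
  set N := ⌈x⌉₊ with hN
  have hxN : x ≤ N := Nat.le_ceil x
  have hNx : (N : ℝ) < x + 1 := Nat.ceil_lt_add_one hx0.le
  have hN0 : (0 : ℝ) < N := hx0.trans_le hxN
  have hll : Real.log x ≤ Real.log N := Real.log_le_log hx0 hxN
  set l := Real.log N with hl
  have hl0 : 0 < l := by linarith
  have h2 := h q a ((ZMod.coe_int_isUnit_iff_isCoprime _ _).2 hqa) N (hx.trans hll)
  have hq1 : (1 : ℝ) ≤ q.totient := by
    exact_mod_cast Nat.totient_pos.2 (Nat.pos_of_ne_zero hq)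
  have hsq : 1 ≤ √(q : ℝ) := by
    rw [Real.one_le_sqrt]
    exact_mod_cast Nat.one_le_iff_ne_zero.2 hq
  have hF1 : 1 ≤ F := by rw [hF]; exact_mod_cast Nat.factorial_pos (2 * k + 2)
  have h3 : |(N : ℝ) / q.totient - x / q.totient| ≤ 1 := by
    rw [← sub_div, abs_of_nonneg (div_nonneg (by linarith) (by linarith)),
      div_le_one (by linarith)]
    linarith
  have h4 : ∑ n ∈ Finset.range N, errorCoeff (a : ZMod q) n =
      ∑ n ∈ Finset.range N, ArithmeticFunction.vonMangoldt.residueClass (a : ZMod q) n -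
        N / q.totient := by
    simp only [errorCoeff, Finset.sum_sub_distrib, Finset.sum_const, Finset.card_range,
      nsmul_eq_mul, div_eq_mul_inv]
  have h5 : l ^ (k + 1) ≤ F * √N := by
    have := pow_le_factorial_mul hN0 (2 * k + 2) hl0.le
    refine (sq_le_sq₀ (by positivity) (by positivity)).1 ?_
    calc (l ^ (k + 1)) ^ 2 = l ^ (2 * k + 2) := by ring
      _ ≤ F * N := this
      _ ≤ F ^ 2 * N := by gcongr; nlinarith
      _ = (F * √N) ^ 2 := by rw [mul_pow, Real.sq_sqrt hN0.le]
  have h6 : 2 * √N * l + 1 ≤ 3 * F * √q * N * l / l ^ (k + 1) := by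
    rw [le_div_iff₀ (by positivity)]
    have hs : 1 ≤ √(N : ℝ) := by rw [Real.one_le_sqrt]; linarith
    calc (2 * √N * l + 1) * l ^ (k + 1) ≤ (3 * √N * l) * (F * √N) := by
          gcongr
          nlinarith
      _ = 3 * F * 1 * (√N * √N) * l := by ring
      _ ≤ 3 * F * √q * N * l := by
          rw [Real.mul_self_sqrt hN0.le]
          gcongr
  rw [h4] at h2
  set S := ∑ n ∈ Finset.range N, ArithmeticFunction.vonMangoldt.residueClass (a : ZMod q) n
  calc |theta x q a - x / q.totient| ≤ |theta x q a - S| + |S - N / q.totient| +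
          |(N : ℝ) / q.totient - x / q.totient| :=
        (abs_sub_le _ ((N : ℝ) / q.totient) _).trans (by gcongr; exact abs_sub_le _ _ _)
    _ ≤ 2 * √N * l + C * √q * N * l / l ^ (k + 1) + 1 := by gcongr
    _ ≤ C * √q * N * l / l ^ (k + 1) + 3 * F * √q * N * l / l ^ (k + 1) := by linarith
    _ = (C + 3 * F) * √q * N / l ^ k := by
        rw [pow_succ]
        field_simp
    _ ≤ (C + 3 * F) * √q * (2 * x) / Real.log x ^ k := by
        gcongr
        linarith
    _ = _ := by ring

lemma isCoprime_of_modEq_two {m n : ℕ} {a : ℤ} (hm : Odd m) (hn : Odd n)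
    (h1 : a ≡ -2 [ZMOD ((m : ℤ) ^ 2)]) (h2 : a ≡ 2 [ZMOD ((n : ℤ) ^ 2)]) :
    IsCoprime ((m ^ 2 * n ^ 2 : ℕ) : ℤ) a := by
  have key : ∀ {k : ℕ} {c : ℤ}, Odd k → IsCoprime (k : ℤ) c → a ≡ c [ZMOD ((k : ℤ) ^ 2)] →
      IsCoprime ((k : ℤ) ^ 2) a := by
    intro k c _ hc h
    obtain ⟨d, hd⟩ := h.dvd
    have : a = c + (k : ℤ) ^ 2 * (-d) := by linarith
    rw [this]
    exact (IsCoprime.pow_left hc).add_mul_left_right _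
  have h2' : ∀ {k : ℕ}, Odd k → IsCoprime (k : ℤ) 2 := fun hk ↦
    Nat.isCoprime_iff_coprime.2 (Nat.coprime_two_right.2 hk)
  push_cast
  exact (key hm (h2' hm).neg_right h1).mul_left (key hn (h2' hn) h2)

/-- For `0 < A < B` and residues `a(m,n) ≡ -2 (mod m²)`, `a(m,n) ≡ 2 (mod n²)`, the sum of the
errors `|θ(x; m²n², a(m,n)) - x/φ(m²n²)|` over odd coprime pairs `m, n` strictly between
`(log x)^A` and `(log x)^B` is `O(x/(log x)^D)` as `x → ∞`, for every `D > 0`. -/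
theorem error_term_bound (A B : ℝ) (hA : 0 < A) (hAB : A < B)
    (a : ℕ → ℕ → ℤ)
    (ha : ∀ m n : ℕ, 0 < m → 0 < n → Odd m → Odd n → Nat.Coprime m n →
      a m n ≡ -2 [ZMOD ((m : ℤ) ^ 2)] ∧ a m n ≡ 2 [ZMOD ((n : ℤ) ^ 2)])
    (D : ℝ) (hD : 0 < D) :
    Asymptotics.IsBigO Filter.atTop
      (fun x : ℝ =>
        ∑ m ∈ Finset.range ⌈Real.log x ^ B⌉₊, ∑ n ∈ Finset.range ⌈Real.log x ^ B⌉₊,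
          if 0 < m ∧ 0 < n ∧ Odd m ∧ Odd n ∧ Nat.Coprime m n ∧
              Real.log x ^ A < m ∧ (m : ℝ) < Real.log x ^ B ∧
              Real.log x ^ A < n ∧ (n : ℝ) < Real.log x ^ B
            then |theta x (m ^ 2 * n ^ 2) (a m n) - x / (Nat.totient (m ^ 2 * n ^ 2) : ℝ)|
            else 0)
      (fun x : ℝ => x / Real.log x ^ D) := by
  obtain ⟨k, hk⟩ := exists_nat_ge (4 * B + D)
  obtain ⟨C, hC, h⟩ := abs_theta_sub_le k
  refine Asymptotics.IsBigO.of_bound (4 * C) ?_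
  filter_upwards [Real.tendsto_log_atTop.eventually_ge_atTop 2, Filter.eventually_gt_atTop 0]
    with x hx hx0
  set l := Real.log x with hl
  have hl0 : 0 < l := by linarith
  have hL1 : 1 ≤ l ^ B := Real.one_le_rpow (by linarith) (hA.trans hAB).le
  set L := l ^ B with hL
  have hterm : ∀ m n : ℕ, ‖(if 0 < m ∧ 0 < n ∧ Odd m ∧ Odd n ∧ Nat.Coprime m n ∧
      l ^ A < m ∧ (m : ℝ) < L ∧ l ^ A < n ∧ (n : ℝ) < L
      then |theta x (m ^ 2 * n ^ 2) (a m n) - x / (Nat.totient (m ^ 2 * n ^ 2) : ℝ)|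
      else 0)‖ ≤ C * (L * L) * x / l ^ k := by
    intro m n
    split_ifs with hmn
    · obtain ⟨hm0, hn0, hm, hn, hmn', -, hmL, -, hnL⟩ := hmn
      obtain ⟨h1, h2⟩ := ha m n hm0 hn0 hm hn hmn'
      rw [norm_abs_eq_norm, Real.norm_eq_abs]
      refine (h _ _ (by positivity) (isCoprime_of_modEq_two hm hn h1 h2) x hx hx0).trans ?_
      have hs : √((m ^ 2 * n ^ 2 : ℕ) : ℝ) = m * n := by
        rw [show ((m ^ 2 * n ^ 2 : ℕ) : ℝ) = ((m : ℝ) * n) ^ 2 by push_cast; ring,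
          Real.sqrt_sq (by positivity)]
      rw [hs]
      gcongr
    · rw [norm_zero]
      positivity
  have hcard : (⌈L⌉₊ : ℝ) ≤ 2 * L := by linarith [Nat.ceil_lt_add_one (zero_le_one.trans hL1)]
  have hsum : ∀ f : ℕ → ℕ → ℝ, (∀ m n, ‖f m n‖ ≤ C * (L * L) * x / l ^ k) →
      ‖∑ m ∈ Finset.range ⌈L⌉₊, ∑ n ∈ Finset.range ⌈L⌉₊, f m n‖ ≤
        ⌈L⌉₊ * (⌈L⌉₊ * (C * (L * L) * x / l ^ k)) := by
    intro f hf
    have := norm_sum_le_of_le (Finset.range ⌈L⌉₊) (f := fun m ↦ ∑ n ∈ Finset.range ⌈L⌉₊, f m n)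
      fun m _ ↦ norm_sum_le_of_le (Finset.range ⌈L⌉₊) fun n _ ↦ hf m n
    simpa using this
  refine (hsum _ hterm).trans ?_
  calc (⌈L⌉₊ : ℝ) * (⌈L⌉₊ * (C * (L * L) * x / l ^ k))
      ≤ (2 * L) * ((2 * L) * (C * (L * L) * x / l ^ k)) := by gcongr
    _ = 4 * C * (x * (L ^ 4 / l ^ k)) := by ring
    _ ≤ 4 * C * ‖x / l ^ D‖ := by
        rw [Real.norm_of_nonneg (by positivity), div_eq_mul_inv x]
        gcongr
        rw [hL, ← Real.rpow_natCast l k, ← Real.rpow_natCast (l ^ B), ← Real.rpow_mul hl0.le,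
          ← Real.rpow_sub hl0, ← Real.rpow_neg hl0.le]
        apply Real.rpow_le_rpow_of_exponent_le (by linarith)
        push_cast
        linarith
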